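/- arXiv:math/0608243 — 4 statements merged into one kernel-verified Lean document; each statement's English description precedes it below -/
import Mathlib

section
/- For Lebesgue-almost every x ∈ (0,1), the number m(x,n) of regular continued fraction partial quotients of x determined by its first n decimal digits satisfies lim_{n→∞} m(x,n)/n = (6·log 2·log 10)/π². -/
open MeasureTheory Filter Set

/-- The `g`-adic cylinder of rank `n` containing `x`. -/
noncomputable def radixCyl (g : ℕ) (n : ℕ) (x : ℝ) : Set ℝ :=
  Set.Ico ((⌊(g : ℝ) ^ n * x⌋ : ℝ) / (g : ℝ) ^ n) (((⌊(g : ℝ) ^ n * x⌋ : ℝ) + 1) / (g : ℝ) ^ n)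

/-- The Gauss (continued fraction) map. -/
noncomputable def gauss (x : ℝ) : ℝ := 1 / x - ⌊1 / x⌋

/-- `cfDigit i x` is the `(i+1)`-st partial quotient `a_{i+1}(x) = ⌊1 / G^i(x)⌋`. -/
noncomputable def cfDigit (i : ℕ) (x : ℝ) : ℤ := ⌊1 / gauss^[i] x⌋

/-- The number of regular continued fraction partial quotients of `x` determined by its
first `n` decimal digits: the largest `m` such that every irrational point of the decimal
cylinder of rank `n` at `x` has the same first `m` partial quotients as `x`. -/
noncomputable def mDecCF (x : ℝ) (n : ℕ) : ℕ :=
  sSup {m : ℕ | ∀ y ∈ radixCyl 10 n x, Irrational y → ∀ i < m, cfDigit i y = cfDigit i x}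

namespace LochsAux

lemma gauss_eq_fract (x : ℝ) : gauss x = Int.fract (1 / x) := rfl

lemma gauss_nonneg (x : ℝ) : 0 ≤ gauss x := Int.fract_nonneg _

lemma gauss_lt_one (x : ℝ) : gauss x < 1 := Int.fract_lt_one _

lemma irr_inv {x : ℝ} (hx : Irrational x) : Irrational (1 / x) := by
  rw [one_div]; exact hx.inv

lemma gauss_irr {x : ℝ} (hx : Irrational x) : Irrational (gauss x) := by
  unfold gauss
  exact (irr_inv hx).sub_intCast _

lemma gauss_pos {x : ℝ} (hx : Irrational x) : 0 < gauss x :=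
  lt_of_le_of_ne (gauss_nonneg x) (gauss_irr hx).ne_zero.symm

/-- irrational points of the unit interval -/
def IrrI (x : ℝ) : Prop := Irrational x ∧ 0 < x ∧ x < 1

lemma IrrI.gauss {x : ℝ} (hx : IrrI x) : IrrI (gauss x) :=
  ⟨gauss_irr hx.1, gauss_pos hx.1, gauss_lt_one x⟩

lemma IrrI.iter {x : ℝ} (hx : IrrI x) (k : ℕ) : IrrI (_root_.gauss^[k] x) := by
  induction k with
  | zero => simpa using hx
  | succ k ih => rw [Function.iterate_succ_apply']; exact ih.gauss

/-- product of the first iterates -/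
noncomputable def Pr (m : ℕ) (x : ℝ) : ℝ := ∏ k ∈ Finset.range m, gauss^[k] x

lemma Pr_succ (m : ℕ) (x : ℝ) : Pr (m + 1) x = Pr m x * gauss^[m] x := by
  unfold Pr; rw [Finset.prod_range_succ]

lemma Pr_pos {x : ℝ} (hx : IrrI x) (m : ℕ) : 0 < Pr m x :=
  Finset.prod_pos fun k _ => (hx.iter k).2.1

lemma digit_eq (x : ℝ) (m : ℕ) :
    1 / gauss^[m] x = cfDigit m x + gauss^[m + 1] x := by
  rw [Function.iterate_succ_apply']
  unfold cfDigit gauss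
  ring

lemma digit_ge {x : ℝ} (hx : IrrI x) (m : ℕ) : 1 ≤ cfDigit m x := by
  unfold cfDigit
  rw [Int.le_floor]
  have h := hx.iter m
  rw [le_div_iff₀ h.2.1]
  push_cast
  linarith [h.2.2]

lemma dist_eq {x y : ℝ} (hx : IrrI x) (hy : IrrI y) (m : ℕ)
    (h : ∀ i < m, cfDigit i y = cfDigit i x) :
    |x - y| = Pr m x * Pr m y * |gauss^[m] x - gauss^[m] y| := by
  induction m with
  | zero => simp [Pr]
  | succ m ih =>
    rw [ih fun i hi => h i (by omega), Pr_succ, Pr_succ]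
    have h1 := digit_eq x m
    have h2 := digit_eq y m
    rw [h m (by omega)] at h2
    have hu := (hx.iter m).2.1
    have hv := (hy.iter m).2.1
    set u := gauss^[m] x
    set v := gauss^[m] y
    have : gauss^[m + 1] x - gauss^[m + 1] y = (v - u) / (u * v) := by
      have : gauss^[m + 1] x - gauss^[m + 1] y = 1 / u - 1 / v := by linarith
      rw [this]; field_simp
    rw [this, abs_div, abs_of_pos (mul_pos hu hv), abs_sub_comm v u]
    field_simp

lemma exists_AB {x : ℝ} (hx : IrrI x) (m : ℕ) :
    ∃ A B : ℝ, 0 < A ∧ 0 ≤ B ∧ B ≤ A ∧ ∀ y, IrrI y →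
      (∀ i < m, cfDigit i y = cfDigit i x) → Pr m y * (A + B * gauss^[m] y) = 1 := by
  induction m with
  | zero => exact ⟨1, 0, by norm_num, le_rfl, by norm_num, fun y _ _ => by simp [Pr]⟩
  | succ m ih =>
    obtain ⟨A, B, hA, hB, hBA, H⟩ := ih
    have ha : (1 : ℝ) ≤ cfDigit m x := by exact_mod_cast digit_ge hx m
    refine ⟨A * cfDigit m x + B, A, by positivity, hA.le, by nlinarith, fun y hy h => ?_⟩
    have h1 := H y hy fun i hi => h i (by omega)
    have h2 := digit_eq y m
    rw [h m (by omega)] at h2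
    have hv := (hy.iter m).2.1
    rw [Pr_succ]
    have : A * cfDigit m x + B + A * gauss^[m + 1] y = A * (1 / gauss^[m] y) + B := by
      rw [h2]; ring
    rw [this]
    have : gauss^[m] y * (A * (1 / gauss^[m] y) + B) = A + B * gauss^[m] y := by
      field_simp
    rw [mul_assoc, this, h1]

lemma Pr_le {x y : ℝ} (hx : IrrI x) (hy : IrrI y) (m : ℕ)
    (h : ∀ i < m, cfDigit i y = cfDigit i x) : Pr m y ≤ 2 * Pr m x := by
  obtain ⟨A, B, hA, hB, hBA, H⟩ := exists_AB hx m
  have h1 := H x hx fun _ _ => rfl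
  have h2 := H y hy h
  have p1 := Pr_pos hx m
  have p2 := Pr_pos hy m
  have a1 := (hx.iter m).2
  have a2 := (hy.iter m).2
  have e1 : Pr m y * A ≤ 1 := by
    have : 0 ≤ Pr m y * (B * gauss^[m] y) := by have := a2.1; positivity
    nlinarith
  have e2 : 1 ≤ 2 * Pr m x * A := by
    have : B * gauss^[m] x ≤ A := by nlinarith
    nlinarith
  by_contra hc
  push Not at hc
  nlinarith

/-- Birkhoff sums of `-log`. -/
noncomputable def S (m : ℕ) (x : ℝ) : ℝ := ∑ k ∈ Finset.range m, -Real.log (gauss^[k] x)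

lemma log_Pr {x : ℝ} (hx : IrrI x) (m : ℕ) : Real.log (Pr m x) = - S m x := by
  unfold Pr S
  rw [Real.log_prod fun k _ => (hx.iter k).2.1.ne']
  simp

lemma cyl_irr {x y : ℝ} (hx : IrrI x) {n : ℕ} (hy : y ∈ radixCyl 10 n x)
    (hi : Irrational y) : IrrI y := by
  have h10 : (0 : ℝ) < ((10 : ℕ) : ℝ) ^ n := by positivity
  have hf0 : (0 : ℤ) ≤ ⌊((10 : ℕ) : ℝ) ^ n * x⌋ := Int.floor_nonneg.2 (by have := hx.2.1; positivity)
  have hf1 : ⌊((10 : ℕ) : ℝ) ^ n * x⌋ < ((10 ^ n : ℕ) : ℤ) := by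
    rw [Int.floor_lt]; push_cast
    have := hx.2.2
    push_cast at h10
    nlinarith
  obtain ⟨h1, h2⟩ := hy
  refine ⟨hi, lt_of_le_of_ne (le_trans ?_ h1) hi.ne_zero.symm, lt_of_lt_of_le h2 ?_⟩
  · have : (0 : ℝ) ≤ ⌊((10 : ℕ) : ℝ) ^ n * x⌋ := by exact_mod_cast hf0
    positivity
  · rw [div_le_one h10]
    have : ⌊((10 : ℕ) : ℝ) ^ n * x⌋ + 1 ≤ ((10 ^ n : ℕ) : ℤ) := by omega
    exact_mod_cast this

lemma upper {x : ℝ} (hx : IrrI x) {n m : ℕ}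
    (h : ∀ y ∈ radixCyl 10 n x, Irrational y → ∀ i < m, cfDigit i y = cfDigit i x) :
    2 * S m x - Real.log 16 ≤ n * Real.log 10 := by
  have h10 : (0 : ℝ) < (10 : ℝ) ^ n := by positivity
  set a : ℝ := (⌊((10 : ℕ) : ℝ) ^ n * x⌋ : ℝ) / ((10 : ℕ) : ℝ) ^ n with ha
  have hab : ((⌊((10 : ℕ) : ℝ) ^ n * x⌋ : ℝ) + 1) / ((10 : ℕ) : ℝ) ^ n = a + 1 / 10 ^ n := by
    rw [ha, add_div]; simp
  have he : (0 : ℝ) < 1 / 10 ^ n := by positivity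
  set e : ℝ := 1 / 10 ^ n
  obtain ⟨y, hy, hy1, hy2⟩ := exists_irrational_btwn (show a < a + e / 4 by linarith)
  obtain ⟨z, hz, hz1, hz2⟩ := exists_irrational_btwn (show a + 3 * e / 4 < a + e by linarith)
  have my : y ∈ radixCyl 10 n x := ⟨hy1.le, by rw [hab]; linarith⟩
  have mz : z ∈ radixCyl 10 n x := ⟨by linarith, by rw [hab]; linarith⟩
  have iy := cyl_irr hx my hy
  have iz := cyl_irr hx mz hz
  have h1 := dist_eq iz iy m fun i hi => by rw [h y my hy i hi, h z mz hz i hi]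
  have h2 := Pr_le hx iy m (h y my hy)
  have h3 := Pr_le hx iz m (h z mz hz)
  have h4 : |gauss^[m] z - gauss^[m] y| ≤ 1 := by
    have a := (iy.iter m).2
    have b := (iz.iter m).2
    rw [abs_le]; constructor <;> linarith
  have h5 : e / 2 ≤ |z - y| := le_trans (by linarith) (le_abs_self _)
  have px := Pr_pos hx m
  have py := Pr_pos iy m
  have pz := Pr_pos iz m
  have h6 : e / 2 ≤ (2 * Pr m x) * (2 * Pr m x) * 1 := by
    refine h5.trans (h1.le.trans ?_)
    gcongr
  have h7 : e ≤ 16 * (Pr m x) ^ 2 := by nlinarith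
  have h8 := Real.log_le_log he h7
  rw [Real.log_mul (by norm_num) (by positivity), Real.log_pow, log_Pr hx] at h8
  have : Real.log e = - (n * Real.log 10) := by
    simp only [e]; rw [one_div, Real.log_inv, Real.log_pow]
  rw [this] at h8
  push_cast at h8
  linarith

lemma S_mono {x : ℝ} (h0 : 0 ≤ x) (h1 : x ≤ 1) : Monotone fun m => S m x := by
  refine monotone_nat_of_le_succ fun m => ?_
  unfold S
  rw [Finset.sum_range_succ]
  have : Real.log (gauss^[m] x) ≤ 0 := by
    cases m with
    | zero => exact Real.log_nonpos h0 h1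
    | succ m =>
      rw [Function.iterate_succ_apply']
      exact Real.log_nonpos (gauss_nonneg _) (gauss_lt_one _).le
  linarith

lemma lower {x : ℝ} (hx : IrrI x) {n M : ℕ}
    (h : ¬ ∀ y ∈ radixCyl 10 n x, Irrational y → ∀ i < M, cfDigit i y = cfDigit i x) :
    n * Real.log 10 ≤ 2 * S (M + 2) x + Real.log 16 := by
  push Not at h
  obtain ⟨y, my, iy, hex⟩ := h
  have hy := cyl_irr hx my iy
  classical
  let j := Nat.find hex
  obtain ⟨hjM, hj⟩ := Nat.find_spec hex
  have hmin : ∀ i < j, cfDigit i y = cfDigit i x := fun i hi => by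
    by_contra hc
    exact Nat.find_min hex hi ⟨by omega, hc⟩
  change j < M at hjM
  change cfDigit j y ≠ cfDigit j x at hj
  have h10 : (0 : ℝ) < (10 : ℝ) ^ n := by positivity
  have he : (0 : ℝ) < 1 / 10 ^ n := by positivity
  have hdist : |x - y| ≤ 1 / 10 ^ n := by
    obtain ⟨a1, a2⟩ := my
    rw [add_div] at a2
    have b1 : (⌊((10 : ℕ) : ℝ) ^ n * x⌋ : ℝ) / ((10 : ℕ) : ℝ) ^ n ≤ x := by
      rw [div_le_iff₀ (by positivity), mul_comm x]; exact Int.floor_le _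
    have b2 : x < ((⌊((10 : ℕ) : ℝ) ^ n * x⌋ : ℝ) + 1) / ((10 : ℕ) : ℝ) ^ n := by
      rw [lt_div_iff₀ (by positivity), mul_comm x]; exact Int.lt_floor_add_one _
    rw [add_div] at b2
    push_cast at *
    rw [abs_le]; constructor <;> linarith
  have d := dist_eq hx hy j hmin
  have p2 := Pr_le hy hx j fun i hi => (hmin i hi).symm
  have ex := digit_eq x j
  have ey := digit_eq y j
  have ex' := digit_eq x (j + 1)
  have px := Pr_pos hx j
  have py := Pr_pos hy j
  have hu := (hx.iter j).2
  have hv := (hy.iter j).2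
  have hu' := (hx.iter (j + 1)).2
  have hv' := (hy.iter (j + 1)).2
  have hu'' := (hx.iter (j + 2)).2
  have hk : (1 : ℝ) ≤ cfDigit (j + 1) x := by exact_mod_cast digit_ge hx (j + 1)
  have hP3 : Pr (j + 3) x = Pr j x * gauss^[j] x * gauss^[j + 1] x * gauss^[j + 2] x := by
    rw [Pr_succ, Pr_succ, Pr_succ]
  rw [show j + 1 + 1 = j + 2 from rfl] at ex'
  have P3 := Pr_pos hx (j + 3)
  have hS : S (j + 3) x ≤ S (M + 2) x := S_mono hx.2.1.le hx.2.2.le (by omega)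
  have hlog3 := log_Pr hx (j + 3)
  set u := gauss^[j] x
  set v := gauss^[j] y
  set u' := gauss^[j + 1] x
  set v' := gauss^[j + 1] y
  set u'' := gauss^[j + 2] x
  have k1 : u' * u'' / 2 ≤ 1 - u' := by
    rcases le_or_gt u' (1 / 2) with hc | hc
    · nlinarith
    · have hz : cfDigit (j + 1) x < 2 := by
        by_contra hcon
        push Not at hcon
        have : (2 : ℝ) ≤ cfDigit (j + 1) x := by exact_mod_cast hcon
        have : 2 ≤ 1 / u' := by linarith
        rw [le_div_iff₀ hu'.1] at this
        linarith
      have hz1 : cfDigit (j + 1) x = 1 := le_antisymm (by omega) (digit_ge hx _)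
      rw [hz1] at ex'
      push_cast at ex'
      have : u' * (1 + u'') = 1 := by rw [← ex']; field_simp
      nlinarith
  have k2 : u' * u'' / 2 ≤ |1 / u - 1 / v| := by
    rw [ex, ey]
    rcases lt_or_gt_of_ne hj with hc | hc
    · have : (cfDigit j y : ℝ) + 1 ≤ cfDigit j x := by exact_mod_cast hc
      refine le_trans ?_ (le_abs_self _)
      nlinarith
    · have : (cfDigit j x : ℝ) + 1 ≤ cfDigit j y := by exact_mod_cast hc
      refine le_trans ?_ (neg_le_abs _)
      nlinarith
  have k3 : u ^ 2 * (u' * u'') / 4 ≤ |u - v| := by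
    have hb : u' * u'' ≤ 1 := by nlinarith
    have hb0 : 0 < u' * u'' := mul_pos hu'.1 hu''.1
    rcases le_or_gt v (u / 2) with hc | hc
    · refine le_trans ?_ (le_abs_self _)
      have : u ^ 2 * (u' * u'') ≤ u ^ 2 * 1 := by gcongr
      nlinarith
    · have : |u - v| = u * v * |1 / u - 1 / v| := by
        have hv0 := hv.1
        have hu0 := hu.1
        have : 1 / u - 1 / v = (v - u) / (u * v) := by field_simp
        rw [this, abs_div, abs_of_pos (mul_pos hu0 hv0), abs_sub_comm v u]
        field_simp
      rw [this]
      calc u ^ 2 * (u' * u'') / 4 = u * (u / 2) * (u' * u'' / 2) := by ring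
        _ ≤ u * v * |1 / u - 1 / v| := by
          have := hu.1
          have := hv.1
          gcongr
  have k4 : (Pr (j + 3) x) ^ 2 / 8 ≤ |x - y| := by
    rw [d, hP3]
    have hb : u' * u'' ≤ 1 := by nlinarith
    have hb0 : 0 < u' * u'' := mul_pos hu'.1 hu''.1
    have := hu.1
    calc (Pr j x * u * u' * u'') ^ 2 / 8
        = (Pr j x * (Pr j x / 2)) * (u ^ 2 * (u' * u'') / 4) * (u' * u'') := by ring
      _ ≤ (Pr j x * (Pr j x / 2)) * (u ^ 2 * (u' * u'') / 4) * 1 := by gcongr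
      _ ≤ Pr j x * Pr j y * |u - v| := by
        rw [mul_one]
        gcongr
        linarith
  have k5 : (Pr (j + 3) x) ^ 2 ≤ 16 * (1 / 10 ^ n) := by
    linarith
  have h8 := Real.log_le_log (by positivity) k5
  rw [Real.log_mul (by norm_num) (by positivity), Real.log_pow, hlog3] at h8
  have : Real.log (1 / 10 ^ n) = - (n * Real.log 10) := by
    rw [one_div, Real.log_inv, Real.log_pow]
  rw [this] at h8
  push_cast at h8
  linarith

lemma deterministic {x l : ℝ} (hx : IrrI x) (hl : 0 < l)
    (hS : Tendsto (fun m : ℕ => S m x / m) atTop (nhds l)) :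
    Tendsto (fun n : ℕ => (mDecCF x n : ℝ) / n) atTop (nhds (Real.log 10 / (2 * l))) := by
  have hL : 0 < Real.log 10 := Real.log_pos (by norm_num)
  have hSinf : Tendsto (fun m : ℕ => S m x) atTop atTop := by
    have : Tendsto (fun m : ℕ => S m x / m * m) atTop atTop :=
      hS.pos_mul_atTop hl tendsto_natCast_atTop_atTop
    refine this.congr' ?_
    filter_upwards [eventually_gt_atTop 0] with m hm
    have : (m : ℝ) ≠ 0 := by positivity
    field_simp
  set Z : ℕ → Set ℕ := fun n =>
    {m : ℕ | ∀ y ∈ radixCyl 10 n x, Irrational y → ∀ i < m, cfDigit i y = cfDigit i x}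
  have hbdd : ∀ n, BddAbove (Z n) := by
    intro n
    obtain ⟨N, hN⟩ := (hSinf.eventually_gt_atTop (n * Real.log 10 + Real.log 16)).exists_forall_of_atTop
    refine ⟨N, fun m hm => ?_⟩
    by_contra hc
    push Not at hc
    have h1 := upper hx hm
    have h2 := hN m hc.le
    have h3 : 0 < n * Real.log 10 + Real.log 16 := by
      have := Real.log_pos (show (1 : ℝ) < 16 by norm_num)
      positivity
    have := Real.log_pos (show (1 : ℝ) < 16 by norm_num)
    nlinarith
  have hne : ∀ n, (Z n).Nonempty := fun n => ⟨0, fun y _ _ i hi => absurd hi (by omega)⟩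
  have hup : ∀ n, 2 * S (mDecCF x n) x - Real.log 16 ≤ n * Real.log 10 := fun n =>
    upper hx (Nat.sSup_mem (hne n) (hbdd n))
  have hlo : ∀ n, n * Real.log 10 ≤ 2 * S (mDecCF x n + 3) x + Real.log 16 := fun n =>
    lower (M := mDecCF x n + 1) hx fun hc => by
      have := le_csSup (hbdd n) (show mDecCF x n + 1 ∈ Z n from hc)
      change mDecCF x n + 1 ≤ mDecCF x n at this
      omega
  have hm : Tendsto (fun n => mDecCF x n) atTop atTop := by
    rw [tendsto_atTop]
    intro b
    have : Tendsto (fun n : ℕ => (n : ℝ) * Real.log 10) atTop atTop :=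
      tendsto_natCast_atTop_atTop.atTop_mul_const hL
    filter_upwards [this.eventually_gt_atTop (2 * S (b + 3) x + Real.log 16)] with n hn
    by_contra hc
    push Not at hc
    have h1 := hlo n
    have h2 : S (mDecCF x n + 3) x ≤ S (b + 3) x := S_mono hx.2.1.le hx.2.2.le (by omega)
    linarith
  have hmr : Tendsto (fun n => (mDecCF x n : ℝ)) atTop atTop := tendsto_natCast_atTop_atTop.comp hm
  have hc : ∀ c : ℝ, Tendsto (fun n => c / (mDecCF x n : ℝ)) atTop (nhds 0) := fun c =>
    tendsto_const_nhds.div_atTop hmr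
  have e1 : Tendsto (fun n => 2 * (S (mDecCF x n) x / (mDecCF x n : ℝ))
      - Real.log 16 / (mDecCF x n : ℝ)) atTop (nhds (2 * l)) := by
    have := ((hS.comp hm).const_mul 2).sub (hc (Real.log 16))
    simpa using this
  have e2 : Tendsto (fun n => 2 * (S (mDecCF x n + 3) x / ((mDecCF x n + 3 : ℕ) : ℝ)
      * (1 + 3 / (mDecCF x n : ℝ))) + Real.log 16 / (mDecCF x n : ℝ)) atTop (nhds (2 * l)) := by
    have h3 : Tendsto (fun n => mDecCF x n + 3) atTop atTop := 
      tendsto_atTop_mono (fun n => Nat.le_add_right _ 3) hm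
    have := (((hS.comp h3).mul ((hc 3).const_add 1)).const_mul 2).add (hc (Real.log 16))
    simpa using this
  have e3 : Tendsto (fun n : ℕ => n * Real.log 10 / (mDecCF x n : ℝ)) atTop (nhds (2 * l)) := by
    refine tendsto_of_tendsto_of_tendsto_of_le_of_le' e1 e2 ?_ ?_
    · filter_upwards [hm.eventually_gt_atTop 0] with n hn
      have : (0 : ℝ) < mDecCF x n := by exact_mod_cast hn
      rw [← mul_div_assoc, ← sub_div]
      gcongr
      exact hup n
    · filter_upwards [hm.eventually_gt_atTop 0] with n hn
      have : (0 : ℝ) < mDecCF x n := by exact_mod_cast hn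
      have e : 2 * (S (mDecCF x n + 3) x / ((mDecCF x n + 3 : ℕ) : ℝ)
        * (1 + 3 / (mDecCF x n : ℝ))) + Real.log 16 / (mDecCF x n : ℝ)
        = (2 * S (mDecCF x n + 3) x + Real.log 16) / (mDecCF x n : ℝ) := by
        push_cast
        field_simp
      rw [e]
      gcongr
      exact hlo n
  have e4 := (e3.inv₀ (by positivity)).const_mul (Real.log 10)
  rw [← div_eq_mul_inv] at e4
  refine e4.congr fun n => ?_
  rw [inv_div, mul_comm (n : ℝ), ← mul_div_assoc, mul_div_mul_left _ _ hL.ne']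

end LochsAux

namespace LochsAux

/-- weights of the Gauss transfer operator -/
noncomputable def w (n : ℕ) (x : ℝ) : ℝ := (1 + x) / ((n + 1 + x) * (n + 2 + x))

/-- tails of the weights -/
noncomputable def T (n : ℕ) (x : ℝ) : ℝ := (1 + x) / (n + 1 + x)

lemma w_eq {x : ℝ} (hx : 0 ≤ x) (n : ℕ) : w n x = T n x - T (n + 1) x := by
  unfold w T
  push_cast
  field_simp
  ring

lemma w_nonneg {x : ℝ} (hx : 0 ≤ x) (n : ℕ) : 0 ≤ w n x := by
  unfold w; positivity

lemma T_nonneg {x : ℝ} (hx : 0 ≤ x) (n : ℕ) : 0 ≤ T n x := by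
  unfold T; positivity

lemma T_zero {x : ℝ} (hx : 0 ≤ x) : T 0 x = 1 := by
  unfold T; push_cast; rw [zero_add]; exact div_self (by positivity)

lemma sum_w {x : ℝ} (hx : 0 ≤ x) (N : ℕ) : ∑ n ∈ Finset.range N, w n x = 1 - T N x := by
  simp_rw [w_eq hx]
  rw [Finset.sum_range_sub', T_zero hx]

lemma T_tendsto (x : ℝ) : Tendsto (fun n : ℕ => T n x) atTop (nhds 0) := by
  unfold T
  refine tendsto_const_nhds.div_atTop ?_
  exact tendsto_atTop_add_const_right _ _ (tendsto_atTop_add_const_right _ _ tendsto_natCast_atTop_atTop)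

lemma hasSum_w {x : ℝ} (hx : 0 ≤ x) : HasSum (fun n => w n x) 1 := by
  rw [hasSum_iff_tendsto_nat_of_nonneg (w_nonneg hx)]
  simp_rw [sum_w hx]
  simpa using (T_tendsto x).const_sub 1

lemma T_diff {x y : ℝ} (hx : 0 ≤ x) (hy : 0 ≤ y) (n : ℕ) :
    |T n x - T n y| ≤ |x - y| * (n / (n + 1) ^ 2) := by
  have : T n x - T n y = (x - y) * (n / ((n + 1 + x) * (n + 1 + y))) := by
    unfold T; field_simp; ring
  rw [this, abs_mul, abs_of_nonneg (a := (n : ℝ) / _) (by positivity)]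
  gcongr
  nlinarith [Nat.cast_nonneg (α := ℝ) n, mul_nonneg hx hy]

/-- Abel summation estimate -/
lemma abel {x y : ℝ} (hx : 0 ≤ x) (hy : 0 ≤ y) (a d : ℕ → ℝ)
    (hd : ∀ n, |a (n + 1) - a n| ≤ d n) (N : ℕ) :
    |∑ n ∈ Finset.range (N + 1), (w n x - w n y) * a n + (T (N + 1) x - T (N + 1) y) * a N|
      ≤ |x - y| * ∑ n ∈ Finset.range N, (n + 1) / (n + 2) ^ 2 * d n := by
  induction N with
  | zero =>
    simp [w_eq hx, w_eq hy, T_zero hx, T_zero hy]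
    ring
  | succ N ih =>
    rw [Finset.sum_range_succ, Finset.sum_range_succ (fun n : ℕ => ((n : ℝ) + 1) / (n + 2) ^ 2 * d n) N, mul_add]
    have : ∑ n ∈ Finset.range (N + 1), (w n x - w n y) * a n
        + (w (N + 1) x - w (N + 1) y) * a (N + 1)
        + (T (N + 1 + 1) x - T (N + 1 + 1) y) * a (N + 1)
        = (∑ n ∈ Finset.range (N + 1), (w n x - w n y) * a n + (T (N + 1) x - T (N + 1) y) * a N)
          + (T (N + 1) x - T (N + 1) y) * (a (N + 1) - a N) := by
      rw [w_eq hx, w_eq hy]; ring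
    rw [this]
    refine (abs_add_le _ _).trans (add_le_add ih ?_)
    rw [abs_mul]
    have h1 := T_diff hx hy (N + 1)
    have h2 := hd N
    calc _ ≤ |x - y| * (((N + 1 : ℕ) : ℝ) / (((N + 1 : ℕ) : ℝ) + 1) ^ 2) * d N := by gcongr
      _ = _ := by push_cast; ring

/-- The transfer operator. -/
noncomputable def P (g : ℝ → ℝ) (x : ℝ) : ℝ := ∑' n : ℕ, w n x * g (1 / (n + 1 + x))

lemma P_lip {g : ℝ → ℝ} {x y C K : ℝ} (hx : 0 ≤ x) (hy : 0 ≤ y)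
    (sx : Summable fun n : ℕ => w n x * g (1 / (n + 1 + x)))
    (sy : Summable fun n : ℕ => w n y * g (1 / (n + 1 + y)))
    (c d : ℕ → ℝ)
    (hc : ∀ n : ℕ, |g (1 / (n + 1 + x)) - g (1 / (n + 1 + y))| ≤ c n * |x - y|)
    (hd : ∀ n : ℕ, |g (1 / (((n + 1 : ℕ) : ℝ) + 1 + y)) - g (1 / (n + 1 + y))| ≤ d n)
    (hC : ∀ N, ∑ n ∈ Finset.range N, w n x * c n ≤ C)
    (hK : ∀ N, ∑ n ∈ Finset.range N, ((n : ℝ) + 1) / (n + 2) ^ 2 * d n ≤ K)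
    (hlim : Tendsto (fun N : ℕ => T (N + 1) y * g (1 / (N + 1 + y))) atTop (nhds 0)) :
    |P g x - P g y| ≤ (C + K) * |x - y| := by
  have t1 := sx.hasSum.tendsto_sum_nat.comp (tendsto_add_atTop_nat 1)
  have t2 := sy.hasSum.tendsto_sum_nat.comp (tendsto_add_atTop_nat 1)
  have hlim' : Tendsto (fun N : ℕ => (T (N + 1) x - T (N + 1) y) * g (1 / (N + 1 + y))) atTop
      (nhds 0) := by
    have : Tendsto (fun N : ℕ => (x - y) / (1 + y) * ((N + 1) / (N + 1 + 1 + x)) *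
        (T (N + 1) y * g (1 / (N + 1 + y)))) atTop (nhds ((x - y) / (1 + y) * 1 * 0)) := by
      refine Tendsto.mul (Tendsto.mul tendsto_const_nhds ?_) hlim
      have : Tendsto (fun N : ℕ => 1 - (1 + x) / ((N : ℝ) + (1 + 1 + x))) atTop (nhds (1 - 0)) := by
        refine tendsto_const_nhds.sub (tendsto_const_nhds.div_atTop ?_)
        exact tendsto_atTop_add_const_right _ _ tendsto_natCast_atTop_atTop
      rw [sub_zero] at this
      refine this.congr fun N => ?_
      field_simp
      ring
    rw [mul_zero] at this
    refine this.congr fun N => ?_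
    rw [← mul_assoc]
    congr 1
    unfold T
    push_cast
    field_simp
    ring
  have t3 := ((t1.sub t2).add hlim').abs
  rw [add_zero] at t3
  refine le_of_tendsto t3 (Eventually.of_forall fun N => ?_)
  simp only [Function.comp]
  have ab := abel hx hy (fun n : ℕ => g (1 / (n + 1 + y))) d hd N
  have e : ∑ n ∈ Finset.range (N + 1), w n x * g (1 / (n + 1 + x))
      - ∑ n ∈ Finset.range (N + 1), w n y * g (1 / (n + 1 + y))
      + (T (N + 1) x - T (N + 1) y) * g (1 / (N + 1 + y))
      = ∑ n ∈ Finset.range (N + 1), w n x * (g (1 / (n + 1 + x)) - g (1 / (n + 1 + y)))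
      + (∑ n ∈ Finset.range (N + 1), (w n x - w n y) * g (1 / (n + 1 + y))
      + (T (N + 1) x - T (N + 1) y) * g (1 / (N + 1 + y))) := by
    rw [← add_assoc]; congr 1
    rw [← Finset.sum_sub_distrib, ← Finset.sum_add_distrib]
    exact Finset.sum_congr rfl fun n _ => by ring
  rw [e, add_mul]
  refine (abs_add_le _ _).trans (add_le_add ?_ (ab.trans ?_))
  · refine (Finset.abs_sum_le_sum_abs _ _).trans ?_
    calc _ ≤ ∑ n ∈ Finset.range (N + 1), w n x * c n * |x - y| := by
          refine Finset.sum_le_sum fun n _ => ?_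
          rw [abs_mul, abs_of_nonneg (w_nonneg hx n), mul_assoc]
          exact mul_le_mul_of_nonneg_left (hc n) (w_nonneg hx n)
      _ ≤ _ := by
        rw [← Finset.sum_mul]
        exact mul_le_mul_of_nonneg_right (hC _) (abs_nonneg _)
  · rw [mul_comm]
    exact mul_le_mul_of_nonneg_right (hK _) (abs_nonneg _)

/-- nonnegative Lipschitz functions on `[0,1]` -/
def Lip (L : ℝ) (g : ℝ → ℝ) : Prop :=
  (∀ x, 0 ≤ x → x ≤ 1 → 0 ≤ g x) ∧
  ∀ x y, 0 ≤ x → x ≤ 1 → 0 ≤ y → y ≤ 1 → |g x - g y| ≤ L * |x - y|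

lemma pt_mem {x : ℝ} (hx : 0 ≤ x) (n : ℕ) : 0 ≤ 1 / (n + 1 + x) ∧ 1 / (n + 1 + x) ≤ 1 := by
  refine ⟨by positivity, ?_⟩
  rw [div_le_one (by positivity)]
  have : (0 : ℝ) ≤ n := Nat.cast_nonneg n
  linarith

lemma Lip.bdd {L : ℝ} {g : ℝ → ℝ} (h : Lip L g) (hL : 0 ≤ L) {x : ℝ} (h0 : 0 ≤ x) (h1 : x ≤ 1) :
    g x ≤ g 0 + L := by
  have := h.2 x 0 h0 h1 le_rfl zero_le_one
  have h2 : L * |x - 0| ≤ L * 1 := by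
    gcongr; rw [sub_zero, abs_of_nonneg h0]; exact h1
  have := le_abs_self (g x - g 0)
  linarith

lemma Lip.summable {L : ℝ} {g : ℝ → ℝ} (h : Lip L g) (hL : 0 ≤ L) {x : ℝ} (h0 : 0 ≤ x) :
    Summable fun n : ℕ => w n x * g (1 / (n + 1 + x)) := by
  refine Summable.of_nonneg_of_le (fun n => mul_nonneg (w_nonneg h0 n)
    (h.1 _ (pt_mem h0 n).1 (pt_mem h0 n).2)) (fun n => ?_)
    ((hasSum_w h0).summable.mul_right (g 0 + L))
  exact mul_le_mul_of_nonneg_left (h.bdd hL (pt_mem h0 n).1 (pt_mem h0 n).2) (w_nonneg h0 n)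

lemma sum_w_sq {x : ℝ} (hx : 0 ≤ x) (N : ℕ) :
    ∑ n ∈ Finset.range N, w n x * (1 / ((n : ℝ) + 1) ^ 2) ≤ 5 / 8 := by
  cases N with
  | zero => simp; norm_num
  | succ N =>
    have h1 : ∑ n ∈ Finset.range (N + 1), w n x * (1 / ((n : ℝ) + 1) ^ 2)
        ≤ w 0 x + ∑ n ∈ Finset.range N, w (n + 1) x * (1 / 4) := by
      rw [Finset.sum_range_succ', add_comm]
      refine add_le_add (by simp) (Finset.sum_le_sum fun n _ => ?_)
      refine mul_le_mul_of_nonneg_left ?_ (w_nonneg hx _)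
      push_cast
      rw [div_le_div_iff₀ (by positivity) (by norm_num)]
      nlinarith [Nat.cast_nonneg (α := ℝ) n]
    have h2 := sum_w hx (N + 1)
    rw [Finset.sum_range_succ'] at h2
    have h3 := T_nonneg hx (N + 1)
    have h4 : w 0 x ≤ 1 / 2 := by
      unfold w
      rw [div_le_div_iff₀ (by push_cast; positivity) (by norm_num)]
      push_cast
      nlinarith
    rw [← Finset.sum_mul] at h1
    linarith

lemma sum_cube (N : ℕ) :
    ∑ n ∈ Finset.range N, ((n : ℝ) + 1) / (n + 2) ^ 2 * (1 / (((n : ℝ) + 1) * (n + 2))) ≤ 5 / 24 := by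
  have : ∀ N : ℕ, ∑ n ∈ Finset.range (N + 1), ((n : ℝ) + 1) / (n + 2) ^ 2 * (1 / (((n : ℝ) + 1) * (n + 2)))
      ≤ (5 / 24 : ℝ) - 1 / (2 * ((N : ℝ) + 2) * ((N : ℝ) + 3)) := by
    intro N
    induction N with
    | zero => simp; norm_num
    | succ N ih =>
      rw [Finset.sum_range_succ]
      have : (((N + 1 : ℕ) : ℝ) + 1) / (((N + 1 : ℕ) : ℝ) + 2) ^ 2 *
          (1 / ((((N + 1 : ℕ) : ℝ) + 1) * (((N + 1 : ℕ) : ℝ) + 2)))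
          ≤ 1 / (2 * (N + 2) * (N + 3)) - 1 / (2 * (((N + 1 : ℕ) : ℝ) + 2) * (((N + 1 : ℕ) : ℝ) + 3)) := by
        push_cast
        have e1 : ((N : ℝ) + 1 + 1) / (N + 1 + 2) ^ 2 * (1 / ((N + 1 + 1) * (N + 1 + 2)))
          = 1 / (N + 3) ^ 3 := by field_simp; ring
        have e2 : (1 : ℝ) / (2 * (N + 2) * (N + 3)) - 1 / (2 * (N + 1 + 2) * (N + 1 + 3))
          = 1 / ((N + 2) * (N + 3) * (N + 4)) := by field_simp; ring
        rw [e1, e2]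
        apply one_div_le_one_div_of_le (by positivity)
        nlinarith [Nat.cast_nonneg (α := ℝ) N]
      linarith
  cases N with
  | zero => simp; norm_num
  | succ N =>
    refine (this N).trans ?_
    have : (0 : ℝ) ≤ 1 / (2 * (N + 2) * (N + 3)) := by positivity
    linarith

lemma P_nonneg {g : ℝ → ℝ} (hg : ∀ x, 0 ≤ x → x ≤ 1 → 0 ≤ g x) {x : ℝ} (hx : 0 ≤ x) :
    0 ≤ P g x :=
  tsum_nonneg fun n => mul_nonneg (w_nonneg hx n) (hg _ (pt_mem hx n).1 (pt_mem hx n).2)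

lemma Lip.P {L : ℝ} {g : ℝ → ℝ} (h : Lip L g) (hL : 0 ≤ L) : Lip (5 / 6 * L) (P g) := by
  refine ⟨fun x h0 _ => P_nonneg h.1 h0, fun x y hx hx1 hy hy1 => ?_⟩
  have key := P_lip (C := 5 / 8 * L) (K := 5 / 24 * L) hx hy (h.summable hL hx) (h.summable hL hy)
    (fun n => L * (1 / ((n : ℝ) + 1) ^ 2)) (fun n => L * (1 / (((n : ℝ) + 1) * (n + 2))))
    (fun n => ?_) (fun n => ?_) (fun N => ?_) (fun N => ?_) ?_
  · convert key using 1; ring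
  · refine (h.2 _ _ (pt_mem hx n).1 (pt_mem hx n).2 (pt_mem hy n).1 (pt_mem hy n).2).trans ?_
    rw [mul_assoc]
    refine mul_le_mul_of_nonneg_left ?_ hL
    have : 1 / ((n : ℝ) + 1 + x) - 1 / (n + 1 + y) = (y - x) * (1 / ((n + 1 + x) * (n + 1 + y))) := by
      field_simp; ring
    rw [this, abs_mul, abs_sub_comm y x, mul_comm, abs_of_nonneg (by positivity)]
    gcongr
    nlinarith [Nat.cast_nonneg (α := ℝ) n, mul_nonneg hx hy]
  · refine (h.2 _ _ (pt_mem hy (n+1)).1 (pt_mem hy (n+1)).2 (pt_mem hy n).1 (pt_mem hy n).2).trans ?_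
    refine mul_le_mul_of_nonneg_left ?_ hL
    have : 1 / (((n + 1 : ℕ) : ℝ) + 1 + y) - 1 / (n + 1 + y)
        = - (1 / ((n + 1 + y) * (n + 2 + y))) := by
      push_cast; field_simp; ring
    rw [this, abs_neg, abs_of_nonneg (by positivity)]
    apply one_div_le_one_div_of_le (by positivity)
    nlinarith [Nat.cast_nonneg (α := ℝ) n, mul_nonneg hy (Nat.cast_nonneg (α := ℝ) n)]
  · have := mul_le_mul_of_nonneg_left (sum_w_sq hx N) hL
    rw [Finset.mul_sum] at this
    rw [mul_comm (5 / 8) L]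
    refine le_trans (le_of_eq (Finset.sum_congr rfl fun n _ => by ring)) this
  · have := mul_le_mul_of_nonneg_left (sum_cube N) hL
    rw [Finset.mul_sum] at this
    rw [mul_comm (5 / 24) L]
    refine le_trans (le_of_eq (Finset.sum_congr rfl fun n _ => by ring)) this
  · have h1 := ((T_tendsto y).comp (tendsto_add_atTop_nat 1)).mul_const (g 0 + L)
    rw [zero_mul] at h1
    refine squeeze_zero (fun N => mul_nonneg (T_nonneg hy _) (h.1 _ (pt_mem hy N).1 (pt_mem hy N).2))
      (fun N => ?_) h1
    exact mul_le_mul_of_nonneg_left (h.bdd hL (pt_mem hy N).1 (pt_mem hy N).2) (T_nonneg hy _)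

/-- the observable -/
noncomputable def f0 (x : ℝ) : ℝ := -Real.log x

lemma f0_pt (n : ℕ) (x : ℝ) : f0 (1 / (n + 1 + x)) = Real.log (n + 1 + x) := by
  unfold f0; rw [one_div, Real.log_inv, neg_neg]

lemma f0_nonneg {x : ℝ} (h0 : 0 ≤ x) (h1 : x ≤ 1) : 0 ≤ f0 x := by
  unfold f0; linarith [Real.log_nonpos h0 h1]

lemma f0_step (n : ℕ) {y : ℝ} (hy : 0 ≤ y) :
    |Real.log (((n + 1 : ℕ) : ℝ) + 1 + y) - Real.log (n + 1 + y)| ≤ 1 / (n + 1) := by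
  have p : (0 : ℝ) < n + 1 + y := by positivity
  have hle : Real.log (n + 1 + y) ≤ Real.log (((n + 1 : ℕ) : ℝ) + 1 + y) :=
    Real.log_le_log p (by push_cast; linarith)
  rw [abs_of_nonneg (by linarith), ← Real.log_div (by positivity) (by positivity)]
  refine (Real.log_le_sub_one_of_pos (by positivity)).trans ?_
  have : (((n + 1 : ℕ) : ℝ) + 1 + y) / (n + 1 + y) - 1 = 1 / (n + 1 + y) := by
    push_cast; field_simp; ring
  rw [this]
  exact one_div_le_one_div_of_le (by positivity) (by linarith)

lemma f0_lim {y : ℝ} (hy : 0 ≤ y) :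
    Tendsto (fun N : ℕ => T (N + 1) y * f0 (1 / (N + 1 + y))) atTop (nhds 0) := by
  have h1 : Tendsto (fun N : ℕ => (1 + y) * (Real.log (N + (1 + y)) / (N + (1 + y)))) atTop
      (nhds ((1 + y) * 0)) := by
    refine Tendsto.const_mul _ ?_
    have := Real.isLittleO_log_id_atTop.tendsto_div_nhds_zero
    exact this.comp (tendsto_atTop_add_const_right _ _ tendsto_natCast_atTop_atTop)
  rw [mul_zero] at h1
  refine squeeze_zero (fun N => mul_nonneg (T_nonneg hy _)
    (f0_nonneg (pt_mem hy N).1 (pt_mem hy N).2)) (fun N => ?_) h1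
  rw [f0_pt]
  unfold T
  have hl : 0 ≤ Real.log ((N : ℝ) + 1 + y) := Real.log_nonneg (by
    have : (0 : ℝ) ≤ N := Nat.cast_nonneg N
    linarith)
  rw [← add_assoc, ← mul_div_assoc, div_mul_eq_mul_div]
  push_cast
  gcongr
  linarith

lemma f0_summable {x : ℝ} (hx : 0 ≤ x) :
    Summable fun n : ℕ => w n x * f0 (1 / (n + 1 + x)) := by
  have hb : Summable fun n : ℕ => (1 + x) * (2 * (1 + x) ^ (1 / 2 : ℝ)) * (1 / ((n + 1 : ℕ) : ℝ) ^ (3 / 2 : ℝ)) :=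
    Summable.mul_left _ ((summable_nat_add_iff 1).2
      (Real.summable_one_div_nat_rpow.2 (by norm_num)))
  refine Summable.of_nonneg_of_le (fun n => mul_nonneg (w_nonneg hx n)
    (f0_nonneg (pt_mem hx n).1 (pt_mem hx n).2)) (fun n => ?_) hb
  rw [f0_pt]
  have p : (0 : ℝ) < n + 1 := by positivity
  have h1 : Real.log (n + 1 + x) ≤ 2 * (1 + x) ^ (1 / 2 : ℝ) * ((n : ℝ) + 1) ^ (1 / 2 : ℝ) := by
    have h := Real.log_le_rpow_div (x := n + 1 + x) (by positivity) (show (0 : ℝ) < 1 / 2 by norm_num)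
    have h2 : ((n : ℝ) + 1 + x) ^ (1 / 2 : ℝ) ≤ ((1 + x) * (n + 1)) ^ (1 / 2 : ℝ) := by
      gcongr
      nlinarith [mul_nonneg hx (Nat.cast_nonneg (α := ℝ) n)]
    rw [Real.mul_rpow (by positivity) p.le] at h2
    calc _ ≤ _ := h
      _ = 2 * ((n : ℝ) + 1 + x) ^ (1 / 2 : ℝ) := by ring
      _ ≤ 2 * ((1 + x) ^ (1 / 2 : ℝ) * ((n : ℝ) + 1) ^ (1 / 2 : ℝ)) := by gcongr
      _ = _ := by ring
  have h2 : w n x ≤ (1 + x) * (1 / ((n : ℝ) + 1) ^ 2) := by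
    unfold w
    rw [mul_one_div]
    gcongr
    nlinarith
  have h3 : (1 : ℝ) / ((n + 1 : ℕ) : ℝ) ^ (3 / 2 : ℝ)
      = 1 / ((n : ℝ) + 1) ^ 2 * ((n : ℝ) + 1) ^ (1 / 2 : ℝ) := by
    push_cast
    have : ((n : ℝ) + 1) ^ 2 = ((n : ℝ) + 1) ^ (3 / 2 : ℝ) * ((n : ℝ) + 1) ^ (1 / 2 : ℝ) := by
      rw [← Real.rpow_add p]; norm_num
    rw [this]
    field_simp
  rw [h3]
  calc _ ≤ (1 + x) * (1 / ((n : ℝ) + 1) ^ 2) * (2 * (1 + x) ^ (1 / 2 : ℝ) * ((n : ℝ) + 1) ^ (1 / 2 : ℝ)) := by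
        have : 0 ≤ Real.log ((n : ℝ) + 1 + x) := Real.log_nonneg (by
          have : (0 : ℝ) ≤ n := Nat.cast_nonneg n
          linarith)
        gcongr
    _ = _ := by ring

lemma sum_sq (N : ℕ) :
    ∑ n ∈ Finset.range N, ((n : ℝ) + 1) / (n + 2) ^ 2 * (1 / ((n : ℝ) + 1)) ≤ 1 := by
  have : ∑ n ∈ Finset.range N, ((n : ℝ) + 1) / (n + 2) ^ 2 * (1 / ((n : ℝ) + 1)) ≤ 1 - 1 / ((N : ℝ) + 1) := by
    induction N with
    | zero => simp
    | succ N ih =>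
      rw [Finset.sum_range_succ]
      have : ((N : ℝ) + 1) / (N + 2) ^ 2 * (1 / (N + 1)) ≤ 1 / (N + 1) - 1 / (((N + 1 : ℕ) : ℝ) + 1) := by
        have e1 : ((N : ℝ) + 1) / (N + 2) ^ 2 * (1 / (N + 1)) = 1 / (N + 2) ^ 2 := by field_simp
        have e2 : (1 : ℝ) / (N + 1) - 1 / (((N + 1 : ℕ) : ℝ) + 1) = 1 / ((N + 1) * (N + 2)) := by
          push_cast; field_simp; ring
        rw [e1, e2]
        apply one_div_le_one_div_of_le (by positivity)
        nlinarith [Nat.cast_nonneg (α := ℝ) N]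
      linarith
  refine this.trans ?_
  have : (0 : ℝ) ≤ 1 / (N + 1) := by positivity
  linarith

lemma Lip_P_f0 : Lip 2 (P f0) := by
  refine ⟨fun x h0 _ => P_nonneg (fun x h0 h1 => f0_nonneg h0 h1) h0, fun x y hx hx1 hy hy1 => ?_⟩
  have key := P_lip (C := 1) (K := 1) hx hy (f0_summable hx) (f0_summable hy)
    (fun n => 1) (fun n => (1 / ((n : ℝ) + 1)))
    (fun n => ?_) (fun n => ?_) (fun N => ?_) (fun N => ?_) (f0_lim hy)
  · convert key using 1; ring
  · rw [f0_pt, f0_pt, one_mul]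
    have : ∀ a b : ℝ, 1 ≤ a → 1 ≤ b → Real.log a - Real.log b ≤ |a - b| := by
      intro a b ha hb
      rw [← Real.log_div (by positivity) (by positivity)]
      refine (Real.log_le_sub_one_of_pos (by positivity)).trans ?_
      have e : a / b - 1 = (a - b) / b := by field_simp
      rw [e]
      refine (le_abs_self _).trans ?_
      rw [abs_div, abs_of_pos (by linarith : 0 < b)]
      exact div_le_self (abs_nonneg _) hb
    have hn : (0 : ℝ) ≤ n := Nat.cast_nonneg n
    have h1 := this (n + 1 + x) (n + 1 + y) (by linarith) (by linarith)
    have h2 := this (n + 1 + y) (n + 1 + x) (by linarith) (by linarith)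
    rw [show (n : ℝ) + 1 + x - (n + 1 + y) = x - y by ring] at h1
    rw [show (n : ℝ) + 1 + y - (n + 1 + x) = y - x by ring, abs_sub_comm] at h2
    rw [abs_le]; constructor <;> linarith
  · rw [f0_pt, f0_pt]; exact f0_step n hy
  · simp_rw [mul_one]
    rw [sum_w hx]
    linarith [T_nonneg hx N]
  · exact sum_sq N

lemma Lip_iter (k : ℕ) : Lip (2 * (5 / 6) ^ k) (P^[k + 1] f0) := by
  induction k with
  | zero => simpa using Lip_P_f0
  | succ k ih =>
    rw [Function.iterate_succ_apply']
    convert ih.P (by positivity) using 1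
    ring

end LochsAux

namespace LochsAux

open scoped ENNReal

lemma measurable_gauss : Measurable gauss := by
  have : gauss = fun x => Int.fract (1 / x) := rfl
  rw [this]
  exact measurable_fract.comp (measurable_const.div measurable_id)

lemma measurable_w (n : ℕ) : Measurable (w n) := by
  unfold w; fun_prop

lemma measurable_f0 : Measurable f0 := by
  unfold f0; fun_prop

/-- inverse branches -/
noncomputable def br (n : ℕ) (t : ℝ) : ℝ := 1 / (n + 1 + t)

lemma measurable_br (n : ℕ) : Measurable (br n) := by
  unfold br; fun_prop

lemma gauss_br (n : ℕ) {t : ℝ} (h0 : 0 ≤ t) (h1 : t < 1) : gauss (br n t) = t := by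
  rw [gauss_eq_fract, br, one_div_one_div]
  have : (n : ℝ) + 1 + t = ((n + 1 : ℕ) : ℝ) + t := by push_cast; ring
  rw [this, Int.fract_natCast_add, Int.fract_eq_self.2 ⟨h0, h1⟩]

lemma br_inj {n m : ℕ} {s t : ℝ} (hs : s ∈ Ico (0 : ℝ) 1) (ht : t ∈ Ico (0 : ℝ) 1)
    (h : br n s = br m t) : n = m ∧ s = t := by
  have h1 := gauss_br n hs.1 hs.2
  have h2 := gauss_br m ht.1 ht.2
  rw [h, h2] at h1
  refine ⟨?_, h1.symm⟩
  subst h1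
  unfold br at h
  have hs0 := hs.1
  have := one_div_one_div ((n : ℝ) + 1 + t)
  rw [h, one_div_one_div] at this
  have h3 : (n : ℝ) = m := by linarith
  exact_mod_cast h3

lemma iUnion_br : ⋃ n : ℕ, Set.image (br n) (Ico (0 : ℝ) 1) = Ioc (0 : ℝ) 1 := by
  ext x
  simp only [mem_iUnion, mem_image]
  constructor
  · rintro ⟨n, t, ht, rfl⟩
    have := ht.1
    refine ⟨by unfold br; positivity, (pt_mem ht.1 n).2⟩
  · rintro ⟨h0, h1⟩
    have hx : 1 ≤ 1 / x := by rw [le_div_iff₀ h0]; linarith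
    have hf : 1 ≤ ⌊1 / x⌋ := Int.le_floor.2 (by exact_mod_cast hx)
    obtain ⟨n, hn⟩ := Int.eq_ofNat_of_zero_le (show 0 ≤ ⌊1 / x⌋ - 1 by omega)
    refine ⟨n, Int.fract (1 / x), ⟨Int.fract_nonneg _, Int.fract_lt_one _⟩, ?_⟩
    unfold br
    have : (n : ℝ) + 1 + Int.fract (1 / x) = 1 / x := by
      have h2 : (⌊1 / x⌋ : ℝ) = n + 1 := by
        have : ⌊1 / x⌋ = (n : ℤ) + 1 := by omega
        rw [this]; push_cast; rfl
      rw [← h2]; exact Int.floor_add_fract _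
    rw [this, one_div_one_div]

lemma hasDerivAt_br (n : ℕ) {t : ℝ} (h0 : 0 ≤ t) :
    HasDerivAt (br n) (-(1 / (n + 1 + t) ^ 2)) t := by
  have h : HasDerivAt (fun t : ℝ => (n : ℝ) + 1 + t) 1 t := (hasDerivAt_id t).const_add _
  have := h.inv (show (n : ℝ) + 1 + t ≠ 0 by positivity)
  have e : br n = fun t : ℝ => ((n : ℝ) + 1 + t)⁻¹ := by ext t; simp [br]
  rw [e, ← neg_div]
  exact this

lemma branch (F : ℝ → ℝ≥0∞) :
    ∫⁻ x in Ioo (0 : ℝ) 1, F x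
      = ∑' n : ℕ, ∫⁻ t in Ioo (0 : ℝ) 1, ENNReal.ofReal (1 / (n + 1 + t) ^ 2) * F (br n t) := by
  rw [setLIntegral_congr Ioo_ae_eq_Ioc, ← iUnion_br]
  have hm : ∀ n : ℕ, MeasurableSet (Set.image (br n) (Ico (0 : ℝ) 1)) := fun n =>
    measurableSet_Ico.image_of_measurable_injOn (measurable_br n) fun s hs t ht h => (br_inj hs ht h).2
  rw [lintegral_iUnion hm]
  · refine tsum_congr fun n => ?_
    rw [lintegral_image_eq_lintegral_abs_deriv_mul measurableSet_Ico
      (fun t ht => (hasDerivAt_br n ht.1).hasDerivWithinAt) fun s hs t ht h => (br_inj hs ht h).2]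
    rw [setLIntegral_congr Ioo_ae_eq_Ico.symm]
    refine setLIntegral_congr_fun measurableSet_Ioo fun t ht => ?_
    have := ht.1
    rw [abs_neg, abs_of_nonneg (by positivity)]
  · intro n m hnm
    rw [Function.onFun, Set.disjoint_left]
    rintro _ ⟨s, hs, rfl⟩ ⟨t, ht, h⟩
    exact hnm (br_inj ht hs h).1.symm

/-- density of the Gauss measure -/
noncomputable def dens (x : ℝ) : ℝ≥0∞ := ENNReal.ofReal (1 / ((1 + x) * Real.log 2))

/-- Gauss measure -/
noncomputable def μ : Measure ℝ := (volume.restrict (Ioo (0 : ℝ) 1)).withDensity dens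

lemma measurable_dens : Measurable dens := by unfold dens; fun_prop

lemma log2_pos : 0 < Real.log 2 := Real.log_pos (by norm_num)

lemma ae_mu_iff (p : ℝ → Prop) : (∀ᵐ x ∂μ, p x) ↔ ∀ᵐ x, x ∈ Ioo (0 : ℝ) 1 → p x := by
  unfold μ
  rw [ae_withDensity_iff measurable_dens, ae_restrict_iff' measurableSet_Ioo]
  refine Filter.eventually_congr (Eventually.of_forall fun x => ?_)
  refine forall_congr' fun hx => ?_
  have : dens x ≠ 0 := by
    unfold dens
    have := log2_pos
    have := hx.1
    simp only [ne_eq, ENNReal.ofReal_eq_zero, not_le]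
    positivity
  simp [this]

lemma ae_mem : ∀ᵐ x ∂μ, x ∈ Ioo (0 : ℝ) 1 := by
  rw [ae_mu_iff]; exact Eventually.of_forall fun x h => h

lemma lintegral_mu {F : ℝ → ℝ≥0∞} (hF : Measurable F) :
    ∫⁻ x, F x ∂μ = ∫⁻ x in Ioo (0 : ℝ) 1, dens x * F x := by
  unfold μ
  rw [lintegral_withDensity_eq_lintegral_mul _ measurable_dens hF]
  rfl

/-- transfer operator on extended nonnegative functions -/
noncomputable def PE (g : ℝ → ℝ≥0∞) (x : ℝ) : ℝ≥0∞ :=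
  ∑' n : ℕ, ENNReal.ofReal (w n x) * g (br n x)

lemma measurable_PE {g : ℝ → ℝ≥0∞} (hg : Measurable g) : Measurable (PE g) :=
  Measurable.tsum fun n =>
    ((measurable_w n).ennreal_ofReal).mul (hg.comp (measurable_br n))

lemma dual {h g : ℝ → ℝ≥0∞} (hh : Measurable h) (hg : Measurable g) :
    ∫⁻ x, h (gauss x) * g x ∂μ = ∫⁻ x, h x * PE g x ∂μ := by
  have m1 : Measurable fun x => h (gauss x) * g x := (hh.comp measurable_gauss).mul hg
  have m2 : Measurable fun x => h x * PE g x := hh.mul (measurable_PE hg)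
  rw [lintegral_mu m1, lintegral_mu m2, branch, ← lintegral_tsum]
  · refine setLIntegral_congr_fun measurableSet_Ioo fun t ht => ?_
    simp only [PE]
    rw [← mul_assoc, ← ENNReal.tsum_mul_left]
    refine tsum_congr fun n => ?_
    rw [gauss_br n ht.1.le ht.2]
    have key : ENNReal.ofReal (1 / (n + 1 + t) ^ 2) * dens (br n t)
        = dens t * ENNReal.ofReal (w n t) := by
      have := ht.1
      have := log2_pos
      unfold dens
      rw [← ENNReal.ofReal_mul (by positivity), ← ENNReal.ofReal_mul (by positivity)]
      congr 1
      unfold br w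
      field_simp
      ring
    calc _ = ENNReal.ofReal (1 / (n + 1 + t) ^ 2) * dens (br n t) * (h t * g (br n t)) := by ring
      _ = _ := by rw [key]; ring
  · intro n
    have h1 := measurable_br n
    have h2 := measurable_dens
    have h3 := measurable_gauss
    have h4 : Measurable fun t : ℝ => ENNReal.ofReal (1 / (n + 1 + t) ^ 2) := by fun_prop
    exact (h4.mul ((h2.comp h1).mul ((hh.comp (h3.comp h1)).mul (hg.comp h1)))).aemeasurable

lemma PE_one {x : ℝ} (hx : 0 ≤ x) : PE (fun _ => 1) x = 1 := by
  unfold PE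
  simp only [mul_one]
  rw [← ENNReal.ofReal_tsum_of_nonneg (w_nonneg hx) (hasSum_w hx).summable, (hasSum_w hx).tsum_eq,
    ENNReal.ofReal_one]

lemma mp : MeasurePreserving gauss μ μ := by
  refine ⟨measurable_gauss, ?_⟩
  ext s hs
  rw [Measure.map_apply measurable_gauss hs, ← lintegral_indicator_one hs,
    ← lintegral_indicator_one (measurable_gauss hs)]
  have h := dual (h := s.indicator 1) (g := fun _ => 1) (measurable_one.indicator hs) measurable_const
  simp only [mul_one] at h
  have e : (fun x => (gauss ⁻¹' s).indicator (1 : ℝ → ℝ≥0∞) x) = fun x => s.indicator 1 (gauss x) := by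
    ext x; rfl
  rw [e, h]
  refine lintegral_congr_ae ?_
  filter_upwards [ae_mem] with x hx
  rw [PE_one hx.1.le, mul_one]

instance : IsProbabilityMeasure μ := by
  refine ⟨?_⟩
  rw [← lintegral_one, lintegral_mu measurable_const]
  simp only [mul_one]
  unfold dens
  have hl := log2_pos
  have hi : IntervalIntegrable (fun x : ℝ => 1 / ((1 + x) * Real.log 2)) volume 0 1 := by
    apply ContinuousOn.intervalIntegrable
    intro x hx
    rw [uIcc_of_le zero_le_one] at hx
    have := hx.1
    refine ContinuousAt.continuousWithinAt ?_
    have : (1 + x) * Real.log 2 ≠ 0 := by positivity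
    fun_prop (disch := assumption)
  rw [← ofReal_integral_eq_lintegral_ofReal]
  · rw [← integral_Ioc_eq_integral_Ioo, ← intervalIntegral.integral_of_le zero_le_one]
    have : ∀ x : ℝ, 1 / ((1 + x) * Real.log 2) = (1 / Real.log 2) * (1 + x)⁻¹ := by
      intro x; rw [one_div, mul_inv, one_div, mul_comm]
    simp_rw [this]
    rw [intervalIntegral.integral_const_mul, intervalIntegral.integral_comp_add_left (fun x => x⁻¹) 1,
      integral_inv_of_pos (by norm_num) (by norm_num)]
    norm_num
  · rw [intervalIntegrable_iff_integrableOn_Ioc_of_le zero_le_one] at hi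
    exact hi.mono_set Ioo_subset_Ioc_self
  · filter_upwards [ae_restrict_mem measurableSet_Ioo] with x hx
    have := hx.1
    simp only [Pi.zero_apply]
    positivity

lemma iter_nonneg (k : ℕ) {x : ℝ} (h0 : 0 ≤ x) (h1 : x ≤ 1) : 0 ≤ P^[k] f0 x := by
  cases k with
  | zero => exact f0_nonneg h0 h1
  | succ k => exact (Lip_iter k).1 x h0 h1

lemma iter_summable (k : ℕ) {x : ℝ} (h0 : 0 ≤ x) :
    Summable fun n : ℕ => w n x * P^[k] f0 (1 / (n + 1 + x)) := by
  cases k with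
  | zero => exact f0_summable h0
  | succ k => exact (Lip_iter k).summable (by positivity) h0

/-- extended version of the observable -/
noncomputable def F0 (x : ℝ) : ℝ≥0∞ := ENNReal.ofReal (f0 x)

lemma measurable_F0 : Measurable F0 := measurable_f0.ennreal_ofReal

lemma measurable_iter (k : ℕ) : Measurable (PE^[k] F0) := by
  induction k with
  | zero => exact measurable_F0
  | succ k ih => rw [Function.iterate_succ_apply']; exact measurable_PE ih

lemma PE_iter (k : ℕ) : ∀ x : ℝ, 0 ≤ x → x ≤ 1 → PE^[k] F0 x = ENNReal.ofReal (P^[k] f0 x) := by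
  induction k with
  | zero => intro x _ _; rfl
  | succ k ih =>
    intro x h0 h1
    rw [Function.iterate_succ_apply', Function.iterate_succ_apply', PE, P,
      ENNReal.ofReal_tsum_of_nonneg _ (iter_summable k h0)]
    · refine tsum_congr fun n => ?_
      rw [br, ih _ (pt_mem h0 n).1 (pt_mem h0 n).2, ENNReal.ofReal_mul (w_nonneg h0 n)]
    · intro n
      exact mul_nonneg (w_nonneg h0 n) (iter_nonneg k (pt_mem h0 n).1 (pt_mem h0 n).2)

lemma dual_iter {h : ℝ → ℝ≥0∞} (hh : Measurable h) (k : ℕ) :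
    ∫⁻ x, h (gauss^[k] x) * F0 x ∂μ = ∫⁻ x, h x * PE^[k] F0 x ∂μ := by
  induction k generalizing h with
  | zero => rfl
  | succ k ih =>
    have h1 := ih (h := fun x => h (gauss x)) (hh.comp measurable_gauss)
    simp only [Function.iterate_succ_apply']
    rw [h1, dual hh (measurable_iter k)]

lemma lintegral_iter (k : ℕ) : ∫⁻ x, PE^[k] F0 x ∂μ = ∫⁻ x, F0 x ∂μ := by
  have := dual_iter (h := fun _ => 1) measurable_const k
  simp only [one_mul] at this
  exact this.symm

lemma iter_le (k : ℕ) {x : ℝ} (h0 : 0 ≤ x) (h1 : x ≤ 1) :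
    PE^[k + 1] F0 x ≤ ∫⁻ y, F0 y ∂μ + ENNReal.ofReal (2 * (5 / 6) ^ k) := by
  have : ∀ᵐ y ∂μ, PE^[k + 1] F0 x ≤ PE^[k + 1] F0 y + ENNReal.ofReal (2 * (5 / 6) ^ k) := by
    filter_upwards [ae_mem] with y hy
    rw [PE_iter _ x h0 h1, PE_iter _ y hy.1.le hy.2.le,
      ← ENNReal.ofReal_add (iter_nonneg _ hy.1.le hy.2.le) (by positivity)]
    apply ENNReal.ofReal_le_ofReal
    have h2 := (Lip_iter k).2 x y h0 h1 hy.1.le hy.2.le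
    have h3 : |x - y| ≤ 1 := by rw [abs_le]; constructor <;> linarith [hy.1, hy.2]
    have h4 : 2 * (5 / 6 : ℝ) ^ k * |x - y| ≤ 2 * (5 / 6) ^ k * 1 := by gcongr
    have := le_abs_self (P^[k + 1] f0 x - P^[k + 1] f0 y)
    linarith
  have h := lintegral_mono_ae this
  rw [lintegral_const, measure_univ, mul_one, lintegral_add_right _ measurable_const,
    lintegral_const, measure_univ, mul_one, lintegral_iter] at h
  exact h

lemma corr_le (k : ℕ) :
    ∫⁻ x, F0 (gauss^[k + 1] x) * F0 x ∂μ
      ≤ (∫⁻ x, F0 x ∂μ) * (∫⁻ y, F0 y ∂μ + ENNReal.ofReal (2 * (5 / 6) ^ k)) := by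
  rw [dual_iter measurable_F0, ← lintegral_mul_const _ measurable_F0]
  refine lintegral_mono_ae ?_
  filter_upwards [ae_mem] with x hx
  gcongr
  exact iter_le k hx.1.le hx.2.le

end LochsAux

namespace LochsAux

open scoped ENNReal

lemma alt_sum : HasSum (fun n : ℕ => (-1 : ℝ) ^ n * (1 / ((n : ℝ) + 1) ^ 2)) (Real.pi ^ 2 / 12) := by
  have h0 : HasSum (fun n : ℕ => 1 / ((n : ℝ) + 1) ^ 2) (Real.pi ^ 2 / 6) := by
    have := (hasSum_nat_add_iff' 1).2 hasSum_zeta_two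
    simpa using this
  set a : ℕ → ℝ := fun n => 1 / ((n : ℝ) + 1) ^ 2 with ha
  have ho : HasSum (fun k => a (2 * k + 1)) (1 / 4 * (Real.pi ^ 2 / 6)) := by
    have e : (fun k => a (2 * k + 1)) = fun k => 1 / 4 * a k := by
      funext k
      simp only [ha]
      push_cast
      have : (2 * (k : ℝ) + 1 + 1) = 2 * (k + 1) := by ring
      rw [this, mul_pow]
      field_simp
      norm_num
    rw [e]
    exact h0.mul_left (1 / 4)
  have he0 : Summable fun k => a (2 * k) :=
    h0.summable.comp_injective (i := fun k : ℕ => 2 * k) fun x y h => by simpa using h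
  have he := he0.hasSum
  have hE := (he.even_add_odd ho).unique h0
  have h1 : HasSum (fun k => (-1 : ℝ) ^ (2 * k) * a (2 * k)) (∑' k, a (2 * k)) := by
    simpa using he
  have h2 : HasSum (fun k => (-1 : ℝ) ^ (2 * k + 1) * a (2 * k + 1)) (-(1 / 4 * (Real.pi ^ 2 / 6))) := by
    have e : (fun k => (-1 : ℝ) ^ (2 * k + 1) * a (2 * k + 1)) = fun k => -(a (2 * k + 1)) := by
      funext k
      rw [pow_succ, pow_mul]; simp
    rw [e]
    exact ho.neg
  have := HasSum.even_add_odd (f := fun n => (-1 : ℝ) ^ n * a n) h1 h2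
  have e : Real.pi ^ 2 / 12 = (∑' k, a (2 * k)) + -(1 / 4 * (Real.pi ^ 2 / 6)) := by linarith
  rw [e]
  exact this

lemma int_pow_f0 (n : ℕ) :
    IntegrableOn (fun x : ℝ => x ^ n * f0 x) (Ioo 0 1) ∧
    ∫ x in Ioo (0 : ℝ) 1, x ^ n * f0 x = 1 / ((n : ℝ) + 1) ^ 2 := by
  have hi : IntervalIntegrable (fun x : ℝ => x ^ n * f0 x) volume 0 1 := by
    refine IntervalIntegrable.continuousOn_mul ?_ (by fun_prop)
    exact (intervalIntegral.intervalIntegrable_log').neg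
  refine ⟨((intervalIntegrable_iff_integrableOn_Ioc_of_le zero_le_one).1 hi).mono_set
    Ioo_subset_Ioc_self, ?_⟩
  rw [← integral_Ioc_eq_integral_Ioo, ← intervalIntegral.integral_of_le zero_le_one]
  rw [intervalIntegral.integral_eq_sub_of_hasDerivAt_of_le (f := fun x : ℝ =>
    -(x ^ n * (x * Real.log x)) / (n + 1) + x ^ (n + 1) / ((n : ℝ) + 1) ^ 2) zero_le_one _ _ hi]
  · simp
  · have := Real.continuous_mul_log
    fun_prop
  · intro x hx
    have hx0 := hx.1
    have h1 := (hasDerivAt_pow (n + 1) x).mul (Real.hasDerivAt_log hx0.ne')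
    have h2 := (h1.neg.div_const ((n : ℝ) + 1)).add ((hasDerivAt_pow (n + 1) x).div_const (((n : ℝ) + 1) ^ 2))
    have e : (fun x : ℝ => -(x ^ n * (x * Real.log x)) / (n + 1) + x ^ (n + 1) / ((n : ℝ) + 1) ^ 2)
      = fun x : ℝ => -(x ^ (n + 1) * Real.log x) / (n + 1) + x ^ (n + 1) / ((n : ℝ) + 1) ^ 2 := by
      ext x; ring
    rw [e]
    refine HasDerivAt.congr_deriv h2 ?_
    unfold f0
    simp only [Nat.add_sub_cancel]
    push_cast
    field_simp
    ring

/-- The Levy constant -/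
noncomputable def lam : ℝ := Real.pi ^ 2 / (12 * Real.log 2)

lemma lam_pos : 0 < lam := by
  have := log2_pos
  unfold lam; positivity

lemma integral_f0 : ∫ x, f0 x ∂μ = lam := by
  unfold μ
  rw [integral_withDensity_eq_integral_toReal_smul measurable_dens
    (Eventually.of_forall fun x => ENNReal.ofReal_lt_top)]
  have hs := hasSum_integral_of_summable_integral_norm
    (F := fun (n : ℕ) (x : ℝ) => (-1 : ℝ) ^ n * (x ^ n * f0 x))
    (μ := volume.restrict (Ioo (0 : ℝ) 1)) (fun n => (int_pow_f0 n).1.const_mul _) ?_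
  · have e1 : ∀ n : ℕ, ∫ x in Ioo (0 : ℝ) 1, (-1 : ℝ) ^ n * (x ^ n * f0 x)
        = (-1 : ℝ) ^ n * (1 / ((n : ℝ) + 1) ^ 2) := by
      intro n; rw [integral_const_mul, (int_pow_f0 n).2]
    simp_rw [e1] at hs
    have e2 := hs.unique alt_sum
    have e3 : ∫ x in Ioo (0 : ℝ) 1, (dens x).toReal • f0 x
        = ∫ x in Ioo (0 : ℝ) 1, (1 / Real.log 2) * ∑' n : ℕ, (-1 : ℝ) ^ n * (x ^ n * f0 x) := by
      refine setIntegral_congr_fun measurableSet_Ioo fun x hx => ?_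
      have hx0 := hx.1
      have hl := log2_pos
      have : ∑' n : ℕ, (-1 : ℝ) ^ n * (x ^ n * f0 x) = (1 + x)⁻¹ * f0 x := by
        have hg := hasSum_geometric_of_abs_lt_one (r := -x) (by
          rw [abs_neg, abs_of_pos hx0]; exact hx.2)
        have := (hg.mul_right (f0 x)).tsum_eq
        rw [sub_neg_eq_add] at this
        rw [← this]
        refine tsum_congr fun n => ?_
        rw [neg_pow x]; ring
      simp only [smul_eq_mul]
      rw [this, dens, ENNReal.toReal_ofReal (by positivity)]
      field_simp
    rw [e3, integral_const_mul, e2]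
    unfold lam
    have hl := log2_pos
    field_simp
  · have : ∀ n : ℕ, ∫ x in Ioo (0 : ℝ) 1, ‖(-1 : ℝ) ^ n * (x ^ n * f0 x)‖ = 1 / ((n : ℝ) + 1) ^ 2 := by
      intro n
      rw [← (int_pow_f0 n).2]
      refine setIntegral_congr_fun measurableSet_Ioo fun x hx => ?_
      have h1 := f0_nonneg hx.1.le hx.2.le
      have h2 := hx.1
      rw [norm_mul, norm_pow, norm_neg, norm_one, one_pow, one_mul, Real.norm_of_nonneg (by positivity)]
    simp_rw [this]
    have := (summable_nat_add_iff 1).2 hasSum_zeta_two.summable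
    simpa using this

lemma memLp_f0 : MemLp f0 2 μ := by
  rw [memLp_two_iff_integrable_sq measurable_f0.aestronglyMeasurable]
  have hl := log2_pos
  have h1 : μ ≤ ENNReal.ofReal (1 / Real.log 2) • volume.restrict (Ioo (0 : ℝ) 1) := by
    rw [← withDensity_const]
    refine withDensity_mono ?_
    filter_upwards [ae_restrict_mem measurableSet_Ioo] with x hx
    apply ENNReal.ofReal_le_ofReal
    apply one_div_le_one_div_of_le hl
    nlinarith [hx.1]
  refine Integrable.mono_measure (ν := ENNReal.ofReal (1 / Real.log 2) • volume.restrict (Ioo (0 : ℝ) 1))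
    ?_ h1
  refine Integrable.smul_measure ?_ ENNReal.ofReal_ne_top
  have hi : IntervalIntegrable (fun x : ℝ => 16 * x ^ (-(1 / 2) : ℝ)) volume 0 1 :=
    (intervalIntegral.intervalIntegrable_rpow' (by norm_num)).const_mul _
  have hi' := ((intervalIntegrable_iff_integrableOn_Ioc_of_le zero_le_one).1 hi).mono_set
    Ioo_subset_Ioc_self
  refine Integrable.mono' hi' (measurable_f0.pow_const 2).aestronglyMeasurable ?_
  filter_upwards [ae_restrict_mem measurableSet_Ioo] with x hx
  have h := Real.abs_log_mul_self_rpow_lt x (1 / 4) hx.1 hx.2.le (by norm_num)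
  have hp : (0 : ℝ) < x ^ (1 / 4 : ℝ) := Real.rpow_pos_of_pos hx.1 _
  rw [Real.norm_of_nonneg (sq_nonneg _)]
  have e : x ^ (-(1 / 2) : ℝ) = ((x ^ (1 / 4 : ℝ)) ^ 2)⁻¹ := by
    rw [Real.rpow_neg hx.1.le, ← Real.rpow_natCast, ← Real.rpow_mul hx.1.le]
    norm_num
  rw [e, ← div_eq_mul_inv, le_div_iff₀ (by positivity), ← mul_pow]
  have h2 : |f0 x * x ^ (1 / 4 : ℝ)| ≤ 4 := by
    unfold f0
    rw [neg_mul, abs_neg]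
    refine h.le.trans (by norm_num)
  rw [← sq_abs]
  nlinarith [abs_nonneg (f0 x * x ^ (1 / 4 : ℝ))]

lemma integrable_f0 : Integrable f0 μ := memLp_f0.integrable (by norm_num)

lemma lintegral_F0 : ∫⁻ x, F0 x ∂μ = ENNReal.ofReal lam := by
  rw [← integral_f0, ofReal_integral_eq_lintegral_ofReal integrable_f0]
  · rfl
  · filter_upwards [ae_mem] with x hx
    exact f0_nonneg hx.1.le hx.2.le

/-- the stationary process -/
noncomputable def X (k : ℕ) (x : ℝ) : ℝ := f0 (gauss^[k] x)

lemma measurable_X (k : ℕ) : Measurable (X k) := measurable_f0.comp (measurable_gauss.iterate k)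

lemma memLp_X (k : ℕ) : MemLp (X k) 2 μ := memLp_f0.comp_measurePreserving (mp.iterate k)

lemma integral_comp_iter {h : ℝ → ℝ} (hh : Measurable h) (k : ℕ) :
    ∫ x, h (gauss^[k] x) ∂μ = ∫ x, h x ∂μ := by
  have := integral_map (μ := μ) (φ := gauss^[k]) (f := h) (measurable_gauss.iterate k).aemeasurable
    hh.aestronglyMeasurable
  rw [(mp.iterate k).map_eq] at this
  exact this.symm

lemma integral_X (k : ℕ) : ∫ x, X k x ∂μ = lam := by
  rw [← integral_f0]; exact integral_comp_iter measurable_f0 k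

lemma X_nonneg {k : ℕ} {x : ℝ} (h0 : 0 ≤ x) (h1 : x ≤ 1) : 0 ≤ X k x := by
  cases k with
  | zero => exact f0_nonneg h0 h1
  | succ k =>
    unfold X
    rw [Function.iterate_succ_apply']
    exact f0_nonneg (gauss_nonneg _) (gauss_lt_one _).le

lemma corr0 (k : ℕ) : ∫ x, X (k + 1) x * X 0 x ∂μ ≤ lam ^ 2 + 2 * lam * (5 / 6) ^ k := by
  have hl := lam_pos
  rw [integral_eq_lintegral_of_nonneg_ae]
  · refine ENNReal.toReal_le_of_le_ofReal (by positivity) ?_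
    have h := corr_le k
    rw [lintegral_F0, ← ENNReal.ofReal_add hl.le (by positivity), ← ENNReal.ofReal_mul hl.le] at h
    calc _ = ∫⁻ x, F0 (gauss^[k + 1] x) * F0 x ∂μ := by
          refine lintegral_congr_ae ?_
          filter_upwards [ae_mem] with x hx
          rw [ENNReal.ofReal_mul (X_nonneg hx.1.le hx.2.le)]
          rfl
      _ ≤ _ := h
      _ = _ := by congr 1; ring
  · filter_upwards [ae_mem] with x hx
    exact mul_nonneg (X_nonneg hx.1.le hx.2.le) (X_nonneg hx.1.le hx.2.le)
  · exact ((measurable_X _).mul (measurable_X _)).aestronglyMeasurable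

lemma corr (i k : ℕ) : ∫ x, X i x * X (i + (k + 1)) x ∂μ ≤ lam ^ 2 + 2 * lam * (5 / 6) ^ k := by
  refine le_trans (le_of_eq ?_) (corr0 k)
  have hm : Measurable fun x => X (k + 1) x * X 0 x := (measurable_X _).mul (measurable_X _)
  rw [← integral_comp_iter hm i]
  refine integral_congr_ae (Eventually.of_forall fun x => ?_)
  simp only [X, Function.iterate_zero, id]
  rw [add_comm i, Function.iterate_add_apply, mul_comm]

/-- centered process -/
noncomputable def Y (k : ℕ) (x : ℝ) : ℝ := X k x - lam

lemma memLp_Y (k : ℕ) : MemLp (Y k) 2 μ := (memLp_X k).sub (memLp_const lam)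

lemma corrY (i k : ℕ) : ∫ x, Y i x * Y (i + (k + 1)) x ∂μ ≤ 2 * lam * (5 / 6) ^ k := by
  have hc := corr i k
  set j := i + (k + 1)
  have iij : Integrable (fun x => X i x * X j x) μ := (memLp_X i).integrable_mul (memLp_X j)
  have ii : Integrable (X i) μ := (memLp_X i).integrable (by norm_num)
  have ij : Integrable (X j) μ := (memLp_X j).integrable (by norm_num)
  have e : ∀ x, Y i x * Y j x = X i x * X j x - lam * X i x - lam * X j x + lam ^ 2 := by
    intro x; unfold Y; ring
  simp_rw [e]
  have a1 := integral_add (((iij.sub (ii.const_mul lam)).sub (ij.const_mul lam))) (integrable_const (μ := μ) (lam ^ 2))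
  have a2 := integral_sub ((iij.sub (ii.const_mul lam))) (ij.const_mul lam)
  have a3 := integral_sub iij (ii.const_mul lam)
  simp only [Pi.sub_apply] at a1 a2 a3
  rw [a1, a2, a3, integral_const_mul, integral_const_mul, integral_X, integral_X, integral_const]
  simp only [probReal_univ, one_smul]
  linarith

/-- centered Birkhoff sums -/
noncomputable def Z (N : ℕ) (x : ℝ) : ℝ := ∑ i ∈ Finset.range N, Y i x

lemma Z_eq (N : ℕ) (x : ℝ) : Z N x = S N x - N * lam := by
  unfold Z Y S X f0
  rw [Finset.sum_sub_distrib]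
  simp

lemma memLp_Z (N : ℕ) : MemLp (Z N) 2 μ := memLp_finsetSum _ fun i _ => memLp_Y i

lemma geom_le (N : ℕ) : ∑ k ∈ Finset.range N, (5 / 6 : ℝ) ^ k ≤ 6 := by
  have h := Summable.sum_le_tsum (f := fun k : ℕ => (5 / 6 : ℝ) ^ k) (Finset.range N) (fun k _ => by positivity)
    (summable_geometric_of_lt_one (by norm_num) (by norm_num))
  rw [tsum_geometric_of_lt_one (by norm_num) (by norm_num)] at h
  norm_num at h ⊢
  exact h

lemma cross (N : ℕ) : ∫ x, Z N x * Y N x ∂μ ≤ 12 * lam := by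
  have hl := lam_pos
  have e : ∀ x, Z N x * Y N x = ∑ i ∈ Finset.range N, Y i x * Y N x := by
    intro x; unfold Z; rw [Finset.sum_mul]
  simp_rw [e]
  rw [integral_finsetSum _ fun i _ =>
    (show Integrable (fun x => Y i x * Y N x) μ from (memLp_Y i).integrable_mul (memLp_Y N))]
  calc _ ≤ ∑ i ∈ Finset.range N, 2 * lam * (5 / 6) ^ (N - 1 - i) := by
        refine Finset.sum_le_sum fun i hi => ?_
        rw [Finset.mem_range] at hi
        have h := corrY i (N - 1 - i)
        have : i + (N - 1 - i + 1) = N := by omega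
        rw [this] at h
        exact h
    _ = 2 * lam * ∑ k ∈ Finset.range N, (5 / 6 : ℝ) ^ k := by
      rw [← Finset.mul_sum, Finset.sum_range_reflect (fun k => (5 / 6 : ℝ) ^ k) N]
    _ ≤ 2 * lam * 6 := by have := geom_le N; gcongr
    _ = _ := by ring

lemma var_le : ∃ C : ℝ, ∀ N : ℕ, ∫ x, (Z N x) ^ 2 ∂μ ≤ C * N := by
  refine ⟨24 * lam + ∫ x, (f0 x - lam) ^ 2 ∂μ, fun N => ?_⟩
  induction N with
  | zero => simp [Z]
  | succ N ih =>
    have e : ∀ x, (Z (N + 1) x) ^ 2 = (Z N x) ^ 2 + 2 * (Z N x * Y N x) + (Y N x) ^ 2 := by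
      intro x; unfold Z; rw [Finset.sum_range_succ]; ring
    simp_rw [e]
    have i1 : Integrable (fun x => (Z N x) ^ 2) μ := (memLp_Z N).integrable_sq
    have i2 : Integrable (fun x => 2 * (Z N x * Y N x)) μ :=
      ((memLp_Z N).integrable_mul (memLp_Y N)).const_mul 2
    have i3 : Integrable (fun x => (Y N x) ^ 2) μ := (memLp_Y N).integrable_sq
    have a1 := integral_add (i1.add i2) i3
    have a2 := integral_add i1 i2
    simp only [Pi.add_apply] at a1 a2
    rw [a1, a2, integral_const_mul]
    have h3 : ∫ x, (Y N x) ^ 2 ∂μ = ∫ x, (f0 x - lam) ^ 2 ∂μ :=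
      integral_comp_iter (h := fun x => (f0 x - lam) ^ 2)
        ((measurable_f0.sub_const lam).pow_const 2) N
    rw [h3]
    have := cross N
    push_cast
    linarith

lemma ae_subseq : ∀ᵐ x ∂μ,
    Tendsto (fun k : ℕ => Z ((k + 1) ^ 2) x / (((k + 1) ^ 2 : ℕ) : ℝ)) atTop (nhds 0) := by
  obtain ⟨C, hC⟩ := var_le
  set U : ℕ → ℝ → ℝ := fun k x => Z ((k + 1) ^ 2) x / (((k + 1) ^ 2 : ℕ) : ℝ) with hU
  have hUm : ∀ k, MemLp (U k) 2 μ := fun k => by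
    have := (memLp_Z ((k + 1) ^ 2)).const_mul ((((k + 1) ^ 2 : ℕ) : ℝ)⁻¹)
    have e : U k = fun x => (((k + 1) ^ 2 : ℕ) : ℝ)⁻¹ * Z ((k + 1) ^ 2) x := by
      funext x; simp only [hU, div_eq_inv_mul]
    rw [e]; exact this
  have hintg : ∀ k, ∫ x, (U k x) ^ 2 ∂μ ≤ C * (1 / ((k : ℝ) + 1) ^ 2) := by
    intro k
    have e : ∀ x, (U k x) ^ 2 = (1 / (((k + 1) ^ 2 : ℕ) : ℝ) ^ 2) * (Z ((k + 1) ^ 2) x) ^ 2 := by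
      intro x; simp only [hU]; rw [div_pow]; ring
    simp_rw [e]
    rw [integral_const_mul]
    have h := hC ((k + 1) ^ 2)
    calc _ ≤ 1 / (((k + 1) ^ 2 : ℕ) : ℝ) ^ 2 * (C * (((k + 1) ^ 2 : ℕ) : ℝ)) := by gcongr
      _ = _ := by push_cast; field_simp
  have hsum : Summable fun k : ℕ => C * (1 / ((k : ℝ) + 1) ^ 2) := by
    have := ((summable_nat_add_iff 1).2 hasSum_zeta_two.summable).mul_left C
    simpa using this
  have hmeas : ∀ k, AEMeasurable (fun x => ENNReal.ofReal ((U k x) ^ 2)) μ := fun k =>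
    ((hUm k).1.aemeasurable.pow_const 2).ennreal_ofReal
  have hfin : ∫⁻ x, ∑' k, ENNReal.ofReal ((U k x) ^ 2) ∂μ ≠ ∞ := by
    rw [lintegral_tsum hmeas]
    have hs2 : Summable fun k => ∫ x, (U k x) ^ 2 ∂μ :=
      Summable.of_nonneg_of_le (fun k => integral_nonneg fun x => sq_nonneg _) hintg hsum
    have : ∀ k, ∫⁻ x, ENNReal.ofReal ((U k x) ^ 2) ∂μ = ENNReal.ofReal (∫ x, (U k x) ^ 2 ∂μ) := by
      intro k
      rw [ofReal_integral_eq_lintegral_ofReal (hUm k).integrable_sq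
        (Eventually.of_forall fun x => sq_nonneg _)]
    simp_rw [this]
    rw [← ENNReal.ofReal_tsum_of_nonneg (fun k => integral_nonneg fun x => sq_nonneg _) hs2]
    exact ENNReal.ofReal_ne_top
  have hae := ae_lt_top' (AEMeasurable.tsum hmeas) hfin
  filter_upwards [hae] with x hx
  have h1 := ENNReal.tendsto_cofinite_zero_of_tsum_ne_top hx.ne
  rw [Nat.cofinite_eq_atTop] at h1
  have h2 := (ENNReal.tendsto_toReal ENNReal.zero_ne_top).comp h1
  have h3 : Tendsto (fun k => (U k x) ^ 2) atTop (nhds 0) := by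
    refine h2.congr fun k => ?_
    simp [ENNReal.toReal_ofReal (sq_nonneg _)]
  have h4 := h3.sqrt
  simp only [Real.sqrt_sq_eq_abs, Real.sqrt_zero] at h4
  exact (tendsto_zero_iff_abs_tendsto_zero _).2 h4

lemma ae_levy : ∀ᵐ x ∂μ, Tendsto (fun m : ℕ => S m x / m) atTop (nhds lam) := by
  filter_upwards [ae_subseq, ae_mem] with x hx hm
  refine tendsto_div_of_monotone_of_exists_subseq_tendsto_div (fun m => S m x) lam
    (S_mono hm.1.le hm.2.le) fun a ha => ⟨fun k => (k + 1) ^ 2, ?_, ?_, ?_⟩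
  · have h1 : Tendsto (fun k : ℕ => (1 + 1 / ((k : ℝ) + 1)) ^ 2) atTop (nhds ((1 + 0) ^ 2)) :=
      (tendsto_one_div_add_atTop_nhds_zero_nat.const_add 1).pow 2
    norm_num at h1
    have h2 := h1.eventually_le_const (show (1 : ℝ) < a from ha)
    filter_upwards [h2] with k hk
    push_cast
    have e : ((k : ℝ) + 1 + 1) ^ 2 = (1 + ((k : ℝ) + 1)⁻¹) ^ 2 * (k + 1) ^ 2 := by
      rw [← mul_pow]; congr 1; field_simp
    rw [e]
    gcongr
  · exact (tendsto_pow_atTop (by norm_num)).comp (tendsto_add_atTop_nat 1)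
  · have := hx.add_const lam
    rw [zero_add] at this
    refine this.congr fun k => ?_
    rw [Z_eq]
    have : (((k + 1) ^ 2 : ℕ) : ℝ) ≠ 0 := by positivity
    field_simp
    ring

end LochsAux

theorem lochs :
    ∀ᵐ x ∂(volume : Measure ℝ), x ∈ Set.Ioo (0 : ℝ) 1 →
      Tendsto (fun n : ℕ => (mDecCF x n : ℝ) / n) atTop
        (nhds (6 * Real.log 2 * Real.log 10 / Real.pi ^ 2)) := by
  have h1 := (LochsAux.ae_mu_iff _).1 LochsAux.ae_levy
  have h2 : ∀ᵐ x : ℝ, Irrational x := by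
    have : (Set.range ((↑) : ℚ → ℝ)).Countable := Set.countable_range _
    have := this.ae_notMem volume
    exact this
  filter_upwards [h1, h2] with x hx hi hm
  have := LochsAux.deterministic (x := x) ⟨hi, hm.1, hm.2⟩ LochsAux.lam_pos (hx hm)
  convert this using 2
  unfold LochsAux.lam
  have hl := LochsAux.log2_pos
  have := Real.pi_pos
  field_simp
  ring
end

section
/- Let g ≥ 2 be an integer. For Lebesgue-almost every x ∈ (0,1), the number m_g^{RCF}(x,n) of regular continued fraction partial quotients of x determined by its first n g-adic digits satisfies lim_{n→∞} m_g^{RCF}(x,n)/n = (6·log 2·log g)/π². -/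
open MeasureTheory Filter Set

/-- The number of regular continued fraction partial quotients of `x` determined by its
first `n` `g`-adic digits. -/
noncomputable def mRadixCF (g : ℕ) (x : ℝ) (n : ℕ) : ℕ :=
  sSup {m : ℕ | ∀ y ∈ radixCyl g n x, Irrational y → ∀ i < m, cfDigit i y = cfDigit i x}


/-- product of the first `n` orbit points -/
noncomputable def orbProd (n : ℕ) (x : ℝ) : ℝ := ∏ i ∈ Finset.range n, gauss^[i] x

/-- irrational in the unit interval -/
def IrrU (x : ℝ) : Prop := Irrational x ∧ 0 < x ∧ x < 1

lemma gauss_eq_fract (x : ℝ) : gauss x = Int.fract (1 / x) := rfl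

lemma IrrU.gauss {x : ℝ} (h : IrrU x) : IrrU (gauss x) := by
  obtain ⟨hi, h0, h1⟩ := h
  have hirr : Irrational (_root_.gauss x) := by
    unfold _root_.gauss
    rw [one_div]
    exact (irrational_inv_iff.mpr hi).sub_intCast _
  refine ⟨hirr, ?_, ?_⟩
  · rcases (Int.fract_nonneg (1 / x)).lt_or_eq with h | h
    · exact h
    · exact absurd (by rw [gauss_eq_fract, ← h]; simp) hirr
  · exact Int.fract_lt_one _

lemma IrrU.iter {x : ℝ} (h : IrrU x) (n : ℕ) : IrrU (_root_.gauss^[n] x) := by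
  induction n with
  | zero => exact h
  | succ n ih => rw [Function.iterate_succ_apply']; exact ih.gauss

lemma IrrU.one_le_floor {x : ℝ} (h : IrrU x) : (1 : ℝ) ≤ (⌊1 / x⌋ : ℝ) := by
  have : (1 : ℤ) ≤ ⌊1 / x⌋ := by
    rw [Int.le_floor]
    push_cast
    rw [le_div_iff₀ h.2.1]
    linarith [h.2.2]
  exact_mod_cast this

lemma one_div_eq_add (x : ℝ) : 1 / x = ⌊1 / x⌋ + gauss x := by unfold gauss; ring

lemma orbProd_pos {x : ℝ} (h : IrrU x) (n : ℕ) : 0 < orbProd n x :=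
  Finset.prod_pos fun i _ => (h.iter i).2.1

lemma orbProd_succ (n : ℕ) (x : ℝ) : orbProd (n + 1) x = orbProd n x * gauss^[n] x :=
  Finset.prod_range_succ _ _

lemma orbProd_anti {x : ℝ} (h : IrrU x) : Antitone (fun n => orbProd n x) := by
  apply antitone_nat_of_succ_le
  intro n
  rw [orbProd_succ]
  exact mul_le_of_le_one_right (orbProd_pos h n).le (h.iter n).2.2.le

/-- agreement of the first `m` digits -/
def Agree (m : ℕ) (y x : ℝ) : Prop := ∀ i < m, cfDigit i y = cfDigit i x

lemma exists_q {x : ℝ} (hx : IrrU x) (m : ℕ) : ∃ q q' : ℝ, 0 ≤ q' ∧ q' ≤ q ∧ 0 < q ∧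
    ∀ y, IrrU y → Agree m y x → (orbProd m y)⁻¹ = q + gauss^[m] y * q' := by
  induction m with
  | zero => exact ⟨1, 0, le_rfl, zero_le_one, one_pos, fun y _ _ => by simp [orbProd]⟩
  | succ m ih =>
    obtain ⟨q, q', h0, h1, h2, h⟩ := ih
    have ha : (1 : ℝ) ≤ (cfDigit m x : ℝ) := (hx.iter m).one_le_floor
    refine ⟨cfDigit m x * q + q', q, h2.le, ?_, ?_, ?_⟩
    · nlinarith
    · nlinarith
    · intro y hy hag
      have := h y hy (fun i hi => hag i (by omega))
      rw [orbProd_succ, mul_inv, this, Function.iterate_succ_apply', ← hag m (by omega)]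
      have e := one_div_eq_add (gauss^[m] y)
      have hp := (hy.iter m).2.1
      unfold cfDigit
      rw [← one_div]
      have e2 : (gauss^[m] y) * (1 / gauss^[m] y) = 1 := by field_simp
      calc (q + gauss^[m] y * q') * (1 / gauss^[m] y)
          = q * (1 / gauss^[m] y) + q' * (gauss^[m] y * (1 / gauss^[m] y)) := by ring
        _ = q * (⌊1 / gauss^[m] y⌋ + gauss (gauss^[m] y)) + q' := by rw [e2, ← e]; ring
        _ = _ := by ring

lemma orbProd_le_two {x y : ℝ} (hx : IrrU x) (hy : IrrU y) {m : ℕ} (h : Agree m y x) :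
    orbProd m y ≤ 2 * orbProd m x := by
  obtain ⟨q, q', h0, h1, h2, hq⟩ := exists_q hx m
  have e1 := hq y hy h
  have e2 := hq x hx (fun _ _ => rfl)
  have a1 := (hx.iter m).2
  have a2 := (hy.iter m).2
  have p1 := orbProd_pos hx m
  have p2 := orbProd_pos hy m
  have : (orbProd m x)⁻¹ ≤ 2 * (orbProd m y)⁻¹ := by rw [e1, e2]; nlinarith
  have h3 := mul_le_mul_of_nonneg_left this (mul_pos p1 p2).le
  field_simp at h3
  linarith

lemma orbProd_le_two' {x y : ℝ} (hx : IrrU x) (hy : IrrU y) {m : ℕ} (h : Agree m y x) :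
    orbProd m x ≤ 2 * orbProd m y :=
  orbProd_le_two hy hx (fun i hi => (h i hi).symm)

lemma abs_sub_eq {x y : ℝ} (hx : IrrU x) (hy : IrrU y) {m : ℕ} (h : Agree m y x) :
    |x - y| = orbProd m x * orbProd m y * |gauss^[m] x - gauss^[m] y| := by
  induction m with
  | zero => simp [orbProd]
  | succ m ih =>
    rw [ih (fun i hi => h i (by omega)), orbProd_succ, orbProd_succ, Function.iterate_succ_apply',
      Function.iterate_succ_apply']
    have hd := h m (by omega)
    unfold cfDigit at hd
    set u := gauss^[m] x with hu
    set v := gauss^[m] y with hv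
    have u0 : 0 < u := (hx.iter m).2.1
    have v0 : 0 < v := (hy.iter m).2.1
    have : gauss u - gauss v = (v - u) / (u * v) := by
      unfold gauss
      rw [hd]
      field_simp
      ring
    rw [this, abs_div, abs_of_pos (mul_pos u0 v0), abs_sub_comm v u]
    field_simp

lemma far_of_digit_ne {u v : ℝ} (hu : IrrU u) (hv : IrrU v) (h : ⌊1 / v⌋ ≠ ⌊1 / u⌋) :
    u ^ 2 * gauss u * gauss (gauss u) / 4 ≤ |u - v| := by
  have g1 := hu.gauss
  have g2 := g1.gauss
  obtain ⟨-, u0, u1⟩ := hu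
  obtain ⟨-, v0, v1⟩ := hv
  have e := one_div_eq_add u
  have key : gauss u * gauss (gauss u) / 2 ≤ |1 / u - 1 / v| := by
    have c1 : gauss u * gauss (gauss u) / 2 ≤ gauss u := by nlinarith [g1.2.1, g2.2.1, g2.2.2]
    have c2 : gauss u * gauss (gauss u) / 2 ≤ 1 - gauss u := by
      have e2 := one_div_eq_add (gauss u)
      have hf := g1.one_le_floor
      have : 1 + gauss (gauss u) ≤ 1 / gauss u := by linarith
      rw [le_div_iff₀ g1.2.1] at this
      nlinarith [g1.2.1, g2.2.1, g2.2.2]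
    rcases lt_or_gt_of_ne h with h | h
    · have : 1 / v < ⌊1 / u⌋ := Int.floor_lt.mp h
      rw [abs_of_nonneg] <;> linarith [g1.2.1]
    · have : ((⌊1 / u⌋ : ℤ) : ℝ) + 1 ≤ 1 / v := by
        have := Int.le_floor.mp (show ⌊1 / u⌋ + 1 ≤ ⌊1 / v⌋ by omega)
        exact_mod_cast this
      rw [abs_of_nonpos] <;> linarith [g1.2.2]
  have hz : 0 < gauss u * gauss (gauss u) := mul_pos g1.2.1 g2.2.1
  have hz1 : gauss u * gauss (gauss u) < 1 := by nlinarith [g1.2.1, g1.2.2, g2.2.1, g2.2.2]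
  by_cases hvu : u / 2 ≤ v
  · have : |u - v| = u * v * |1 / u - 1 / v| := by
      have : u - v = u * v * (1 / v - 1 / u) := by field_simp
      rw [this, abs_mul, abs_of_pos (mul_pos u0 v0), abs_sub_comm]
    rw [this]
    calc u ^ 2 * gauss u * gauss (gauss u) / 4
        = (u * (u / 2)) * (gauss u * gauss (gauss u) / 2) := by ring
      _ ≤ (u * v) * |1 / u - 1 / v| := by gcongr
  · push Not at hvu
    have : u / 2 ≤ |u - v| := le_trans (by linarith) (le_abs_self _)
    refine le_trans ?_ this
    have : u ^ 2 * (gauss u * gauss (gauss u)) ≤ u * 1 * 1 := by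
      rw [sq, mul_assoc u u, mul_assoc u 1]
      gcongr
    nlinarith

lemma lower_agree {x y : ℝ} (hx : IrrU x) (hy : IrrU y) {k : ℕ}
    (h : |x - y| < orbProd (k + 2) x ^ 2 / 8) : Agree k y x := by
  intro i
  induction i using Nat.strong_induction_on with
  | _ i ih =>
    intro hi
    by_contra hne
    have hag : Agree i y x := fun j hj => ih j hj (by omega)
    have h1 := abs_sub_eq hx hy hag
    have h2 := far_of_digit_ne (hx.iter i) (hy.iter i) hne
    have h3 := orbProd_le_two' hx hy hag
    have h4 : orbProd (k + 2) x ≤ orbProd (i + 3) x := orbProd_anti hx (by omega)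
    have p4 := orbProd_pos hx (k + 2)
    have p1 := orbProd_pos hx i
    have p2 := orbProd_pos hy i
    have e : orbProd (i + 3) x = orbProd i x * gauss^[i] x * gauss (gauss^[i] x) *
        gauss (gauss (gauss^[i] x)) := by
      rw [orbProd_succ, orbProd_succ, orbProd_succ, Function.iterate_succ_apply',
        Function.iterate_succ_apply', Function.iterate_succ_apply']
    have i0 := hx.iter i
    have i1 := i0.gauss
    have i2 := i1.gauss
    set u := gauss^[i] x
    set a := gauss u
    set b := gauss a
    have hab : 0 < a * b := mul_pos i1.2.1 i2.2.1
    have hab1 : a * b ≤ 1 := by nlinarith [i1.2.1, i1.2.2, i2.2.1, i2.2.2]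
    have : orbProd (k + 2) x ^ 2 ≤ orbProd i x ^ 2 * u ^ 2 * (a * b) := by
      calc orbProd (k + 2) x ^ 2 ≤ orbProd (i + 3) x ^ 2 := by gcongr
        _ = orbProd i x ^ 2 * u ^ 2 * ((a * b) * (a * b)) := by rw [e]; ring
        _ ≤ orbProd i x ^ 2 * u ^ 2 * ((a * b) * 1) := by gcongr
        _ = _ := by ring
    have : orbProd i x * (orbProd i x / 2) * (u ^ 2 * a * b / 4) ≤ |x - y| := by
      have hc : 0 ≤ u ^ 2 * a * b / 4 := by
        have := mul_nonneg (sq_nonneg u) hab.le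
        linarith
      rw [h1]
      apply mul_le_mul _ h2 hc (mul_pos p1 p2).le
      gcongr
      linarith
    nlinarith

lemma upper_agree {x y : ℝ} (hx : IrrU x) (hy : IrrU y) {m : ℕ} (h : Agree m y x) :
    |x - y| ≤ 2 * orbProd m x ^ 2 := by
  rw [abs_sub_eq hx hy h]
  have h3 := orbProd_le_two hx hy h
  have p1 := orbProd_pos hx m
  have p2 := orbProd_pos hy m
  have a1 := (hx.iter m).2
  have a2 := (hy.iter m).2
  have : |gauss^[m] x - gauss^[m] y| ≤ 1 := by rw [abs_le]; constructor <;> linarith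
  calc orbProd m x * orbProd m y * |gauss^[m] x - gauss^[m] y|
      ≤ orbProd m x * (2 * orbProd m x) * 1 := by gcongr
    _ = _ := by ring

lemma cyl_sub {g n : ℕ} (hg : 2 ≤ g) {x y : ℝ} (hx : IrrU x) (hy : y ∈ radixCyl g n x)
    (hi : Irrational y) : IrrU y ∧ |x - y| < 1 / (g : ℝ) ^ n := by
  have hgn : (0 : ℝ) < (g : ℝ) ^ n := by positivity
  obtain ⟨h1, h2⟩ := hy
  have f0 : (0 : ℤ) ≤ ⌊(g : ℝ) ^ n * x⌋ := Int.floor_nonneg.mpr (mul_pos hgn hx.2.1).le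
  have f1 : ⌊(g : ℝ) ^ n * x⌋ < (g : ℤ) ^ n := by
    rw [Int.floor_lt]; push_cast
    nlinarith [hx.2.2]
  have f0' : (0 : ℝ) ≤ (⌊(g : ℝ) ^ n * x⌋ : ℝ) := by exact_mod_cast f0
  have f1' : (⌊(g : ℝ) ^ n * x⌋ : ℝ) + 1 ≤ (g : ℝ) ^ n := by exact_mod_cast f1
  have l1 := Int.floor_le ((g : ℝ) ^ n * x)
  have l2 := Int.lt_floor_add_one ((g : ℝ) ^ n * x)
  rw [div_le_iff₀ hgn] at h1
  rw [lt_div_iff₀ hgn] at h2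
  refine ⟨⟨hi, ?_, ?_⟩, ?_⟩
  · have : 0 ≤ y := by
      by_contra hc
      push Not at hc
      nlinarith
    exact lt_of_le_of_ne this (fun h => hi.ne_zero h.symm)
  · by_contra hc
    push Not at hc
    nlinarith
  · rw [lt_div_iff₀ hgn, ← abs_of_pos hgn, ← abs_mul, abs_lt]
    constructor <;> nlinarith

lemma exists_far {g n : ℕ} (hg : 2 ≤ g) {x : ℝ} :
    ∃ y ∈ radixCyl g n x, Irrational y ∧ 1 / (4 * (g : ℝ) ^ n) ≤ |x - y| := by
  have hgn : (0 : ℝ) < (g : ℝ) ^ n := by positivity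
  unfold radixCyl
  set a : ℝ := (⌊(g : ℝ) ^ n * x⌋ : ℝ) / (g : ℝ) ^ n with ha
  set l : ℝ := 1 / (4 * (g : ℝ) ^ n) with hl
  have hl0 : 0 < l := by positivity
  have hb : ((⌊(g : ℝ) ^ n * x⌋ : ℝ) + 1) / (g : ℝ) ^ n = a + 4 * l := by
    rw [ha, hl]; field_simp
  rw [hb]
  by_cases hx : x ≤ a + 2 * l
  · obtain ⟨y, hy, h1, h2⟩ := exists_irrational_btwn (show a + 3 * l < a + 4 * l by linarith)
    refine ⟨y, ⟨by linarith, h2⟩, hy, ?_⟩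
    rw [abs_sub_comm]
    exact le_trans (by linarith) (le_abs_self _)
  · obtain ⟨y, hy, h1, h2⟩ := exists_irrational_btwn (show a < a + l by linarith)
    refine ⟨y, ⟨h1.le, by linarith⟩, hy, ?_⟩
    exact le_trans (by linarith) (le_abs_self _)

lemma lochs_det (g : ℕ) (hg : 2 ≤ g) {x L : ℝ} (hx : IrrU x) (hL : 0 < L)
    (hlim : Tendsto (fun n : ℕ => -Real.log (orbProd n x) / n) atTop (nhds L)) :
    Tendsto (fun n : ℕ => (mRadixCF g x n : ℝ) / n) atTop (nhds (Real.log g / (2 * L))) := by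
  set S : ℕ → ℝ := fun n => -Real.log (orbProd n x) with hS
  have hlg : 0 < Real.log g := Real.log_pos (by exact_mod_cast hg)
  have hgn : ∀ n : ℕ, (0 : ℝ) < (g : ℝ) ^ n := fun n => by positivity
  let M : ℕ → Set ℕ := fun n =>
    {m : ℕ | ∀ y ∈ radixCyl g n x, Irrational y → ∀ i < m, cfDigit i y = cfDigit i x}
  -- upper bound
  have hU : ∀ n, ∀ m ∈ M n, 2 * S m ≤ n * Real.log g + Real.log 8 := by
    intro n m hm
    obtain ⟨y, hy, hyi, hd⟩ := exists_far (n := n) hg (x := x)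
    have h1 := upper_agree hx (cyl_sub hg hx hy hyi).1 (m := m) (hm y hy hyi)
    have h2 : 1 / (4 * (g : ℝ) ^ n) ≤ 2 * orbProd m x ^ 2 := hd.trans h1
    have p := orbProd_pos hx m
    have h3 : 1 ≤ 8 * (g : ℝ) ^ n * orbProd m x ^ 2 := by
      rw [div_le_iff₀ (by positivity)] at h2
      linarith
    have h4 := Real.log_nonneg h3
    rw [Real.log_mul (by positivity) (by positivity), Real.log_mul (by positivity) (by positivity),
      Real.log_pow, Real.log_pow] at h4
    simp only [hS]
    push_cast at h4
    linarith
  have hLow : ∀ n k, k ∉ M n → n * Real.log g ≤ 2 * S (k + 2) + Real.log 8 := by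
    intro n k hk
    by_contra hc
    push Not at hc
    apply hk
    intro y hy hyi
    obtain ⟨h1, h2⟩ := cyl_sub hg hx hy hyi
    apply lower_agree hx h1
    refine lt_of_lt_of_le h2 ?_
    have p := orbProd_pos hx (k + 2)
    rw [← Real.log_le_log_iff (by have := hgn n; positivity) (by positivity),
      Real.log_div one_ne_zero (hgn n).ne', Real.log_div (by positivity) (by norm_num),
      Real.log_pow, Real.log_pow, Real.log_one]
    simp only [hS] at hc
    push_cast
    linarith
  have hStop : Tendsto S atTop atTop := by
    have : Tendsto (fun n : ℕ => (S n / n) * n) atTop atTop :=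
      hlim.pos_mul_atTop hL tendsto_natCast_atTop_atTop
    refine this.congr' ?_
    filter_upwards [eventually_ge_atTop 1] with n hn
    have : (n : ℝ) ≠ 0 := by positivity
    field_simp
  have hbdd : ∀ n, BddAbove (M n) := by
    intro n
    obtain ⟨N, hN⟩ := (eventually_atTop.mp (hStop.eventually_gt_atTop
      ((n * Real.log g + Real.log 8) / 2)))
    refine ⟨N, fun m hm => ?_⟩
    by_contra hc
    push Not at hc
    have := hN m hc.le
    have := hU n m hm
    linarith
  set μ : ℕ → ℕ := fun n => mRadixCF g x n with hμ
  have hmem : ∀ n, μ n ∈ M n := fun n => Nat.sSup_mem ⟨0, fun y _ _ i hi => by omega⟩ (hbdd n)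
  have hnot : ∀ n, μ n + 1 ∉ M n := fun n h => by
    have := le_csSup (hbdd n) h
    have e : μ n = sSup (M n) := rfl
    omega
  have hA : ∀ n, 2 * S (μ n) ≤ n * Real.log g + Real.log 8 := fun n => hU n _ (hmem n)
  have hB : ∀ n, n * Real.log g ≤ 2 * S (μ n + 3) + Real.log 8 := fun n => hLow n _ (hnot n)
  have hSmono : Monotone S := by
    intro a b hab
    simp only [hS]
    have := Real.log_le_log (orbProd_pos hx b) (orbProd_anti hx hab)
    linarith
  have hμtop : Tendsto μ atTop atTop := by
    rw [tendsto_atTop]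
    intro b
    have : Tendsto (fun n : ℕ => (n : ℝ) * Real.log g) atTop atTop :=
      tendsto_natCast_atTop_atTop.atTop_mul_const hlg
    filter_upwards [this.eventually_gt_atTop (2 * S (b + 3) + Real.log 8)] with n hn
    by_contra hc
    push Not at hc
    have := hB n
    have := hSmono (show μ n + 3 ≤ b + 3 by omega)
    linarith
  have inv0 : Tendsto (fun m : ℕ => Real.log 8 / (m : ℝ)) atTop (nhds 0) :=
    tendsto_const_div_atTop_nhds_zero_nat _
  have l1 : Tendsto (fun m : ℕ => (2 * S m - Real.log 8) / m) atTop (nhds (2 * L)) := by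
    have := (hlim.const_mul 2).sub inv0
    rw [sub_zero] at this
    refine this.congr fun m => ?_
    simp only [hS]; ring
  have l2 : Tendsto (fun m : ℕ => (2 * S (m + 3) + Real.log 8) / m) atTop (nhds (2 * L)) := by
    have h3 : Tendsto (fun m : ℕ => ((m + 3 : ℕ) : ℝ) / m) atTop (nhds 1) := by
      have : Tendsto (fun m : ℕ => 1 + (3 : ℝ) / m) atTop (nhds (1 + 0)) :=
        tendsto_const_nhds.add (tendsto_const_div_atTop_nhds_zero_nat _)
      rw [add_zero] at this
      refine this.congr' ?_
      filter_upwards [eventually_ge_atTop 1] with n hn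
      have : (n : ℝ) ≠ 0 := by positivity
      push_cast
      field_simp
    have h4 := hlim.comp (tendsto_add_atTop_nat 3)
    have := (((h4.mul h3).const_mul 2).add inv0)
    rw [mul_one, add_zero] at this
    refine this.congr' ?_
    filter_upwards [eventually_ge_atTop 1] with n hn
    have : (n : ℝ) ≠ 0 := by positivity
    have : ((n + 3 : ℕ) : ℝ) ≠ 0 := by positivity
    simp only [Function.comp, hS]
    field_simp
  have l3 : Tendsto (fun n : ℕ => (n * Real.log g) / (μ n : ℝ)) atTop (nhds (2 * L)) := by
    refine tendsto_of_tendsto_of_tendsto_of_le_of_le (l1.comp hμtop) (l2.comp hμtop) ?_ ?_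
    · intro n
      simp only [Function.comp]
      gcongr
      linarith [hA n]
    · intro n
      simp only [Function.comp]
      gcongr
      exact hB n
  have l4 := (l3.inv₀ (by positivity)).const_mul (Real.log g)
  rw [← div_eq_mul_inv] at l4
  refine l4.congr fun n => ?_
  simp only [hμ]
  rw [inv_div]
  field_simp

/-- transition weights of the Gauss transfer operator -/
noncomputable def wt (k : ℕ) (t : ℝ) : ℝ := (1 + t) / ((k + 1 + t) * (k + 2 + t))

/-- inverse branches -/
noncomputable def br (k : ℕ) (t : ℝ) : ℝ := 1 / (k + 1 + t)

/-- transfer operator -/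
noncomputable def tr (h : ℝ → ℝ) (t : ℝ) : ℝ :=
  (∑' k : ℕ, ENNReal.ofReal (wt k t * h (br k t))).toReal

lemma wt_pos (k : ℕ) {t : ℝ} (ht : 0 ≤ t) : 0 < wt k t := by unfold wt; positivity

lemma br_mem (k : ℕ) {t : ℝ} (ht : t ∈ Icc (0 : ℝ) 1) : br k t ∈ Icc (0 : ℝ) 1 := by
  have := ht.1
  unfold br
  refine ⟨by positivity, ?_⟩
  rw [div_le_one (by positivity)]
  have : (0 : ℝ) ≤ k := by positivity
  linarith

lemma br_anti (k : ℕ) {t s : ℝ} (ht : 0 ≤ t) (hts : t ≤ s) : br k s ≤ br k t := by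
  unfold br; gcongr

lemma br_anti' {k l : ℕ} (hkl : k ≤ l) {t : ℝ} (ht : 0 ≤ t) : br l t ≤ br k t := by
  unfold br; gcongr

lemma hasSum_wt {t : ℝ} (ht : 0 ≤ t) : HasSum (fun k => wt k t) 1 := by
  rw [hasSum_iff_tendsto_nat_of_nonneg (fun k => (wt_pos k ht).le)]
  have h1 : ∀ n : ℕ, ∑ i ∈ Finset.range n, wt i t = 1 - (1 + t) / (n + 1 + t) := by
    intro n
    induction n with
    | zero =>
      have : (1 + t) ≠ 0 := by positivity
      simp [this]
    | succ n ih =>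
      rw [Finset.sum_range_succ, ih]
      unfold wt
      push_cast
      have : (n + 1 + t) ≠ 0 := by positivity
      have : (n + 2 + t) ≠ 0 := by positivity
      have : (n + 1 + 1 + t) ≠ 0 := by positivity
      field_simp
      ring
  simp_rw [h1]
  have : Tendsto (fun n : ℕ => (1 + t) / ((n : ℝ) + 1 + t)) atTop (nhds 0) := by
    apply Tendsto.const_div_atTop
    apply tendsto_atTop_add_const_right
    apply tendsto_atTop_add_const_right
    exact tendsto_natCast_atTop_atTop
  simpa using this.const_sub 1

/-- the transfer series converges on the unit interval, `h` is nonnegative -/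
structure Adm (h : ℝ → ℝ) : Prop where
  nn : ∀ t ∈ Icc (0 : ℝ) 1, 0 ≤ h t
  sm : ∀ t ∈ Icc (0 : ℝ) 1, Summable (fun k => wt k t * h (br k t))

lemma Adm.hasSum {h : ℝ → ℝ} (H : Adm h) {t : ℝ} (ht : t ∈ Icc (0 : ℝ) 1) :
    HasSum (fun k => wt k t * h (br k t)) (tr h t) := by
  have hn : ∀ k, 0 ≤ wt k t * h (br k t) := fun k =>
    mul_nonneg (wt_pos k ht.1).le (H.nn _ (br_mem k ht))
  unfold tr
  rw [← ENNReal.ofReal_tsum_of_nonneg hn (H.sm t ht), ENNReal.toReal_ofReal (tsum_nonneg hn)]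
  exact (H.sm t ht).hasSum

lemma wt_sign1 {s t : ℝ} (hs : s ∈ Icc (0 : ℝ) 1) (ht : t ∈ Icc (0 : ℝ) 1) (hst : s ≤ t) :
    wt 0 t ≤ wt 0 s := by
  unfold wt
  have := hs.1
  have := ht.1
  rw [div_le_div_iff₀ (by positivity) (by positivity)]
  push_cast
  have : 0 ≤ (1 + s) * (1 + t) * (t - s) := mul_nonneg (by positivity) (by linarith)
  nlinarith

lemma wt_sign2 {s t : ℝ} (hs : s ∈ Icc (0 : ℝ) 1) (ht : t ∈ Icc (0 : ℝ) 1) (hst : s ≤ t) (k : ℕ)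
    (hk : 2 ≤ k) : wt k s ≤ wt k t := by
  unfold wt
  have s0 := hs.1
  have t0 := ht.1
  have s1 := hs.2
  have t1 := ht.2
  have hk' : (2 : ℝ) ≤ k := by exact_mod_cast hk
  rw [div_le_div_iff₀ (by positivity) (by positivity)]
  have h1 : (1 + s) * (1 + t) ≤ 2 * 2 := by gcongr <;> linarith
  have h2 : (2 : ℝ) * 3 ≤ k * (k + 1) := by gcongr; linarith
  have : 0 ≤ (t - s) * (k * (k + 1) - (1 + s) * (1 + t)) :=
    mul_nonneg (by linarith) (by linarith)
  nlinarith

/-- stochastic domination -/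
lemma dom {s t : ℝ} (hs : s ∈ Icc (0 : ℝ) 1) (ht : t ∈ Icc (0 : ℝ) 1) (hst : s ≤ t) {c : ℕ → ℝ}
    {A B : ℝ} (h0 : c 0 ≤ c 1) (h2 : ∀ k, 2 ≤ k → c 1 ≤ c k)
    (hA : HasSum (fun k => wt k s * c k) A) (hB : HasSum (fun k => wt k t * c k) B) : A ≤ B := by
  have h := ((hB.sub hA).sub (((hasSum_wt ht.1).sub (hasSum_wt hs.1)).mul_left (c 1)))
  have := h.nonneg (fun k => ?_)
  · linarith
  · have e : wt k t * c k - wt k s * c k - c 1 * (wt k t - wt k s)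
      = (wt k t - wt k s) * (c k - c 1) := by ring
    rw [e]
    rcases Nat.lt_or_ge k 2 with hk | hk
    · interval_cases k
      · have := wt_sign1 hs ht hst
        exact mul_nonneg_of_nonpos_of_nonpos (by linarith) (by linarith)
      · simp
    · have := wt_sign2 hs ht hst k hk
      exact mul_nonneg (by linarith) (by linarith [h2 k hk])

lemma dom' {s t : ℝ} (hs : s ∈ Icc (0 : ℝ) 1) (ht : t ∈ Icc (0 : ℝ) 1) (hst : s ≤ t) {c : ℕ → ℝ}
    {A B : ℝ} (h0 : c 1 ≤ c 0) (h2 : ∀ k, 2 ≤ k → c k ≤ c 1)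
    (hA : HasSum (fun k => wt k s * c k) A) (hB : HasSum (fun k => wt k t * c k) B) : B ≤ A := by
  have := dom hs ht hst (c := fun k => - c k) (A := -A) (B := -B) (by linarith)
    (fun k hk => by linarith [h2 k hk]) (by simpa using hA.neg) (by simpa using hB.neg)
  linarith

lemma tr_mono {h : ℝ → ℝ} (H : Adm h) (hm : AntitoneOn h (Ioc 0 1)) :
    MonotoneOn (tr h) (Icc 0 1) := by
  intro s hs t ht hst
  have bp : ∀ k (u : ℝ), u ∈ Icc (0 : ℝ) 1 → br k u ∈ Ioc (0 : ℝ) 1 := fun k u hu =>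
    ⟨by unfold br; have := hu.1; positivity, (br_mem k hu).2⟩
  -- compare c k = h (br k s)  with h (br k t)
  have hA := H.hasSum hs
  have hB := H.hasSum ht
  have hsm : Summable (fun k => wt k t * h (br k s)) := by
    refine Summable.of_nonneg_of_le (fun k => mul_nonneg (wt_pos k ht.1).le (H.nn _ (br_mem k hs)))
      (fun k => ?_) hB.summable
    have := hm (bp k t ht) (bp k s hs) (br_anti k hs.1 hst)
    exact mul_le_mul_of_nonneg_left this (wt_pos k ht.1).le
  calc tr h s ≤ ∑' k, wt k t * h (br k s) := dom hs ht hst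
        (c := fun k => h (br k s))
        (hm (bp 1 s hs) (bp 0 s hs) (br_anti' (by norm_num) hs.1))
        (fun k hk => hm (bp k s hs) (bp 1 s hs) (br_anti' (by omega) hs.1)) hA hsm.hasSum
    _ ≤ tr h t := by
      refine hasSum_le (fun k => ?_) hsm.hasSum hB
      have := hm (bp k t ht) (bp k s hs) (br_anti k hs.1 hst)
      exact mul_le_mul_of_nonneg_left this (wt_pos k ht.1).le

lemma tr_anti {h : ℝ → ℝ} (H : Adm h) (hm : MonotoneOn h (Icc 0 1)) :
    AntitoneOn (tr h) (Icc 0 1) := by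
  intro s hs t ht hst
  have hA := H.hasSum hs
  have hB := H.hasSum ht
  have hsm : Summable (fun k => wt k s * h (br k t)) := by
    refine Summable.of_nonneg_of_le (fun k => mul_nonneg (wt_pos k hs.1).le (H.nn _ (br_mem k ht)))
      (fun k => ?_) hA.summable
    have := hm (br_mem k ht) (br_mem k hs) (br_anti k hs.1 hst)
    exact mul_le_mul_of_nonneg_left this (wt_pos k hs.1).le
  calc tr h t ≤ ∑' k, wt k s * h (br k t) := dom' hs ht hst
        (c := fun k => h (br k t))
        (hm (br_mem 1 ht) (br_mem 0 ht) (br_anti' (by norm_num) ht.1))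
        (fun k hk => hm (br_mem k ht) (br_mem 1 ht) (br_anti' (by omega) ht.1)) hsm.hasSum hB
    _ ≤ tr h s := by
      refine hasSum_le (fun k => ?_) hsm.hasSum hA
      have := hm (br_mem k ht) (br_mem k hs) (br_anti k hs.1 hst)
      exact mul_le_mul_of_nonneg_left this (wt_pos k hs.1).le

lemma tr_ends {h : ℝ → ℝ} (H : Adm h) : tr h 1 = 2 * tr h 0 - h 1 := by
  have h0 := H.hasSum (t := 0) (by simp)
  have h1 := H.hasSum (t := 1) (by simp)
  have h2 := ((hasSum_nat_add_iff' 1).mpr h0).mul_left 2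
  have : (fun k : ℕ => 2 * (wt (k + 1) 0 * h (br (k + 1) 0))) = fun k => wt k 1 * h (br k 1) := by
    funext k
    have e1 : br (k + 1) 0 = br k 1 := by unfold br; push_cast; ring_nf
    have e2 : 2 * wt (k + 1) 0 = wt k 1 := by
      unfold wt; push_cast
      field_simp
      ring
    rw [e1, ← e2]; ring
  rw [this] at h2
  have := h1.unique h2
  rw [this]
  simp [wt, br]
  ring

lemma tr_zero_bound {h : ℝ → ℝ} (H : Adm h) {a b : ℝ}
    (hab : ∀ t ∈ Icc (0 : ℝ) 1, a ≤ h t ∧ h t ≤ b) :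
    (h 1 + a) / 2 ≤ tr h 0 ∧ tr h 0 ≤ (h 1 + b) / 2 := by
  have h0 := H.hasSum (t := 0) (by simp)
  have h2 := ((hasSum_nat_add_iff' 1).mpr h0)
  have h3 := ((hasSum_nat_add_iff' 1).mpr (hasSum_wt le_rfl))
  simp [wt, br] at h2 h3
  have z : (0 : ℝ) ∈ Icc (0 : ℝ) 1 := by simp
  have hb1 : ∀ k : ℕ, ((k : ℝ) + 1 + 1)⁻¹ ∈ Icc (0 : ℝ) 1 := by
    intro k
    have := br_mem (k + 1) z
    simpa [br] using this
  constructor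
  · have := hasSum_le (fun k => ?_) (h3.mul_left a) h2
    · linarith
    · rw [mul_comm a]
      exact mul_le_mul_of_nonneg_left (hab _ (hb1 k)).1 (by positivity)
  · have := hasSum_le (fun k => ?_) h2 (h3.mul_left b)
    · linarith
    · rw [mul_comm b]
      exact mul_le_mul_of_nonneg_left (hab _ (hb1 k)).2 (by positivity)

/-- monotone functions with controlled oscillation -/
structure Good (h : ℝ → ℝ) (D : ℝ) : Prop where
  nn : ∀ t ∈ Icc (0 : ℝ) 1, 0 ≤ h t
  mono : MonotoneOn h (Icc 0 1) ∨ AntitoneOn h (Icc 0 1)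
  osc : ∀ s ∈ Icc (0 : ℝ) 1, ∀ t ∈ Icc (0 : ℝ) 1, h s - h t ≤ D

lemma Good.adm {h : ℝ → ℝ} {D : ℝ} (H : Good h D) : Adm h := by
  refine ⟨H.nn, fun t ht => ?_⟩
  refine Summable.of_nonneg_of_le (fun k => mul_nonneg (wt_pos k ht.1).le (H.nn _ (br_mem k ht)))
      (fun k => ?_) ((hasSum_wt ht.1).summable.mul_right (h 0 + D))
  have := H.osc _ (br_mem k ht) 0 (by simp)
  exact mul_le_mul_of_nonneg_left (by linarith) (wt_pos k ht.1).le

lemma tr_nonneg (h : ℝ → ℝ) (t : ℝ) : 0 ≤ tr h t := ENNReal.toReal_nonneg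

lemma Good.tr {h : ℝ → ℝ} {D : ℝ} (H : Good h D) : Good (tr h) (D / 2) := by
  have A := H.adm
  have z0 : (0 : ℝ) ∈ Icc (0 : ℝ) 1 := by simp
  have z1 : (1 : ℝ) ∈ Icc (0 : ℝ) 1 := by simp
  have e := tr_ends A
  have bd := tr_zero_bound A (a := h 1 - D) (b := h 1 + D) (fun t ht =>
    ⟨by linarith [H.osc 1 z1 t ht], by linarith [H.osc t ht 1 z1]⟩)
  refine ⟨fun t _ => tr_nonneg h t, ?_, ?_⟩
  · rcases H.mono with hm | hm
    · exact Or.inr (tr_anti A hm)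
    · exact Or.inl (tr_mono A (hm.mono Ioc_subset_Icc_self))
  · intro s hs t ht
    rcases H.mono with hm | hm
    · have := tr_anti A hm
      have b1 := this z0 hs hs.1
      have b2 := this ht z1 ht.2
      linarith
    · have := tr_mono A (hm.mono Ioc_subset_Icc_self)
      have b1 := this z0 ht ht.1
      have b2 := this hs z1 hs.2
      linarith

/-- start function -/
noncomputable def nlog (x : ℝ) : ℝ := -Real.log x

lemma nlog_nonneg {t : ℝ} (ht : t ∈ Icc (0 : ℝ) 1) : 0 ≤ nlog t := by
  unfold nlog; linarith [Real.log_nonpos ht.1 ht.2]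

lemma adm_nlog : Adm nlog := by
  refine ⟨fun t ht => nlog_nonneg ht, fun t ht => ?_⟩
  have hs : Summable (fun k : ℕ => 8 * (1 / ((k + 1 : ℕ) : ℝ) ^ (3 / 2 : ℝ))) := by
    apply Summable.mul_left
    exact (summable_nat_add_iff 1).mpr (Real.summable_one_div_nat_rpow.mpr (by norm_num))
  refine Summable.of_nonneg_of_le (fun k => mul_nonneg (wt_pos k ht.1).le
    (nlog_nonneg (br_mem k ht))) (fun k => ?_) hs
  have t0 := ht.1
  have t1 := ht.2
  unfold wt br nlog
  rw [one_div, Real.log_inv, neg_neg]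
  have hk : (0 : ℝ) < k + 1 := by positivity
  have h1 : Real.log (k + 1 + t) ≤ (k + 1 + t) ^ (1 / 2 : ℝ) / (1 / 2) :=
    Real.log_le_rpow_div (by positivity) (by norm_num)
  have h2 : ((k : ℝ) + 1 + t) ^ (1 / 2 : ℝ) ≤ (4 * (k + 1)) ^ (1 / 2 : ℝ) := by
    apply Real.rpow_le_rpow (by positivity) (by linarith) (by norm_num)
  have h3 : (4 * ((k : ℝ) + 1)) ^ (1 / 2 : ℝ) = 2 * (k + 1) ^ (1 / 2 : ℝ) := by
    rw [Real.mul_rpow (by norm_num) hk.le]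
    congr 1
    rw [show (4 : ℝ) = 2 ^ (2 : ℝ) by norm_num, ← Real.rpow_mul (by norm_num)]
    norm_num
  have h4 : Real.log (k + 1 + t) ≤ 4 * (k + 1) ^ (1 / 2 : ℝ) := by linarith
  have h5 : (1 + t) / (((k : ℝ) + 1 + t) * (k + 2 + t)) ≤ 2 / ((k + 1) * (k + 1)) := by
    apply div_le_div₀ (by norm_num) (by linarith) (by positivity)
    exact mul_le_mul (by linarith) (by linarith) hk.le (by positivity)
  calc (1 + t) / (((k : ℝ) + 1 + t) * (k + 2 + t)) * Real.log (k + 1 + t)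
      ≤ 2 / ((k + 1) * (k + 1)) * (4 * (k + 1) ^ (1 / 2 : ℝ)) := by
        apply mul_le_mul h5 h4 (Real.log_nonneg (by linarith [show (0 : ℝ) ≤ k by positivity]))
        positivity
    _ = 8 * (1 / ((k + 1 : ℕ) : ℝ) ^ (3 / 2 : ℝ)) := by
        push_cast
        have : ((k : ℝ) + 1) * (k + 1) = (k + 1) ^ (1 / 2 : ℝ) * (k + 1) ^ (3 / 2 : ℝ) := by
          rw [← Real.rpow_add hk, ← sq, ← Real.rpow_natCast]
          norm_num
        rw [this]
        have a1 : (0 : ℝ) < ((k : ℝ) + 1) ^ (1 / 2 : ℝ) := by positivity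
        have a2 : (0 : ℝ) < ((k : ℝ) + 1) ^ (3 / 2 : ℝ) := by positivity
        field_simp
        norm_num

lemma nlog_anti : AntitoneOn nlog (Ioc 0 1) := by
  intro a ha b hb hab
  unfold nlog
  linarith [Real.log_le_log ha.1 hab]

lemma good_tr_nlog : Good (tr nlog) (tr nlog 1) := by
  refine ⟨fun t _ => tr_nonneg _ t, Or.inl (tr_mono adm_nlog nlog_anti), fun s hs t ht => ?_⟩
  have := tr_mono adm_nlog nlog_anti hs (show (1 : ℝ) ∈ Icc (0 : ℝ) 1 by simp) hs.2
  linarith [tr_nonneg nlog t]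

lemma good_iter (n : ℕ) : Good (tr^[n + 1] nlog) (tr nlog 1 / 2 ^ n) := by
  induction n with
  | zero => simpa using good_tr_nlog
  | succ n ih =>
    rw [Function.iterate_succ_apply']
    have := ih.tr
    rwa [div_div, ← pow_succ] at this

lemma adm_iter (n : ℕ) : Adm (tr^[n] nlog) := by
  cases n with
  | zero => exact adm_nlog
  | succ n => exact (good_iter n).adm

lemma measurable_tr {h : ℝ → ℝ} (hh : Measurable h) : Measurable (tr h) := by
  unfold tr wt br
  apply Measurable.ennreal_toReal
  apply Measurable.tsum
  intro k
  fun_prop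

lemma measurable_iter (n : ℕ) : Measurable (tr^[n] nlog) := by
  induction n with
  | zero => unfold nlog; exact Real.measurable_log.neg
  | succ n ih => rw [Function.iterate_succ_apply']; exact measurable_tr ih

lemma measurable_gauss : Measurable gauss := by
  unfold gauss
  have : Measurable fun x : ℝ => 1 / x := by fun_prop
  exact measurable_fract.comp this

/-- density of Gauss measure -/
noncomputable def rho (x : ℝ) : ℝ := 1 / (Real.log 2 * (1 + x))

/-- Gauss measure -/
noncomputable def gm : Measure ℝ :=
  (volume.restrict (Ioo 0 1)).withDensity (fun x => ENNReal.ofReal (rho x))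

lemma measurable_rho : Measurable (fun x => ENNReal.ofReal (rho x)) := by
  unfold rho; fun_prop

lemma lintegral_gm {F : ℝ → ENNReal} (hF : Measurable F) :
    ∫⁻ x, F x ∂gm = ∫⁻ x in Ioo 0 1, ENNReal.ofReal (rho x) * F x := by
  unfold gm
  rw [lintegral_withDensity_eq_lintegral_mul _ measurable_rho hF]
  rfl

lemma gauss_br (k : ℕ) {t : ℝ} (ht : t ∈ Ico (0 : ℝ) 1) : gauss (br k t) = t := by
  unfold gauss br
  rw [one_div_one_div]
  have : ⌊(k : ℝ) + 1 + t⌋ = k + 1 := by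
    rw [Int.floor_eq_iff]
    push_cast
    constructor <;> linarith [ht.1, ht.2]
  rw [this]; push_cast; ring

lemma br_image (k : ℕ) : br k '' Ico (0 : ℝ) 1 = {x | x ∈ Ioc (0 : ℝ) 1 ∧ ⌊1 / x⌋ = k + 1} := by
  ext x
  constructor
  · rintro ⟨t, ht, rfl⟩
    have : ⌊1 / br k t⌋ = k + 1 := by
      unfold br
      rw [one_div_one_div, Int.floor_eq_iff]
      push_cast
      constructor <;> linarith [ht.1, ht.2]
    refine ⟨⟨?_, (br_mem k ⟨ht.1, ht.2.le⟩).2⟩, this⟩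
    unfold br; have := ht.1; positivity
  · rintro ⟨hx, hf⟩
    refine ⟨gauss x, ⟨Int.fract_nonneg _, Int.fract_lt_one _⟩, ?_⟩
    have := one_div_eq_add x
    rw [hf] at this
    unfold br
    push_cast at this
    rw [← this, one_div_one_div]

lemma iUnion_br : ⋃ k : ℕ, br k '' Ico (0 : ℝ) 1 = Ioc 0 1 := by
  ext x
  simp only [br_image, mem_iUnion, mem_ofPred_eq]
  constructor
  · rintro ⟨k, h, -⟩; exact h
  · intro h
    have : (1 : ℤ) ≤ ⌊1 / x⌋ := by
      rw [Int.le_floor]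
      push_cast
      rw [le_div_iff₀ h.1]
      linarith [h.2]
    refine ⟨(⌊1 / x⌋ - 1).toNat, h, ?_⟩
    omega

lemma lintegral_branches (F : ℝ → ENNReal) (hF : Measurable F) :
    ∫⁻ x in Ioo (0 : ℝ) 1, F x =
      ∫⁻ t in Ioo (0 : ℝ) 1, ∑' k : ℕ, ENNReal.ofReal (1 / (k + 1 + t) ^ 2) * F (br k t) := by
  have hm : ∀ k : ℕ, MeasurableSet (br k '' Ico (0 : ℝ) 1) := by
    intro k
    rw [br_image]
    have : Measurable fun x : ℝ => ⌊1 / x⌋ := by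
      have : Measurable fun x : ℝ => 1 / x := by fun_prop
      exact Int.measurable_floor.comp this
    exact measurableSet_Ioc.inter (this (measurableSet_singleton _))
  have hd : Pairwise (Function.onFun Disjoint fun k : ℕ => br k '' Ico (0 : ℝ) 1) := by
    intro k l hkl
    rw [Function.onFun, Set.disjoint_left]
    simp only [br_image]
    rintro x ⟨-, h1⟩ ⟨-, h2⟩
    apply hkl
    omega
  have hL : ∫⁻ x in Ioo (0 : ℝ) 1, F x = ∫⁻ x in ⋃ k : ℕ, br k '' Ico (0 : ℝ) 1, F x := by
    rw [iUnion_br, Measure.restrict_congr_set (Ioo_ae_eq_Ioc)]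
  rw [hL, lintegral_iUnion hm hd, Measure.restrict_congr_set (Ioo_ae_eq_Ico), lintegral_tsum]
  · congr 1
    funext k
    rw [lintegral_image_eq_lintegral_abs_deriv_mul measurableSet_Ico
      (f' := fun t => -1 / ((k : ℝ) + 1 + t) ^ 2)]
    · refine setLIntegral_congr_fun measurableSet_Ico fun t ht => ?_
      have : 0 ≤ 1 / ((k : ℝ) + 1 + t) ^ 2 := by positivity
      simp only [neg_div, abs_neg, abs_of_nonneg this]
    · intro t ht
      have h0 := ht.1
      have : HasDerivAt (fun t : ℝ => (k : ℝ) + 1 + t) 1 t := (hasDerivAt_id t).const_add _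
      have h2 := this.inv (by positivity)
      unfold br
      simp_rw [one_div]
      exact h2.hasDerivWithinAt
    · intro s hs t ht hst
      rw [← gauss_br k hs, ← gauss_br k ht, hst]
  · intro k
    apply Measurable.aemeasurable
    unfold br
    fun_prop

lemma duality {h : ℝ → ℝ} (hh : Measurable h) (H : Adm h) {φ : ℝ → ENNReal} (hφ : Measurable φ) :
    ∫⁻ x, ENNReal.ofReal (h x) * φ (gauss x) ∂gm = ∫⁻ x, ENNReal.ofReal (tr h x) * φ x ∂gm := by
  have hG := hφ.comp measurable_gauss
  have hF : Measurable fun x => ENNReal.ofReal (h x) * φ (gauss x) := by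
    exact hh.ennreal_ofReal.mul hG
  have hF2 : Measurable fun x => ENNReal.ofReal (tr h x) * φ x :=
    (measurable_tr hh).ennreal_ofReal.mul hφ
  rw [lintegral_gm hF, lintegral_gm hF2,
    lintegral_branches (fun x => ENNReal.ofReal (rho x) * (ENNReal.ofReal (h x) * φ (gauss x)))
      (measurable_rho.mul hF)]
  refine setLIntegral_congr_fun measurableSet_Ioo fun t ht => ?_
  have ht' : t ∈ Icc (0 : ℝ) 1 := ⟨ht.1.le, ht.2.le⟩
  have hn : ∀ k, 0 ≤ wt k t * h (br k t) := fun k =>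
    mul_nonneg (wt_pos k ht'.1).le (H.nn _ (br_mem k ht'))
  have e : ENNReal.ofReal (tr h t) = ∑' k : ℕ, ENNReal.ofReal (wt k t * h (br k t)) := by
    rw [← (H.hasSum ht').tsum_eq, ENNReal.ofReal_tsum_of_nonneg hn (H.sm t ht')]
  rw [e, ← mul_assoc, ← ENNReal.tsum_mul_left, ← ENNReal.tsum_mul_right]
  congr 1
  funext k
  rw [gauss_br k ⟨ht.1.le, ht.2⟩, ← mul_assoc, ← mul_assoc]
  congr 1
  have hl : 0 < Real.log 2 := Real.log_pos (by norm_num)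
  have t0 := ht.1
  have hb : 0 ≤ br k t := (br_mem k ht').1
  have r1 : 0 ≤ rho (br k t) := by unfold rho; positivity
  have r2 : 0 ≤ rho t := by unfold rho; positivity
  rw [← ENNReal.ofReal_mul (by positivity), ← ENNReal.ofReal_mul (by positivity),
    ← ENNReal.ofReal_mul r2, ← mul_assoc]
  congr 2
  unfold rho wt br
  field_simp
  ring

lemma adm_one : Adm (fun _ => 1) := by
  have : Good (fun _ => 1) 0 := ⟨fun _ _ => zero_le_one, Or.inl monotoneOn_const, by simp⟩
  exact this.adm

lemma tr_one {t : ℝ} (ht : t ∈ Icc (0 : ℝ) 1) : tr (fun _ => 1) t = 1 := by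
  have := adm_one.hasSum ht
  simp only [mul_one] at this
  exact this.unique (hasSum_wt ht.1)

lemma ae_gm : ∀ᵐ x ∂gm, x ∈ Ioo (0 : ℝ) 1 := by
  have : ∀ᵐ x ∂(volume.restrict (Ioo (0 : ℝ) 1)), x ∈ Ioo (0 : ℝ) 1 :=
    ae_restrict_mem measurableSet_Ioo
  exact (withDensity_absolutelyContinuous _ _).ae_le this

lemma mp_gauss : MeasurePreserving gauss gm gm := by
  refine ⟨measurable_gauss, ?_⟩
  ext s hs
  rw [Measure.map_apply measurable_gauss hs, ← lintegral_indicator_one hs,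
    ← lintegral_indicator_one (measurable_gauss hs)]
  have := duality measurable_const adm_one (φ := s.indicator 1) (measurable_one.indicator hs)
  simp only [ENNReal.ofReal_one, one_mul] at this
  rw [show (∫⁻ a, (gauss ⁻¹' s).indicator 1 a ∂gm) = ∫⁻ x, s.indicator (1 : ℝ → ENNReal) (gauss x) ∂gm from rfl, this]
  refine lintegral_congr_ae ?_
  filter_upwards [ae_gm] with x hx
  rw [tr_one ⟨hx.1.le, hx.2.le⟩]
  simp

lemma log2_pos : 0 < Real.log 2 := Real.log_pos (by norm_num)

lemma int_pow_nlog (m : ℕ) : IntervalIntegrable (fun x => x ^ m * nlog x) volume 0 1 ∧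
    ∫ x in (0 : ℝ)..1, x ^ m * nlog x = 1 / ((m : ℝ) + 1) ^ 2 := by
  have hi : IntervalIntegrable (fun x => x ^ m * nlog x) volume 0 1 := by
    have : IntervalIntegrable nlog volume 0 1 := intervalIntegral.intervalIntegrable_log'.neg
    exact this.continuousOn_mul (by fun_prop)
  refine ⟨hi, ?_⟩
  have hc : Continuous fun x : ℝ => x ^ (m + 1) / ((m : ℝ) + 1) ^ 2 -
      x ^ m * (x * Real.log x) / ((m : ℝ) + 1) := by
    have := Real.continuous_mul_log
    fun_prop
  rw [intervalIntegral.integral_eq_sub_of_hasDerivAt_of_le zero_le_one hc.continuousOn _ hi]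
  · simp
  · intro x hx
    have hx0 : x ≠ 0 := hx.1.ne'
    have h1 := (hasDerivAt_pow (m + 1) x).div_const (((m : ℝ) + 1) ^ 2)
    have h2 := (((hasDerivAt_pow (m + 1) x).mul (Real.hasDerivAt_log hx0)).div_const ((m : ℝ) + 1))
    have h3 := h1.sub h2
    have hm : (m : ℝ) + 1 ≠ 0 := by positivity
    refine (h3.congr_deriv ?_).congr_of_eventuallyEq ?_
    · unfold nlog
      simp only [Nat.add_sub_cancel]
      push_cast
      field_simp
      ring
    · filter_upwards with y
      simp only [Pi.sub_apply, Pi.mul_apply]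
      ring

lemma lint_term (n : ℕ) : ∫⁻ x in Ioo (0 : ℝ) 1, ENNReal.ofReal (x ^ (2 * n) * (1 - x) * nlog x) =
    ENNReal.ofReal (1 / (2 * (n : ℝ) + 1) ^ 2 - 1 / (2 * (n : ℝ) + 2) ^ 2) := by
  obtain ⟨i1, e1⟩ := int_pow_nlog (2 * n)
  obtain ⟨i2, e2⟩ := int_pow_nlog (2 * n + 1)
  have e : (fun x : ℝ => x ^ (2 * n) * (1 - x) * nlog x) =
      fun x => x ^ (2 * n) * nlog x - x ^ (2 * n + 1) * nlog x := by
    funext x; ring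
  have hi : IntegrableOn (fun x : ℝ => x ^ (2 * n) * (1 - x) * nlog x) (Ioo 0 1) := by
    rw [e]
    exact ((i1.sub i2).1).mono_set Ioo_subset_Ioc_self
  rw [← ofReal_integral_eq_lintegral_ofReal hi]
  · congr 1
    rw [← integral_Ioc_eq_integral_Ioo, ← intervalIntegral.integral_of_le zero_le_one, e,
      intervalIntegral.integral_sub i1 i2, e1, e2]
    push_cast
    ring
  · filter_upwards [ae_restrict_mem measurableSet_Ioo] with x hx
    have := nlog_nonneg ⟨hx.1.le, hx.2.le⟩
    have h1 : 0 ≤ x := hx.1.le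
    have h2 : 0 ≤ 1 - x := by linarith [hx.2]
    simp only [Pi.zero_apply]
    positivity

lemma hasSum_terms : HasSum (fun n : ℕ => 1 / (2 * (n : ℝ) + 1) ^ 2 - 1 / (2 * (n : ℝ) + 2) ^ 2)
    (Real.pi ^ 2 / 12) := by
  have hz := hasSum_zeta_two
  have hz1 : HasSum (fun n : ℕ => 1 / ((n : ℝ) + 1) ^ 2) (Real.pi ^ 2 / 6) := by
    have := (hasSum_nat_add_iff' 1).mpr hz
    simpa using this
  have hev : HasSum (fun n : ℕ => 1 / (2 * (n : ℝ) + 2) ^ 2) (Real.pi ^ 2 / 24) := by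
    have := hz1.mul_left (1 / 4)
    convert! this using 1
    · funext n
      rw [show 2 * (n : ℝ) + 2 = 2 * (n + 1) by ring, mul_pow]
      field_simp
      norm_num
    · ring
  have hsm : Summable (fun n : ℕ => 1 / (2 * (n : ℝ) + 1) ^ 2) := by
    have := hz1.summable.comp_injective (i := fun n : ℕ => 2 * n)
      (fun a b h => by simpa using h)
    refine this.congr fun n => ?_
    simp
  have hodd : HasSum (fun n : ℕ => 1 / (2 * (n : ℝ) + 1) ^ 2) (Real.pi ^ 2 / 8) := by
    have h1 := HasSum.even_add_odd (f := fun n : ℕ => 1 / ((n : ℝ) + 1) ^ 2)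
      (m := ∑' n : ℕ, 1 / (2 * (n : ℝ) + 1) ^ 2) (m' := Real.pi ^ 2 / 24)
      (by convert! hsm.hasSum using 3; push_cast; ring)
      (by convert! hev using 3; push_cast; ring)
    have h2 := h1.unique hz1
    have : ∑' n : ℕ, 1 / (2 * (n : ℝ) + 1) ^ 2 = Real.pi ^ 2 / 8 := by linarith
    rw [← this]
    exact hsm.hasSum
  have := hodd.sub hev
  convert! this using 1
  ring

lemma terms_nonneg (n : ℕ) :
    0 ≤ 1 / (2 * (n : ℝ) + 1) ^ 2 - 1 / (2 * (n : ℝ) + 2) ^ 2 := by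
  rw [sub_nonneg]
  gcongr
  norm_num

/-- Levy constant -/
noncomputable def lev : ℝ := Real.pi ^ 2 / (12 * Real.log 2)

lemma measurable_nlog : Measurable nlog := measurable_iter 0

lemma lintegral_nlog : ∫⁻ x, ENNReal.ofReal (nlog x) ∂gm = ENNReal.ofReal lev := by
  rw [lintegral_gm measurable_nlog.ennreal_ofReal]
  have h1 : ∫⁻ x in Ioo (0 : ℝ) 1, ENNReal.ofReal (rho x) * ENNReal.ofReal (nlog x) =
      ∫⁻ x in Ioo (0 : ℝ) 1, ENNReal.ofReal (1 / Real.log 2) *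
        ∑' n : ℕ, ENNReal.ofReal (x ^ (2 * n) * (1 - x) * nlog x) := by
    refine setLIntegral_congr_fun measurableSet_Ioo fun x hx => ?_
    have x0 := hx.1
    have x1 := hx.2
    have hn := nlog_nonneg ⟨hx.1.le, hx.2.le⟩
    have hl := log2_pos
    have h2 : 0 ≤ 1 - x := by linarith
    have hg := hasSum_geometric_of_lt_one (r := x ^ 2) (by positivity) (by nlinarith)
    have hs := hg.mul_right ((1 - x) * nlog x)
    have hs' : HasSum (fun n : ℕ => x ^ (2 * n) * (1 - x) * nlog x)
        ((1 - x ^ 2)⁻¹ * ((1 - x) * nlog x)) := by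
      convert! hs using 1
      funext n
      rw [pow_mul]; ring
    rw [← ENNReal.ofReal_tsum_of_nonneg (fun n => by positivity) hs'.summable, hs'.tsum_eq,
      ← ENNReal.ofReal_mul (by unfold rho; positivity), ← ENNReal.ofReal_mul (by positivity)]
    congr 1
    unfold rho
    have : 1 - x ≠ 0 := by linarith
    have : 1 - x ^ 2 ≠ 0 := by nlinarith
    field_simp
    ring
  rw [h1, lintegral_const_mul, lintegral_tsum]
  · simp_rw [lint_term]
    rw [← ENNReal.ofReal_tsum_of_nonneg terms_nonneg hasSum_terms.summable, hasSum_terms.tsum_eq,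
      ← ENNReal.ofReal_mul (by have := log2_pos; positivity)]
    congr 1
    unfold lev
    have := log2_pos
    field_simp
  · intro n
    have := measurable_nlog
    fun_prop
  · have := measurable_nlog
    refine Measurable.tsum fun n => ?_
    fun_prop

instance prob_gm : IsProbabilityMeasure gm := by
  constructor
  rw [← lintegral_one, lintegral_gm (F := fun _ => 1) measurable_const]
  simp only [mul_one]
  have hl := log2_pos
  have hcont : ContinuousOn rho (Icc 0 1) := by
    unfold rho
    refine continuousOn_const.div (by fun_prop) (fun x hx => ?_)
    have := hx.1
    positivity
  have hi : IntegrableOn rho (Ioo 0 1) := (hcont.integrableOn_Icc).mono_set Ioo_subset_Icc_self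
  rw [← ofReal_integral_eq_lintegral_ofReal hi]
  · rw [← integral_Ioc_eq_integral_Ioo, ← intervalIntegral.integral_of_le zero_le_one]
    have : ∫ x in (0 : ℝ)..1, rho x = 1 := by
      rw [intervalIntegral.integral_eq_sub_of_hasDerivAt (f := fun x => Real.log (1 + x) / Real.log 2)]
      · norm_num
      · intro x hx
        rw [uIcc_of_le zero_le_one] at hx
        have h0 := hx.1
        have h1 : HasDerivAt (fun x : ℝ => 1 + x) 1 x := (hasDerivAt_id x).const_add _
        refine ((h1.log (by positivity)).div_const (Real.log 2)).congr_deriv ?_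
        unfold rho
        field_simp
      · rw [intervalIntegrable_iff_integrableOn_Ioc_of_le zero_le_one]
        exact (hcont.integrableOn_Icc).mono_set Ioc_subset_Icc_self
    rw [this, ENNReal.ofReal_one]
  · filter_upwards [ae_restrict_mem measurableSet_Ioo] with x hx
    have := hx.1
    unfold rho
    simp only [Pi.zero_apply]
    positivity

lemma memLp_nlog : MemLp nlog 2 gm := by
  rw [memLp_two_iff_integrable_sq measurable_nlog.aestronglyMeasurable]
  have hmeas : Measurable fun x => nlog x ^ 2 := measurable_nlog.pow_const 2
  refine ⟨hmeas.aestronglyMeasurable, ?_⟩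
  rw [hasFiniteIntegral_iff_ofReal (ae_of_all _ fun x => sq_nonneg _),
    lintegral_gm hmeas.ennreal_ofReal]
  have hl := log2_pos
  have hi : IntegrableOn (fun x : ℝ => 16 / Real.log 2 * x ^ (-(1 / 2) : ℝ)) (Ioo 0 1) := by
    have : IntervalIntegrable (fun x : ℝ => x ^ (-(1 / 2) : ℝ)) volume 0 1 :=
      intervalIntegral.intervalIntegrable_rpow' (by norm_num)
    exact (this.1.mono_set Ioo_subset_Ioc_self).const_mul _
  refine lt_of_le_of_lt ?_ hi.lintegral_lt_top
  refine setLIntegral_mono' measurableSet_Ioo fun x hx => ?_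
  have x0 := hx.1
  rw [← ENNReal.ofReal_mul (by unfold rho; positivity)]
  apply ENNReal.ofReal_le_ofReal
  have h1 := Real.abs_log_mul_self_rpow_lt x (1 / 4) x0 hx.2.le (by norm_num)
  have h2 : nlog x ^ 2 ≤ 16 * x ^ (-(1 / 2) : ℝ) := by
    have h3 : (Real.log x * x ^ (1 / 4 : ℝ)) ^ 2 ≤ 16 := by
      rw [← sq_abs]
      have := abs_nonneg (Real.log x * x ^ (1 / 4 : ℝ))
      nlinarith
    have h4 : (x ^ (1 / 4 : ℝ)) ^ 2 * x ^ (-(1 / 2) : ℝ) = 1 := by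
      rw [← Real.rpow_natCast, ← Real.rpow_mul x0.le, ← Real.rpow_add x0]
      norm_num
    have h5 : (0 : ℝ) < x ^ (-(1 / 2) : ℝ) := by positivity
    calc nlog x ^ 2 = (Real.log x) ^ 2 * ((x ^ (1 / 4 : ℝ)) ^ 2 * x ^ (-(1 / 2) : ℝ)) := by
          rw [h4]; unfold nlog; ring
      _ = (Real.log x * x ^ (1 / 4 : ℝ)) ^ 2 * x ^ (-(1 / 2) : ℝ) := by ring
      _ ≤ _ := by gcongr
  have h6 : rho x ≤ 1 / Real.log 2 := by
    unfold rho
    gcongr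
    nlinarith
  calc rho x * nlog x ^ 2 ≤ 1 / Real.log 2 * (16 * x ^ (-(1 / 2) : ℝ)) := by gcongr
    _ = _ := by ring

lemma lev_pos : 0 < lev := by
  unfold lev
  have := log2_pos
  have := Real.pi_pos
  positivity

lemma duality_iter (n : ℕ) {φ : ℝ → ENNReal} (hφ : Measurable φ) :
    ∫⁻ x, ENNReal.ofReal (nlog x) * φ (gauss^[n] x) ∂gm =
      ∫⁻ x, ENNReal.ofReal (tr^[n] nlog x) * φ x ∂gm := by
  induction n generalizing φ with
  | zero => rfl
  | succ n ih =>
    have h1 := ih (hφ.comp measurable_gauss)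
    have h2 := duality (measurable_iter n) (adm_iter n) hφ
    simp_rw [Function.iterate_succ_apply']
    simp only [Function.comp] at h1
    rw [h1, h2]

lemma iter_le (n : ℕ) {t : ℝ} (ht : t ∈ Icc (0 : ℝ) 1) :
    tr^[n + 1] nlog t ≤ lev + tr nlog 1 / 2 ^ n := by
  by_contra hc
  push Not at hc
  set c := tr^[n + 1] nlog t - tr nlog 1 / 2 ^ n with hcdef
  have hc' : lev < c := by rw [hcdef]; linarith
  have h1 := duality_iter (n + 1) (φ := fun _ => 1) measurable_const
  simp only [mul_one] at h1
  rw [lintegral_nlog] at h1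
  have h2 : ENNReal.ofReal c ≤ ∫⁻ x, ENNReal.ofReal (tr^[n + 1] nlog x) ∂gm := by
    calc ENNReal.ofReal c = ∫⁻ x, ENNReal.ofReal c ∂gm := by simp
      _ ≤ _ := by
        refine lintegral_mono_ae ?_
        filter_upwards [ae_gm] with x hx
        apply ENNReal.ofReal_le_ofReal
        have := (good_iter n).osc t ht x ⟨hx.1.le, hx.2.le⟩
        rw [hcdef]; linarith
  rw [← h1, ENNReal.ofReal_le_ofReal_iff lev_pos.le] at h2
  linarith

lemma ae_nlog_nonneg : ∀ᵐ x ∂gm, 0 ≤ nlog x := by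
  filter_upwards [ae_gm] with x hx
  exact nlog_nonneg ⟨hx.1.le, hx.2.le⟩

lemma integrable_nlog : Integrable nlog gm := memLp_nlog.integrable (by norm_num)

lemma integral_nlog : ∫ x, nlog x ∂gm = lev := by
  rw [integral_eq_lintegral_of_nonneg_ae ae_nlog_nonneg measurable_nlog.aestronglyMeasurable,
    lintegral_nlog, ENNReal.toReal_ofReal lev_pos.le]

lemma mp_iter (n : ℕ) : MeasurePreserving (gauss^[n]) gm gm := mp_gauss.iterate n

lemma corr_aux {T h : ℝ → ℝ} {c : ℝ} (hc : 0 ≤ c) (hT : MeasurePreserving T gm gm)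
    (hd : ∀ φ : ℝ → ENNReal, Measurable φ → ∫⁻ x, ENNReal.ofReal (nlog x) * φ (T x) ∂gm =
      ∫⁻ x, ENNReal.ofReal (h x) * φ x ∂gm) (hle : ∀ t ∈ Icc (0 : ℝ) 1, h t ≤ c) :
    ∫ x, nlog x * nlog (T x) ∂gm ≤ lev * c := by
  have hm : Measurable fun x => nlog (T x) := measurable_nlog.comp hT.measurable
  have hm2 : Measurable fun x => nlog x * nlog (T x) := measurable_nlog.mul hm
  have hl := lev_pos
  have hn2 : ∀ᵐ x ∂gm, 0 ≤ nlog (T x) := hT.quasiMeasurePreserving.ae ae_nlog_nonneg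
  rw [integral_eq_lintegral_of_nonneg_ae _ hm2.aestronglyMeasurable]
  · apply ENNReal.toReal_le_of_le_ofReal (by positivity)
    have e : ∫⁻ x, ENNReal.ofReal (nlog x * nlog (T x)) ∂gm =
        ∫⁻ x, ENNReal.ofReal (nlog x) * ENNReal.ofReal (nlog (T x)) ∂gm := by
      refine lintegral_congr_ae ?_
      filter_upwards [ae_nlog_nonneg] with x hx
      exact ENNReal.ofReal_mul hx
    rw [e, hd (fun x => ENNReal.ofReal (nlog x)) measurable_nlog.ennreal_ofReal]
    calc _ ≤ ∫⁻ x, ENNReal.ofReal c * ENNReal.ofReal (nlog x) ∂gm := by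
          refine lintegral_mono_ae ?_
          filter_upwards [ae_gm] with x hx
          gcongr
          exact hle x ⟨hx.1.le, hx.2.le⟩
      _ = _ := by
        rw [lintegral_const_mul _ measurable_nlog.ennreal_ofReal, lintegral_nlog,
          ← ENNReal.ofReal_mul (by positivity), mul_comm]
  · filter_upwards [ae_nlog_nonneg, hn2] with x h1 h2
    exact mul_nonneg h1 h2

lemma corr_le (n : ℕ) : ∫ x, nlog x * nlog (gauss^[n + 1] x) ∂gm ≤
    lev * (lev + tr nlog 1 / 2 ^ n) := by
  have hD : 0 ≤ tr nlog 1 / 2 ^ n := div_nonneg (tr_nonneg _ _) (by positivity)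
  have hl := lev_pos
  exact corr_aux (by positivity) (mp_iter (n + 1)) (fun φ hφ => duality_iter (n + 1) hφ)
    (fun t ht => iter_le n ht)

/-- centred function -/
noncomputable def cen (x : ℝ) : ℝ := nlog x - lev

lemma memLp_cen : MemLp cen 2 gm := memLp_nlog.sub (memLp_const lev)

lemma memLp_cen_iter (n : ℕ) : MemLp (fun x => cen (gauss^[n] x)) 2 gm :=
  memLp_cen.comp_measurePreserving (mp_iter n)

lemma memLp_nlog_iter (n : ℕ) : MemLp (fun x => nlog (gauss^[n] x)) 2 gm :=
  memLp_nlog.comp_measurePreserving (mp_iter n)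

lemma integral_nlog_iter (n : ℕ) : ∫ x, nlog (gauss^[n] x) ∂gm = lev := by
  rw [← integral_nlog]
  have h := (mp_iter n).map_eq
  conv_rhs => rw [← h]
  rw [integral_map (mp_iter n).measurable.aemeasurable measurable_nlog.aestronglyMeasurable]

lemma cov_le (n : ℕ) : ∫ x, cen x * cen (gauss^[n + 1] x) ∂gm ≤ lev * tr nlog 1 * (1 / 2) ^ n := by
  have h1 := corr_le n
  have i1 : Integrable (fun x => nlog x * nlog (gauss^[n + 1] x)) gm :=
    memLp_nlog.integrable_mul (memLp_nlog_iter (n + 1))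
  have i2 : Integrable (fun x => nlog (gauss^[n + 1] x)) gm :=
    (memLp_nlog_iter (n + 1)).integrable (by norm_num)
  have e : ∫ x, cen x * cen (gauss^[n + 1] x) ∂gm =
      ∫ x, (nlog x * nlog (gauss^[n + 1] x) - lev * nlog x -
        (lev * nlog (gauss^[n + 1] x) - lev * lev)) ∂gm := by
    congr 1; funext x; unfold cen; ring
  have i3 : Integrable (fun x => nlog x * nlog (gauss^[n + 1] x) - lev * nlog x) gm :=
    i1.sub (integrable_nlog.const_mul _)
  have i4 : Integrable (fun x => lev * nlog (gauss^[n + 1] x) - lev * lev) gm :=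
    (i2.const_mul _).sub (integrable_const _)
  rw [e, integral_sub i3 i4, integral_sub i1 (integrable_nlog.const_mul _), integral_sub (i2.const_mul _) (integrable_const _),
    integral_const_mul, integral_const_mul, integral_nlog, integral_nlog_iter]
  simp only [integral_const, probReal_univ, one_smul]
  have : (1 / 2 : ℝ) ^ n = 1 / 2 ^ n := by rw [div_pow, one_pow]
  rw [this]
  have : lev * (lev + tr nlog 1 / 2 ^ n) = lev * lev + lev * tr nlog 1 * (1 / 2 ^ n) := by ring
  linarith

lemma memLp_bsum (n : ℕ) : MemLp (birkhoffSum gauss cen n) 2 gm := by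
  unfold birkhoffSum
  exact memLp_finsetSum _ fun i _ => memLp_cen_iter i

lemma var_le : ∃ K : ℝ, ∀ n : ℕ, ∫ x, (birkhoffSum gauss cen n x) ^ 2 ∂gm ≤ K * n := by
  set D := lev * tr nlog 1 with hD
  have hD0 : 0 ≤ D := mul_nonneg lev_pos.le (tr_nonneg _ _)
  refine ⟨∫ x, cen x ^ 2 ∂gm + 4 * D, fun n => ?_⟩
  induction n with
  | zero => simp [birkhoffSum]
  | succ n ih =>
    have m1 := memLp_cen
    have m2 : MemLp (fun x => birkhoffSum gauss cen n (gauss x)) 2 gm :=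
      (memLp_bsum n).comp_measurePreserving mp_gauss
    have cross : ∫ x, cen x * birkhoffSum gauss cen n (gauss x) ∂gm ≤ 2 * D := by
      have e : ∀ x, cen x * birkhoffSum gauss cen n (gauss x) =
          ∑ i ∈ Finset.range n, cen x * cen (gauss^[i + 1] x) := by
        intro x
        unfold birkhoffSum
        rw [Finset.mul_sum]
        rfl
      simp_rw [e]
      have hi : ∀ i ∈ Finset.range n, Integrable (fun x => cen x * cen (gauss^[i + 1] x)) gm :=
        fun i _ => m1.integrable_mul (memLp_cen_iter (i + 1))
      rw [integral_finsetSum _ hi]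
      calc _ ≤ ∑ i ∈ Finset.range n, D * (1 / 2) ^ i := Finset.sum_le_sum fun i _ => cov_le i
        _ = D * ∑ i ∈ Finset.range n, (1 / 2 : ℝ) ^ i := by rw [Finset.mul_sum]
        _ ≤ D * 2 := by
          gcongr
          exact sum_geometric_two_le n
        _ = _ := by ring
    have sq : ∫ x, (birkhoffSum gauss cen n (gauss x)) ^ 2 ∂gm =
        ∫ x, (birkhoffSum gauss cen n x) ^ 2 ∂gm := by
      have h := mp_gauss.map_eq
      conv_rhs => rw [← h]
      rw [integral_map mp_gauss.measurable.aemeasurable]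
      rw [h]
      exact (memLp_bsum n).aestronglyMeasurable.pow 2
    have e2 : ∀ x, (birkhoffSum gauss cen (n + 1) x) ^ 2 = cen x ^ 2 +
        2 * (cen x * birkhoffSum gauss cen n (gauss x)) + (birkhoffSum gauss cen n (gauss x)) ^ 2 := by
      intro x
      rw [birkhoffSum_succ']
      ring
    simp_rw [e2]
    have i1 : Integrable (fun x => cen x ^ 2) gm := m1.integrable_sq
    have i2 : Integrable (fun x => 2 * (cen x * birkhoffSum gauss cen n (gauss x))) gm :=
      (m1.integrable_mul m2).const_mul 2
    have i3 : Integrable (fun x => (birkhoffSum gauss cen n (gauss x)) ^ 2) gm := m2.integrable_sq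
    have i4 : Integrable (fun x => cen x ^ 2 +
        2 * (cen x * birkhoffSum gauss cen n (gauss x))) gm := i1.add i2
    rw [integral_add i4 i3, integral_add i1 i2, integral_const_mul, sq]
    push_cast
    linarith

lemma ae_sq : ∀ᵐ x ∂gm, Tendsto (fun m : ℕ =>
    birkhoffSum gauss cen ((m + 1) ^ 2) x / (((m + 1) ^ 2 : ℕ) : ℝ)) atTop (nhds 0) := by
  obtain ⟨K, hK⟩ := var_le
  set Y : ℕ → ℝ → ℝ := fun m x => birkhoffSum gauss cen ((m + 1) ^ 2) x / (((m + 1) ^ 2 : ℕ) : ℝ)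
  have hY : ∀ m, MemLp (Y m) 2 gm := fun m => by
    have := (memLp_bsum ((m + 1) ^ 2)).mul_const ((((m + 1) ^ 2 : ℕ) : ℝ)⁻¹)
    simpa [Y, div_eq_mul_inv] using this
  have hb : ∀ m, ∫⁻ x, ENNReal.ofReal (Y m x ^ 2) ∂gm ≤
      ENNReal.ofReal (K * (1 / ((m + 1 : ℕ) : ℝ) ^ 2)) := by
    intro m
    rw [← ofReal_integral_eq_lintegral_ofReal (hY m).integrable_sq (ae_of_all _ fun x => sq_nonneg _)]
    apply ENNReal.ofReal_le_ofReal
    simp only [Y, div_pow]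
    rw [integral_div, div_le_iff₀ (by positivity)]
    refine (hK _).trans (le_of_eq ?_)
    have : ((m : ℝ) + 1) ≠ 0 := by positivity
    push_cast
    field_simp
  have hsm : Summable fun m : ℕ => K * (1 / ((m + 1 : ℕ) : ℝ) ^ 2) := by
    apply Summable.mul_left
    exact (summable_nat_add_iff 1).mpr (Real.summable_one_div_nat_pow.mpr (by norm_num))
  have hmeas : ∀ m, AEMeasurable (fun x => ENNReal.ofReal (Y m x ^ 2)) gm := fun m =>
    ((hY m).aestronglyMeasurable.aemeasurable.pow_const 2).ennreal_ofReal
  have hfin : ∫⁻ x, ∑' m, ENNReal.ofReal (Y m x ^ 2) ∂gm ≠ ⊤ := by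
    rw [lintegral_tsum hmeas]
    refine ne_top_of_le_ne_top ?_ (ENNReal.tsum_le_tsum hb)
    exact hsm.tsum_ofReal_ne_top
  have hmt : AEMeasurable (fun x => ∑' m, ENNReal.ofReal (Y m x ^ 2)) gm :=
    AEMeasurable.tsum hmeas
  filter_upwards [ae_lt_top' hmt hfin] with x hx
  have h1 := ENNReal.tendsto_atTop_zero_of_tsum_ne_top hx.ne
  have h2 : Tendsto (fun m => Y m x ^ 2) atTop (nhds 0) := by
    have := (ENNReal.tendsto_toReal ENNReal.zero_ne_top).comp h1
    simp only [ENNReal.toReal_zero] at this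
    refine this.congr fun m => ?_
    simp [ENNReal.toReal_ofReal (sq_nonneg _)]
  have h3 := h2.sqrt
  simp only [Real.sqrt_zero, Real.sqrt_sq_eq_abs] at h3
  exact (tendsto_zero_iff_abs_tendsto_zero _).mpr h3

lemma levy {x : ℝ} (hx : IrrU x) (h : Tendsto (fun m : ℕ =>
    birkhoffSum gauss cen ((m + 1) ^ 2) x / (((m + 1) ^ 2 : ℕ) : ℝ)) atTop (nhds 0)) :
    Tendsto (fun n : ℕ => -Real.log (orbProd n x) / n) atTop (nhds lev) := by
  have hS : ∀ n : ℕ, -Real.log (orbProd n x) = birkhoffSum gauss cen n x + n * lev := by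
    intro n
    unfold orbProd birkhoffSum cen nlog
    rw [Real.log_prod fun i _ => (hx.iter i).2.1.ne']
    simp
  apply tendsto_div_of_monotone_of_exists_subseq_tendsto_div
  · intro a b hab
    have := Real.log_le_log (orbProd_pos hx b) (orbProd_anti hx hab)
    simp only
    linarith
  · intro a ha
    refine ⟨fun m => (m + 1) ^ 2, ?_, ?_, ?_⟩
    · have : Tendsto (fun m : ℕ => (1 + 1 / ((m : ℝ) + 1)) ^ 2) atTop (nhds ((1 + 0) ^ 2)) :=
        (tendsto_const_nhds.add tendsto_one_div_add_atTop_nhds_zero_nat).pow 2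
      have := this.eventually_lt_const (show ((1 : ℝ) + 0) ^ 2 < a by simpa using ha)
      filter_upwards [this] with m hm
      push_cast
      have hp : (0 : ℝ) < (m : ℝ) + 1 := by positivity
      have : ((m : ℝ) + 1 + 1) ^ 2 = (1 + 1 / ((m : ℝ) + 1)) ^ 2 * ((m : ℝ) + 1) ^ 2 := by
        field_simp
      rw [this]
      gcongr
    · exact (tendsto_pow_atTop two_ne_zero).comp (tendsto_add_atTop_nat 1)
    · have := h.add_const lev
      rw [zero_add] at this
      refine this.congr fun m => ?_
      rw [hS]
      have : (((m + 1) ^ 2 : ℕ) : ℝ) ≠ 0 := by positivity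
      field_simp

lemma gm_ac : (volume.restrict (Ioo (0 : ℝ) 1)) ≪ gm := by
  unfold gm
  apply withDensity_absolutelyContinuous' measurable_rho.aemeasurable
  filter_upwards [ae_restrict_mem measurableSet_Ioo] with x hx
  have := hx.1
  have := log2_pos
  rw [Ne, ENNReal.ofReal_eq_zero, not_le]
  unfold rho
  positivity

theorem lochs_radix (g : ℕ) (hg : 2 ≤ g) :
    ∀ᵐ x ∂(volume : Measure ℝ), x ∈ Set.Ioo (0 : ℝ) 1 →
      Tendsto (fun n : ℕ => (mRadixCF g x n : ℝ) / n) atTop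
        (nhds (6 * Real.log 2 * Real.log g / Real.pi ^ 2)) := by
  have h1 : ∀ᵐ x ∂(volume.restrict (Ioo (0 : ℝ) 1)), Tendsto (fun m : ℕ =>
    birkhoffSum gauss cen ((m + 1) ^ 2) x / (((m + 1) ^ 2 : ℕ) : ℝ)) atTop (nhds 0) :=
    gm_ac.ae_le ae_sq
  rw [ae_restrict_iff' measurableSet_Ioo] at h1
  have h2 : ∀ᵐ x ∂(volume : Measure ℝ), Irrational x := by
    rw [ae_iff]
    have : {x : ℝ | ¬ Irrational x} = Set.range ((↑) : ℚ → ℝ) := by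
      ext x; simp [Irrational]
    rw [this]
    exact (Set.countable_range _).measure_zero _
  filter_upwards [h1, h2] with x hx hi hI
  have hU : IrrU x := ⟨hi, hI.1, hI.2⟩
  have := lochs_det g hg hU lev_pos (levy hU (hx hI))
  convert! this using 2
  unfold lev
  have := log2_pos
  have := Real.pi_pos
  field_simp
  ring
end

section
/- Let g ≥ 2 be an integer. For Lebesgue-almost every x ∈ (0,1), the number m_g^{ALE}(x,n) of alternating Lüroth digits of x determined by its first n g-adic digits satisfies lim_{n→∞} m_g^{ALE}(x,n)/n = log g / Σ_{k=1}^∞ log(k(k+1))/(k(k+1)). -/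
open MeasureTheory Filter Set

/-- The alternating Lüroth map: on `(1/(k+1), 1/k]` (where `k = ⌊1/x⌋`) it is
`x ↦ (k+1) - k(k+1)x`, decreasing linearly onto `[0,1)`. -/
noncomputable def altLuroth (x : ℝ) : ℝ :=
  ((⌊1 / x⌋ : ℝ) + 1) - (⌊1 / x⌋ : ℝ) * ((⌊1 / x⌋ : ℝ) + 1) * x

/-- `altLurothDigit i x` is the `(i+1)`-st alternating Lüroth digit
`k_{i+1}(x) = ⌊1 / L^i(x)⌋`. -/
noncomputable def altLurothDigit (i : ℕ) (x : ℝ) : ℤ := ⌊1 / altLuroth^[i] x⌋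

/-- The number of alternating Lüroth digits of `x` determined by its first `n`
`g`-adic digits. -/
noncomputable def mRadixALE (g : ℕ) (x : ℝ) (n : ℕ) : ℕ :=
  sSup {m : ℕ | ∀ y ∈ radixCyl g n x, (∀ i : ℕ, altLuroth^[i] y ≠ 0) →
    ∀ i < m, altLurothDigit i y = altLurothDigit i x}

/-- branch slope -/
noncomputable def slopeAL (x : ℝ) : ℝ := (⌊1 / x⌋ : ℝ) * ((⌊1 / x⌋ : ℝ) + 1)

noncomputable def prodAL (m : ℕ) (x : ℝ) : ℝ := ∏ i ∈ Finset.range m, slopeAL (altLuroth^[i] x)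

lemma altLuroth_eq (x : ℝ) : altLuroth x = (⌊1 / x⌋ : ℝ) + 1 - slopeAL x * x := rfl

lemma floor_bounds {x : ℝ} (hx : x ∈ Ioo (0:ℝ) 1) :
    (1:ℝ) ≤ (⌊1/x⌋ : ℝ) ∧ (⌊1/x⌋ : ℝ) * x ≤ 1 ∧ 1 < ((⌊1/x⌋ : ℝ) + 1) * x := by
  have h0 := hx.1
  refine ⟨?_, ?_, ?_⟩
  · have : (1:ℤ) ≤ ⌊1/x⌋ := by
      rw [Int.le_floor]; push_cast
      rw [le_div_iff₀ h0]; linarith [hx.2]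
    exact_mod_cast this
  · exact (le_div_iff₀ h0).1 (Int.floor_le (1/x))
  · exact (div_lt_iff₀ h0).1 (Int.lt_floor_add_one (1/x))

lemma slope_ge {x : ℝ} (hx : x ∈ Ioo (0:ℝ) 1) : 2 ≤ slopeAL x := by
  have := (floor_bounds hx).1
  unfold slopeAL; nlinarith

lemma altLuroth_irr {x : ℝ} (hx : x ∈ Ioo (0:ℝ) 1) (hi : Irrational x) :
    Irrational (altLuroth x) := by
  have h := (floor_bounds hx).1
  have e : altLuroth x = (((⌊1/x⌋ + 1 : ℤ)) : ℝ) - ((⌊1/x⌋ * (⌊1/x⌋ + 1) : ℤ) : ℝ) * x := by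
    unfold altLuroth; push_cast; ring
  rw [e]
  refine Irrational.intCast_sub (Irrational.intCast_mul hi ?_) _
  have h' : 1 ≤ ⌊1/x⌋ := by exact_mod_cast h
  positivity

lemma altLuroth_mem {x : ℝ} (hx : x ∈ Ioo (0:ℝ) 1) (hi : Irrational x) :
    altLuroth x ∈ Ioo (0:ℝ) 1 := by
  obtain ⟨h1, h2, h3⟩ := floor_bounds hx
  have hne := (altLuroth_irr hx hi).ne_zero
  have hnn : 0 ≤ altLuroth x := by unfold altLuroth; nlinarith
  refine ⟨lt_of_le_of_ne hnn hne.symm, ?_⟩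
  unfold altLuroth; nlinarith

lemma iter_good {x : ℝ} (hx : x ∈ Ioo (0:ℝ) 1) (hi : Irrational x) (m : ℕ) :
    altLuroth^[m] x ∈ Ioo (0:ℝ) 1 ∧ Irrational (altLuroth^[m] x) := by
  induction m with
  | zero => exact ⟨hx, hi⟩
  | succ m ih =>
    rw [Function.iterate_succ_apply']
    exact ⟨altLuroth_mem ih.1 ih.2, altLuroth_irr ih.1 ih.2⟩

lemma prodAL_succ (m : ℕ) (x : ℝ) : prodAL (m+1) x = prodAL m x * slopeAL (altLuroth^[m] x) := by
  unfold prodAL; rw [Finset.prod_range_succ]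

lemma prodAL_succ' (m : ℕ) (x : ℝ) : prodAL (m+1) x = slopeAL x * prodAL m (altLuroth x) := by
  unfold prodAL; rw [Finset.prod_range_succ']
  simp [mul_comm]

lemma prodAL_pos {x : ℝ} (hx : x ∈ Ioo (0:ℝ) 1) (hi : Irrational x) (m : ℕ) : 0 < prodAL m x :=
  Finset.prod_pos fun i _ => by linarith [slope_ge (iter_good hx hi i).1]

/-- distance to the boundary -/
noncomputable def dAL (x : ℝ) : ℝ := min x (1 - x)

lemma dAL_le {x : ℝ} (hx : x ∈ Ioo (0:ℝ) 1) :
    dAL (altLuroth x) ≤ slopeAL x * dAL x := by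
  obtain ⟨h1, h2, h3⟩ := floor_bounds hx
  have hs := slope_ge hx
  unfold dAL
  rw [mul_min_of_nonneg _ _ (by linarith)]
  refine le_min ?_ ?_
  · refine (min_le_right _ _).trans ?_
    rw [altLuroth_eq]; linarith
  · refine (min_le_left _ _).trans ?_
    rw [altLuroth_eq]
    have : (⌊1/x⌋ : ℝ) + 1 ≤ slopeAL x := by unfold slopeAL; nlinarith
    linarith

lemma dAL_iter_le {x : ℝ} (hx : x ∈ Ioo (0:ℝ) 1) (hi : Irrational x) (m : ℕ) :
    dAL (altLuroth^[m] x) ≤ prodAL m x * dAL x := by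
  induction m with
  | zero => simp [prodAL]
  | succ m ih =>
    have hg := iter_good hx hi m
    have := dAL_le hg.1
    rw [Function.iterate_succ_apply', prodAL_succ]
    have hs := slope_ge hg.1
    calc _ ≤ _ := this
      _ ≤ slopeAL (altLuroth^[m] x) * (prodAL m x * dAL x) := by gcongr
      _ = _ := by ring

lemma digits_agree (m : ℕ) : ∀ {x y : ℝ}, x ∈ Ioo (0:ℝ) 1 → Irrational x →
    prodAL m x * |y - x| < dAL (altLuroth^[m] x) →
    ∀ i < m, altLurothDigit i y = altLurothDigit i x := by
  induction m with
  | zero => intro x y _ _ _ i hi; omega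
  | succ m ih =>
    intro x y hx hi h i him
    have hLx := altLuroth_mem hx hi
    have hLi := altLuroth_irr hx hi
    have hp := prodAL_pos hLx hLi m
    have hs := slope_ge hx
    rw [prodAL_succ', Function.iterate_succ_apply] at h
    have h2 := dAL_iter_le hLx hLi m
    have h3 : slopeAL x * |y - x| < dAL (altLuroth x) := by
      by_contra hcon
      push Not at hcon
      have := mul_le_mul_of_nonneg_left hcon hp.le
      linarith
    have h4 : |slopeAL x * (y - x)| < dAL (altLuroth x) := by
      rw [abs_mul, abs_of_pos (by linarith : 0 < slopeAL x)]; exact h3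
    obtain ⟨h5, h6⟩ := abs_lt.1 h4
    have h7 : dAL (altLuroth x) ≤ altLuroth x := min_le_left _ _
    have h8 : dAL (altLuroth x) ≤ 1 - altLuroth x := min_le_right _ _
    obtain ⟨f1, f2, f3⟩ := floor_bounds hx
    have e := altLuroth_eq x
    have a1 : slopeAL x * y < (⌊1/x⌋ : ℝ) + 1 := by linarith
    have a2 : (⌊1/x⌋ : ℝ) < slopeAL x * y := by linarith
    have b1 : (⌊1/x⌋ : ℝ) * y < 1 := by unfold slopeAL at a1; by_contra hc; push Not at hc; nlinarith
    have b2 : 1 < ((⌊1/x⌋ : ℝ) + 1) * y := by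
      unfold slopeAL at a2; by_contra hc; push Not at hc; nlinarith
    have hy : 0 < y := by by_contra hc; push Not at hc; nlinarith
    have hfl : ⌊1/y⌋ = ⌊1/x⌋ := by
      rw [Int.floor_eq_iff]
      constructor
      · rw [le_div_iff₀ hy]; exact b1.le
      · rw [div_lt_iff₀ hy]; exact b2
    have hsl : slopeAL y = slopeAL x := by unfold slopeAL; rw [hfl]
    cases i with
    | zero => simpa [altLurothDigit] using hfl
    | succ i =>
      have : altLurothDigit i (altLuroth y) = altLurothDigit i (altLuroth x) := by
        refine ih hLx hLi ?_ i (by omega)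
        have e2 : altLuroth y - altLuroth x = -(slopeAL x * (y - x)) := by
          rw [altLuroth_eq, altLuroth_eq, hfl, hsl]; ring
        rw [e2, abs_neg, abs_mul, abs_of_pos (by linarith : 0 < slopeAL x)]
        calc _ = _ := by ring
          _ < _ := h
      simpa [altLurothDigit, Function.iterate_succ_apply] using this

lemma dAL_lower {x : ℝ} (hx : x ∈ Ioo (0:ℝ) 1) (hi : Irrational x) :
    1 ≤ prodAL 3 x * dAL x := by
  have g1 := iter_good hx hi 1
  have g2 := iter_good hx hi 2
  have s0 := slope_ge hx
  have s1 := slope_ge g1.1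
  have s2 := slope_ge g2.1
  have e : prodAL 3 x = slopeAL x * slopeAL (altLuroth^[1] x) * slopeAL (altLuroth^[2] x) := by
    simp [prodAL, Finset.prod_range_succ]
  have key : ∀ z ∈ Ioo (0:ℝ) 1, 1 ≤ slopeAL z * z := by
    intro z hz
    obtain ⟨f1, f2, f3⟩ := floor_bounds hz
    unfold slopeAL; nlinarith
  have k0 := key x hx
  have k1 := key _ g1.1
  set a := slopeAL (altLuroth^[1] x)
  set b := slopeAL (altLuroth^[2] x)
  have hab : 4 ≤ a * b := by nlinarith
  unfold dAL
  rw [e, mul_min_of_nonneg _ _ (by positivity)]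
  refine le_min ?_ ?_
  · calc (1:ℝ) ≤ 1 * 4 := by norm_num
      _ ≤ (slopeAL x * x) * (a * b) := by gcongr
      _ = _ := by ring
  · obtain ⟨f1, f2, f3⟩ := floor_bounds hx
    have h1 : altLuroth^[1] x ≤ slopeAL x * (1 - x) := by
      simp only [Function.iterate_one]
      rw [altLuroth_eq]
      have : (⌊1/x⌋ : ℝ) + 1 ≤ slopeAL x := by unfold slopeAL; nlinarith
      linarith
    calc (1:ℝ) ≤ 1 * 1 := by norm_num
      _ ≤ (a * altLuroth^[1] x) * b := by gcongr; linarith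
      _ ≤ (a * (slopeAL x * (1-x))) * b := by gcongr
      _ = _ := by ring

lemma prodAL_add (m j : ℕ) (x : ℝ) : prodAL (m+j) x = prodAL m x * prodAL j (altLuroth^[m] x) := by
  unfold prodAL
  rw [Finset.prod_range_add]
  congr 1
  refine Finset.prod_congr rfl fun i _ => ?_
  rw [← Function.iterate_add_apply, add_comm]

/-- If digits agree, iterates expand exactly. -/
lemma iter_diff (m : ℕ) : ∀ {x y : ℝ}, (∀ i < m, altLurothDigit i y = altLurothDigit i x) →
    ∀ {z : ℝ}, (∀ i < m, altLurothDigit i z = altLurothDigit i x) →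
    |altLuroth^[m] y - altLuroth^[m] z| = |prodAL m x| * |y - z| := by
  induction m with
  | zero => intro x y _ z _; simp [prodAL]
  | succ m ih =>
    intro x y hy z hz
    have h1 := ih (fun i h => hy i (by omega)) (fun i h => hz i (by omega))
    have y1 := hy m (by omega)
    have z1 := hz m (by omega)
    rw [Function.iterate_succ_apply', Function.iterate_succ_apply', prodAL_succ]
    unfold altLurothDigit at y1 z1
    have e : altLuroth (altLuroth^[m] y) - altLuroth (altLuroth^[m] z)
      = - (slopeAL (altLuroth^[m] x) * (altLuroth^[m] y - altLuroth^[m] z)) := by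
      rw [altLuroth_eq, altLuroth_eq]; unfold slopeAL; rw [y1, z1]; ring
    rw [e, abs_neg, abs_mul, h1, abs_mul]; ring

/-- The set in the definition of `mRadixALE`. -/
def mSet (g : ℕ) (x : ℝ) (n : ℕ) : Set ℕ := {m : ℕ | ∀ y ∈ radixCyl g n x, (∀ i : ℕ, altLuroth^[i] y ≠ 0) →
    ∀ i < m, altLurothDigit i y = altLurothDigit i x}

lemma mSet_upper {g : ℕ} (hg : 2 ≤ g) {x : ℝ} (hx : x ∈ Ioo (0:ℝ) 1) (hi : Irrational x) {n m : ℕ}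
    (hm : m ∈ mSet g x n) : prodAL m x ≤ (g:ℝ)^n := by
  have hgp : (0:ℝ) < (g:ℝ)^n := by positivity
  by_contra hcon
  push Not at hcon
  have hp := prodAL_pos hx hi m
  set a : ℝ := (⌊(g : ℝ) ^ n * x⌋ : ℝ) / (g:ℝ)^n with ha
  have hb : ((⌊(g : ℝ) ^ n * x⌋ : ℝ) + 1) / (g : ℝ) ^ n = a + 1/(g:ℝ)^n := by rw [ha]; ring
  have ha0 : 0 ≤ a := by
    have : (0:ℤ) ≤ ⌊(g : ℝ) ^ n * x⌋ := Int.floor_nonneg.2 (by have := hx.1; positivity)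
    have : (0:ℝ) ≤ (⌊(g : ℝ) ^ n * x⌋ : ℝ) := by exact_mod_cast this
    positivity
  have hb1 : a + 1/(g:ℝ)^n ≤ 1 := by
    rw [← hb, div_le_one hgp]
    have : ⌊(g : ℝ) ^ n * x⌋ < (g:ℤ)^n := by
      rw [Int.floor_lt]; push_cast; nlinarith [hx.2]
    have : ⌊(g : ℝ) ^ n * x⌋ + 1 ≤ (g:ℤ)^n := this
    exact_mod_cast this
  -- the gap
  have hgap : 1 / prodAL m x < 1/(g:ℝ)^n := one_div_lt_one_div_of_lt hgp hcon
  have hpi : 0 < 1 / prodAL m x := by positivity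
  set ε := (1/(g:ℝ)^n - 1 / prodAL m x) / 2 with hε
  have hεp : 0 < ε := by rw [hε]; linarith
  obtain ⟨y, hyi, hy1, hy2⟩ := exists_irrational_btwn (show a < a + ε by linarith)
  obtain ⟨z, hzi, hz1, hz2⟩ := exists_irrational_btwn (show a + 1/(g:ℝ)^n - ε < a + 1/(g:ℝ)^n by linarith)
  have hy : y ∈ Ioo (0:ℝ) 1 := ⟨by linarith, by linarith⟩
  have hz : z ∈ Ioo (0:ℝ) 1 := ⟨by linarith, by linarith⟩
  have dy := hm y (by unfold radixCyl; rw [hb]; exact ⟨hy1.le, by linarith⟩)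
    (fun i => (iter_good hy hyi i).1.1.ne')
  have dz := hm z (by unfold radixCyl; rw [hb]; exact ⟨by linarith, hz2⟩)
    (fun i => (iter_good hz hzi i).1.1.ne')
  have h := iter_diff m dy dz
  have h1 : |altLuroth^[m] y - altLuroth^[m] z| < 1 := by
    have := (iter_good hy hyi m).1
    have := (iter_good hz hzi m).1
    simp only [mem_Ioo] at *
    rw [abs_lt]; constructor <;> linarith
  rw [h, abs_of_pos hp] at h1
  have h2 : 1 / prodAL m x < |y - z| := by
    rw [abs_sub_comm]
    refine lt_of_lt_of_le ?_ (le_abs_self _)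
    linarith
  rw [div_lt_iff₀ hp] at h2
  linarith

lemma mSet_lower {g : ℕ} (hg : 2 ≤ g) {x : ℝ} (hx : x ∈ Ioo (0:ℝ) 1) (hi : Irrational x) {n m : ℕ}
    (hm : prodAL (m+3) x ≤ (g:ℝ)^n) : m ∈ mSet g x n := by
  intro y hy _
  have hgp : (0:ℝ) < (g:ℝ)^n := by positivity
  have hp := prodAL_pos hx hi m
  have hgm := iter_good hx hi m
  have h1 := dAL_lower hgm.1 hgm.2
  rw [prodAL_add] at hm
  have hd : 0 < dAL (altLuroth^[m] x) := lt_min hgm.1.1 (by linarith [hgm.1.2])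
  refine digits_agree m hx hi ?_
  have hyx : |y - x| * (g:ℝ)^n < 1 := by
    unfold radixCyl at hy
    obtain ⟨h2, h3⟩ := hy
    rw [div_le_iff₀ hgp] at h2
    rw [lt_div_iff₀ hgp] at h3
    have h4 := Int.floor_le ((g : ℝ) ^ n * x)
    have h5 := Int.lt_floor_add_one ((g : ℝ) ^ n * x)
    have e : |y - x| * (g:ℝ)^n = |(y - x) * (g:ℝ)^n| := by rw [abs_mul, abs_of_pos hgp]
    rw [e, abs_lt]
    constructor <;> nlinarith
  set Q := prodAL 3 (altLuroth^[m] x)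
  have hQ : 0 < Q := prodAL_pos hgm.1 hgm.2 3
  have h6 : |y - x| * (prodAL m x * Q) < 1 :=
    lt_of_le_of_lt (mul_le_mul_of_nonneg_left hm (abs_nonneg _)) hyx
  by_contra hc
  push Not at hc
  have := mul_le_mul_of_nonneg_left hc hQ.le
  nlinarith

lemma prodAL_ge {x : ℝ} (hx : x ∈ Ioo (0:ℝ) 1) (hi : Irrational x) (m : ℕ) : (2:ℝ)^m ≤ prodAL m x := by
  induction m with
  | zero => simp [prodAL]
  | succ m ih =>
    rw [pow_succ, prodAL_succ]
    have := slope_ge (iter_good hx hi m).1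
    have := prodAL_pos hx hi m
    gcongr

lemma mSet_bdd {g : ℕ} (hg : 2 ≤ g) {x : ℝ} (hx : x ∈ Ioo (0:ℝ) 1) (hi : Irrational x) (n : ℕ) :
    BddAbove (mSet g x n) := by
  refine ⟨g^n, fun m hm => ?_⟩
  have h1 := (prodAL_ge hx hi m).trans (mSet_upper hg hx hi hm)
  have h2 : 2^m ≤ g^n := by exact_mod_cast h1
  exact (Nat.lt_two_pow_self (n := m)).le.trans h2

lemma m_sandwich {g : ℕ} (hg : 2 ≤ g) {x : ℝ} (hx : x ∈ Ioo (0:ℝ) 1) (hi : Irrational x) (n : ℕ) :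
    prodAL (mRadixALE g x n) x ≤ (g:ℝ)^n ∧ (g:ℝ)^n < prodAL (mRadixALE g x n + 4) x := by
  have hb := mSet_bdd hg hx hi n
  constructor
  · refine mSet_upper hg hx hi (Nat.sSup_mem ⟨0, ?_⟩ hb)
    intro y _ _ i h; omega
  · by_contra hc
    push Not at hc
    have := le_csSup hb (mSet_lower hg hx hi (m := mRadixALE g x n + 1) hc)
    change _ ≤ mRadixALE g x n at this
    omega

lemma det_limit {g : ℕ} (hg : 2 ≤ g) {x : ℝ} (hx : x ∈ Ioo (0:ℝ) 1) (hi : Irrational x) {h : ℝ}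
    (hlim : Tendsto (fun m : ℕ => (∑ i ∈ Finset.range m, Real.log (slopeAL (altLuroth^[i] x))) / m)
      atTop (nhds h)) (hh : h ≠ 0) :
    Tendsto (fun n : ℕ => (mRadixALE g x n : ℝ) / n) atTop (nhds (Real.log g / h)) := by
  set M := fun n => mRadixALE g x n with hM
  have hlogg : 0 < Real.log g := Real.log_pos (by exact_mod_cast hg)
  have hS : ∀ m, (∑ i ∈ Finset.range m, Real.log (slopeAL (altLuroth^[i] x))) = Real.log (prodAL m x) := by
    intro m
    unfold prodAL
    rw [Real.log_prod]
    intro i _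
    linarith [slope_ge (iter_good hx hi i).1]
  simp only [hS] at hlim
  have hmono : Monotone (fun m => prodAL m x) := by
    refine monotone_nat_of_le_succ fun m => ?_
    rw [prodAL_succ]
    have := slope_ge (iter_good hx hi m).1
    have := prodAL_pos hx hi m
    nlinarith
  have hMtop : Tendsto M atTop atTop := by
    rw [tendsto_atTop]
    intro b
    have : Tendsto (fun n : ℕ => (g:ℝ)^n) atTop atTop :=
      tendsto_pow_atTop_atTop_of_one_lt (by exact_mod_cast hg)
    filter_upwards [this.eventually_ge_atTop (prodAL (b+4) x)] with n hn
    by_contra hc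
    push Not at hc
    have h1 := (m_sandwich hg hx hi n).2
    have h2 : prodAL (M n + 4) x ≤ prodAL (b+4) x := hmono (by omega)
    exact absurd (h1.trans_le (h2.trans hn)) (lt_irrefl _)
  have hlow : Tendsto (fun n => Real.log (prodAL (M n) x) / (M n : ℝ)) atTop (nhds h) := hlim.comp hMtop
  have hup : Tendsto (fun n => Real.log (prodAL (M n + 4) x) / (M n : ℝ)) atTop (nhds h) := by
    have h1 : Tendsto (fun m : ℕ => Real.log (prodAL (m + 4) x) / ((m + 4 : ℕ) : ℝ)) atTop (nhds h) :=
      hlim.comp (tendsto_add_atTop_nat 4)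
    have h2 : Tendsto (fun m : ℕ => 1 + (4:ℝ) / (m:ℝ)) atTop (nhds (1 + 0)) :=
      tendsto_const_nhds.add (tendsto_const_div_atTop_nhds_zero_nat 4)
    have h3 := h1.mul h2
    rw [add_zero, mul_one] at h3
    have h4 : Tendsto (fun m : ℕ => Real.log (prodAL (m + 4) x) / (m : ℝ)) atTop (nhds h) := by
      refine h3.congr' ?_
      filter_upwards [eventually_gt_atTop 0] with m hm
      have : (m:ℝ) ≠ 0 := by positivity
      push_cast
      field_simp
    exact h4.comp hMtop
  have hmid : Tendsto (fun n : ℕ => (n * Real.log g) / (M n : ℝ)) atTop (nhds h) := by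
    refine tendsto_of_tendsto_of_tendsto_of_le_of_le hlow hup ?_ ?_
    · intro n
      have := Real.log_le_log (prodAL_pos hx hi _) (m_sandwich hg hx hi n).1
      rw [Real.log_pow] at this
      dsimp only; gcongr
    · intro n
      have := Real.log_le_log (by positivity) (m_sandwich hg hx hi n).2.le
      rw [Real.log_pow] at this
      dsimp only; gcongr
  have := (hmid.inv₀ hh).const_mul (Real.log g)
  rw [← div_eq_mul_inv] at this
  refine this.congr fun n => ?_
  rw [inv_div]
  field_simp
  rfl

/-! ### Probabilistic part -/

noncomputable def muAL : Measure ℝ := (volume : Measure ℝ).restrict (Ioc 0 1)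

instance muAL_prob : IsProbabilityMeasure muAL := ⟨by simp [muAL]⟩

noncomputable def digAL (x : ℝ) : ℕ := (⌊1 / x⌋ - 1).toNat

noncomputable def fAL (a : ℕ) : ℝ := Real.log (((a : ℝ) + 1) * ((a : ℝ) + 2))

lemma measurable_digAL : Measurable digAL := by
  have h : Measurable (fun x : ℝ => ⌊1 / x⌋) := Int.measurable_floor.comp (by fun_prop)
  exact (measurable_of_countable (fun z : ℤ => (z - 1).toNat)).comp h

lemma measurable_altLuroth : Measurable altLuroth := by
  have h : Measurable (fun x : ℝ => ⌊1 / x⌋) := Int.measurable_floor.comp (by fun_prop)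
  have h' : Measurable (fun x : ℝ => (⌊1 / x⌋ : ℝ)) := (measurable_of_countable (fun z : ℤ => (z : ℝ))).comp h
  unfold altLuroth
  fun_prop

lemma floor_digAL {x : ℝ} (hx : x ∈ Ioc (0:ℝ) 1) : ⌊1 / x⌋ = (digAL x : ℤ) + 1 := by
  have : (1:ℤ) ≤ ⌊1/x⌋ := by
    rw [Int.le_floor]; push_cast
    rw [le_div_iff₀ hx.1]; linarith [hx.2]
  unfold digAL; omega

lemma cyl_preimage (a : ℕ) (B : Set ℝ) :
    (digAL ⁻¹' {a} ∩ altLuroth ⁻¹' B) ∩ Ioc 0 1 =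
      (fun x : ℝ => (((a:ℝ) + 1) * ((a:ℝ) + 2)) * x) ⁻¹' ((fun x : ℝ => ((a:ℝ) + 2) - x) ⁻¹' (B ∩ Ico 0 1)) := by
  have ha : (0:ℝ) ≤ a := Nat.cast_nonneg a
  ext x
  simp only [mem_inter_iff, mem_preimage, mem_singleton_iff]
  have hiff : ∀ hx : 0 < x, ⌊1/x⌋ = (a:ℤ) + 1 → altLuroth x = (a:ℝ) + 2 - ((a:ℝ) + 1) * ((a:ℝ) + 2) * x := by
    intro hx h
    unfold altLuroth; rw [h]; push_cast; ring
  constructor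
  · rintro ⟨⟨hd, hB⟩, hx⟩
    have hf := floor_digAL hx
    rw [hd] at hf
    have e := hiff hx.1 hf
    rw [← e]
    refine ⟨hB, ?_⟩
    have hx0 := hx.1
    obtain ⟨h1, h2⟩ := Int.floor_eq_iff.1 hf
    push_cast at h1 h2
    rw [le_div_iff₀ hx0] at h1
    rw [div_lt_iff₀ hx0] at h2
    rw [e]
    constructor <;> nlinarith
  · rintro ⟨hB, h1, h2⟩
    have b1 : ((a:ℝ) + 1) * x ≤ 1 := by by_contra hc; push Not at hc; nlinarith
    have b2 : 1 < ((a:ℝ) + 2) * x := by by_contra hc; push Not at hc; nlinarith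
    have hx0 : 0 < x := by by_contra hc; push Not at hc; nlinarith
    have hx1 : x ≤ 1 := by nlinarith
    have hf : ⌊1/x⌋ = (a:ℤ) + 1 := by
      rw [Int.floor_eq_iff]; push_cast
      rw [le_div_iff₀ hx0, div_lt_iff₀ hx0]
      constructor <;> linarith
    refine ⟨⟨?_, ?_⟩, hx0, hx1⟩
    · have := floor_digAL ⟨hx0, hx1⟩
      omega
    · rw [hiff hx0 hf]; exact hB

lemma mu_cyl (a : ℕ) {B : Set ℝ} (hB : MeasurableSet B) :
    muAL (digAL ⁻¹' {a} ∩ altLuroth ⁻¹' B) =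
      ENNReal.ofReal (1 / (((a:ℝ) + 1) * ((a:ℝ) + 2))) * muAL B := by
  have hm : MeasurableSet (digAL ⁻¹' {a} ∩ altLuroth ⁻¹' B) :=
    (measurable_digAL (measurableSet_singleton a)).inter (measurable_altLuroth hB)
  have hc : (((a:ℝ) + 1) * ((a:ℝ) + 2)) ≠ 0 := by positivity
  rw [muAL, Measure.restrict_apply hm, cyl_preimage, Real.volume_preimage_mul_left hc,
    (volume.measurePreserving_sub_left ((a:ℝ)+2)).measure_preimage
      (hB.inter measurableSet_Ico).nullMeasurableSet, ← Measure.restrict_apply hB,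
    Measure.restrict_congr_set (Ico_ae_eq_Ioc (μ := volume) (a := (0:ℝ)) (b := 1)),
    abs_of_pos (by positivity), one_div]

lemma mu_dig (a : ℕ) : muAL (digAL ⁻¹' {a}) = ENNReal.ofReal (1 / (((a:ℝ) + 1) * ((a:ℝ) + 2))) := by
  have := mu_cyl a MeasurableSet.univ
  simpa using this

lemma mu_indep (s : Set ℕ) {B : Set ℝ} (hB : MeasurableSet B) :
    muAL (digAL ⁻¹' s ∩ altLuroth ⁻¹' B) = muAL (digAL ⁻¹' s) * muAL B := by
  have h : (muAL.restrict (altLuroth ⁻¹' B)).map digAL = muAL B • muAL.map digAL := by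
    refine Measure.ext_of_singleton fun a => ?_
    rw [Measure.map_apply measurable_digAL (measurableSet_singleton a),
      Measure.restrict_apply (measurable_digAL (measurableSet_singleton a)), mu_cyl a hB,
      Measure.smul_apply, Measure.map_apply measurable_digAL (measurableSet_singleton a), mu_dig,
      smul_eq_mul, mul_comm]
  have hs : MeasurableSet s := MeasurableSet.of_discrete
  have := congrArg (fun ν => ν s) h
  simp only [Measure.smul_apply, smul_eq_mul] at this
  rw [Measure.map_apply measurable_digAL hs, Measure.map_apply measurable_digAL hs,
    Measure.restrict_apply (measurable_digAL hs)] at this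
  rw [this, mul_comm]

lemma mp_altLuroth : MeasurePreserving altLuroth muAL muAL := by
  refine ⟨measurable_altLuroth, Measure.ext fun B hB => ?_⟩
  rw [Measure.map_apply measurable_altLuroth hB]
  have := mu_indep univ hB
  simpa using this

noncomputable def XAL (i : ℕ) (x : ℝ) : ℝ := fAL (digAL (altLuroth^[i] x))

lemma measurable_fdig : Measurable (fun x => fAL (digAL x)) :=
  (measurable_of_countable fAL).comp measurable_digAL

lemma measurable_XAL (i : ℕ) : Measurable (XAL i) :=
  measurable_fdig.comp (mp_altLuroth.iterate i).measurable

lemma XAL_add (i j : ℕ) : XAL (i + j) = XAL j ∘ altLuroth^[i] := by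
  funext x
  simp only [XAL, Function.comp]
  rw [← Function.iterate_add_apply, add_comm]

lemma ident_XAL (i : ℕ) : ProbabilityTheory.IdentDistrib (XAL i) (XAL 0) muAL muAL := by
  refine ⟨(measurable_XAL i).aemeasurable, (measurable_XAL 0).aemeasurable, ?_⟩
  have : XAL i = XAL 0 ∘ altLuroth^[i] := XAL_add i 0
  rw [this, ← Measure.map_map (measurable_XAL 0) (mp_altLuroth.iterate i).measurable,
    (mp_altLuroth.iterate i).map_eq]

lemma indep_lt {i j : ℕ} (h : i < j) : ProbabilityTheory.IndepFun (XAL i) (XAL j) muAL := by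
  obtain ⟨d, rfl⟩ : ∃ d, j = i + (1 + d) := ⟨j - i - 1, by omega⟩
  have hi : XAL i = XAL 0 ∘ altLuroth^[i] := XAL_add i 0
  rw [ProbabilityTheory.indepFun_iff_measure_inter_preimage_eq_mul]
  intro s t hs ht
  have mi := mp_altLuroth.iterate i
  rw [XAL_add i, hi, preimage_comp, preimage_comp, ← preimage_inter,
    mi.measure_preimage (((measurable_XAL 0) hs).inter ((measurable_XAL _) ht)).nullMeasurableSet,
    mi.measure_preimage ((measurable_XAL 0) hs).nullMeasurableSet,
    mi.measure_preimage ((measurable_XAL _) ht).nullMeasurableSet, XAL_add 1 d, preimage_comp,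
    Function.iterate_one, mp_altLuroth.measure_preimage ((measurable_XAL _) ht).nullMeasurableSet]
  exact mu_indep (fAL ⁻¹' s) ((measurable_XAL d) ht)

lemma summable_AL : Summable (fun k : ℕ => fAL k / (((k : ℝ) + 1) * ((k : ℝ) + 2))) := by
  have h1 : Summable (fun k : ℕ => (((k + 1 : ℕ) : ℝ) ^ (-(3/2) : ℝ))) :=
    (summable_nat_add_iff 1).2 (Real.summable_nat_rpow.2 (by norm_num))
  refine Summable.of_nonneg_of_le (fun k => ?_) (fun k => ?_) (h1.mul_left 4)
  · have hk : (0:ℝ) ≤ k := Nat.cast_nonneg k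
    exact div_nonneg (Real.log_nonneg (by nlinarith)) (by positivity)
  · have hk : (0:ℝ) ≤ k := Nat.cast_nonneg k
    set c : ℝ := ((k : ℝ) + 1) * ((k : ℝ) + 2) with hc
    have hcp : 0 < c := by positivity
    have h2 : fAL k ≤ c ^ (1/4 : ℝ) / (1/4) := Real.log_le_rpow_div hcp.le (by norm_num)
    calc fAL k / c ≤ (c ^ (1/4 : ℝ) / (1/4)) / c := by gcongr
      _ = 4 * c ^ (-(3/4) : ℝ) := by
        have : c ^ (-(3/4) : ℝ) = c ^ (1/4:ℝ) / c := by
          rw [← Real.rpow_sub_one hcp.ne']; norm_num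
        rw [this]; ring
      _ ≤ 4 * (((k:ℝ)+1)^(2:ℝ)) ^ (-(3/4) : ℝ) := by
        gcongr 4 * ?_
        refine Real.rpow_le_rpow_of_nonpos (by positivity) ?_ (by norm_num)
        rw [Real.rpow_two, hc]; nlinarith
      _ = 4 * (((k + 1 : ℕ) : ℝ) ^ (-(3/2) : ℝ)) := by
        rw [← Real.rpow_mul (by positivity)]; push_cast; norm_num

lemma fAL_nonneg (k : ℕ) : 0 ≤ fAL k := by
  have hk : (0:ℝ) ≤ k := Nat.cast_nonneg k
  exact Real.log_nonneg (by nlinarith)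

lemma integrable_fAL : Integrable fAL (muAL.map digAL) := by
  refine ⟨(measurable_of_countable fAL).aestronglyMeasurable, ?_⟩
  rw [hasFiniteIntegral_iff_norm, lintegral_countable']
  have : ∀ a, ENNReal.ofReal ‖fAL a‖ * (muAL.map digAL) {a} =
      ENNReal.ofReal (fAL a / (((a : ℝ) + 1) * ((a : ℝ) + 2))) := by
    intro a
    rw [Measure.map_apply measurable_digAL (measurableSet_singleton a), mu_dig,
      ← ENNReal.ofReal_mul (norm_nonneg _), Real.norm_of_nonneg (fAL_nonneg a)]
    congr 1; ring
  simp only [this]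
  exact lt_top_iff_ne_top.2 summable_AL.tsum_ofReal_ne_top

lemma integrable_XAL : Integrable (XAL 0) muAL :=
  (integrable_map_measure integrable_fAL.1 measurable_digAL.aemeasurable).1 integrable_fAL

lemma integral_XAL : ∫ x, XAL 0 x ∂muAL =
    ∑' k : ℕ, Real.log (((k : ℝ) + 1) * ((k : ℝ) + 2)) / (((k : ℝ) + 1) * ((k : ℝ) + 2)) := by
  have h := integral_map measurable_digAL.aemeasurable integrable_fAL.1
  change _ = ∫ x, XAL 0 x ∂muAL at h
  rw [← h, integral_countable integrable_fAL]
  refine tsum_congr fun a => ?_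
  rw [Measure.real, Measure.map_apply measurable_digAL (measurableSet_singleton a), mu_dig,
    ENNReal.toReal_ofReal (by positivity), smul_eq_mul, fAL]
  ring

lemma entropy_pos : 0 < ∑' k : ℕ, Real.log (((k : ℝ) + 1) * ((k : ℝ) + 2)) / (((k : ℝ) + 1) * ((k : ℝ) + 2)) := by
  refine summable_AL.tsum_pos (fun k => div_nonneg (fAL_nonneg k) (by positivity)) 0 ?_
  have : 0 < Real.log 2 := Real.log_pos (by norm_num)
  simp only [fAL, Nat.cast_zero, zero_add, one_mul]
  positivity

lemma XAL_eq {x : ℝ} (hx : x ∈ Ioo (0:ℝ) 1) (hi : Irrational x) (i : ℕ) :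
    XAL i x = Real.log (slopeAL (altLuroth^[i] x)) := by
  have h := (iter_good hx hi i).1
  have := floor_digAL ⟨h.1, h.2.le⟩
  unfold XAL fAL slopeAL
  rw [this]; push_cast; ring_nf

lemma ae_irrational : ∀ᵐ x ∂(volume : Measure ℝ), Irrational x := by
  have : (volume : Measure ℝ) (range ((↑) : ℚ → ℝ)) = 0 := (countable_range _).measure_zero _
  exact measure_eq_zero_iff_ae_notMem.1 this

theorem radix_vs_alternating_luroth (g : ℕ) (hg : 2 ≤ g) :
    ∀ᵐ x ∂(volume : Measure ℝ), x ∈ Set.Ioo (0 : ℝ) 1 →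
      Tendsto (fun n : ℕ => (mRadixALE g x n : ℝ) / n) atTop
        (nhds (Real.log g /
          ∑' k : ℕ, Real.log (((k : ℝ) + 1) * ((k : ℝ) + 2)) / (((k : ℝ) + 1) * ((k : ℝ) + 2)))) := by
  have hslln := ProbabilityTheory.strong_law_ae_real XAL integrable_XAL
    (fun i j hij => by
      rcases lt_or_gt_of_ne hij with h | h
      · exact indep_lt h
      · exact (indep_lt h).symm) ident_XAL
  rw [integral_XAL, muAL, ae_restrict_iff' measurableSet_Ioc] at hslln
  filter_upwards [hslln, ae_irrational] with x hx hi hx01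
  have h := hx ⟨hx01.1, hx01.2.le⟩
  simp only [XAL_eq hx01 hi] at h
  exact det_limit hg hx01 hi h entropy_pos.ne'
end

section
/- Let g, h ≥ 2 be integers. For every x ∈ [0,1) and every n ≥ 1 at which m_g^{(h)}(x,·) jumps, i.e. m_g^{(h)}(x,n) > m_g^{(h)}(x,n−1), one has g^{n−1} ≤ h^{m_g^{(h)}(x,n)+1}. -/
open MeasureTheory Filter Set

/-- `mRadix g h x n` is the largest `m` with `A_n^{(g)}(x) ⊆ A_m^{(h)}(x)`. -/
noncomputable def mRadix (g h : ℕ) (x : ℝ) (n : ℕ) : ℕ :=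
  sSup {m : ℕ | radixCyl g n x ⊆ radixCyl h m x}

lemma radixCyl_subset_iff (g h : ℕ) (hg : 2 ≤ g) (x : ℝ) (n m : ℕ) :
    radixCyl g n x ⊆ radixCyl h m x ↔
      (⌊(h : ℝ) ^ m * x⌋ : ℝ) / (h : ℝ) ^ m ≤ (⌊(g : ℝ) ^ n * x⌋ : ℝ) / (g : ℝ) ^ n ∧
      ((⌊(g : ℝ) ^ n * x⌋ : ℝ) + 1) / (g : ℝ) ^ n ≤
        ((⌊(h : ℝ) ^ m * x⌋ : ℝ) + 1) / (h : ℝ) ^ m := by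
  have hgp : (0 : ℝ) < (g : ℝ) ^ n := by positivity
  unfold radixCyl
  apply Set.Ico_subset_Ico_iff
  gcongr
  linarith

lemma radix_bdd (g h : ℕ) (hg : 2 ≤ g) (hh : 2 ≤ h) (x : ℝ) (n : ℕ) :
    BddAbove {m : ℕ | radixCyl g n x ⊆ radixCyl h m x} := by
  refine ⟨g ^ n, fun m hm => ?_⟩
  obtain ⟨h1, h2⟩ := (radixCyl_subset_iff g h hg x n m).1 hm
  have hgp : (0 : ℝ) < (g : ℝ) ^ n := by positivity
  have hhp : (0 : ℝ) < (h : ℝ) ^ m := by positivity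
  rw [add_div, add_div] at h2
  have h3 : 1 / (g : ℝ) ^ n ≤ 1 / (h : ℝ) ^ m := by linarith
  have h4 : (h : ℝ) ^ m ≤ (g : ℝ) ^ n := le_of_one_div_le_one_div hgp h3
  have h5 : h ^ m ≤ g ^ n := by exact_mod_cast h4
  exact (Nat.lt_pow_self (by omega : 1 < h)).le.trans h5

lemma radix_floor_bounds (g : ℕ) (hg : 2 ≤ g) (x : ℝ) (n : ℕ) :
    (⌊(g : ℝ) ^ n * x⌋ : ℝ) / (g : ℝ) ^ n ≤ x ∧
      x < ((⌊(g : ℝ) ^ n * x⌋ : ℝ) + 1) / (g : ℝ) ^ n := by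
  have hgp : (0 : ℝ) < (g : ℝ) ^ n := by positivity
  rw [div_le_iff₀ hgp, lt_div_iff₀ hgp, mul_comm x]
  exact ⟨Int.floor_le _, Int.lt_floor_add_one _⟩

/-- Cylinders in the same base are nested. -/
lemma radix_nested (g : ℕ) (hg : 2 ≤ g) (x : ℝ) (n : ℕ) :
    radixCyl g (n + 1) x ⊆ radixCyl g n x := by
  rw [radixCyl_subset_iff g g hg]
  have hgp : (0 : ℝ) < (g : ℝ) ^ n := by positivity
  have hg0 : (0 : ℝ) < (g : ℝ) := by positivity
  have e : (g : ℝ) ^ (n + 1) * x = g * ((g : ℝ) ^ n * x) := by ring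
  set y := (g : ℝ) ^ n * x
  have k1 : (g : ℤ) * ⌊y⌋ ≤ ⌊(g : ℝ) * y⌋ := by
    rw [Int.le_floor]; push_cast
    exact mul_le_mul_of_nonneg_left (Int.floor_le y) hg0.le
  have k2 : ⌊(g : ℝ) * y⌋ + 1 ≤ (g : ℤ) * (⌊y⌋ + 1) := by
    rw [Int.add_one_le_iff, Int.floor_lt]; push_cast
    exact mul_lt_mul_of_pos_left (Int.lt_floor_add_one y) hg0
  have k1' : (g : ℝ) * ⌊y⌋ ≤ ⌊(g : ℝ) * y⌋ := by exact_mod_cast k1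
  have k2' : (⌊(g : ℝ) * y⌋ : ℝ) + 1 ≤ (g : ℝ) * (⌊y⌋ + 1) := by exact_mod_cast k2
  rw [e, pow_succ]
  constructor
  · rw [div_le_div_iff₀ hgp (by positivity)]; nlinarith
  · rw [div_le_div_iff₀ (by positivity) hgp]; nlinarith

theorem radix_jump_inequality (g h : ℕ) (hg : 2 ≤ g) (hh : 2 ≤ h)
    (x : ℝ) (hx : x ∈ Set.Ico (0 : ℝ) 1) (n : ℕ) (hn : 1 ≤ n)
    (hjump : mRadix g h x (n - 1) < mRadix g h x n) :
    g ^ (n - 1) ≤ h ^ (mRadix g h x n + 1) := by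
  obtain ⟨N, rfl⟩ : ∃ N, n = N + 1 := ⟨n - 1, by omega⟩
  simp only [Nat.add_sub_cancel] at *
  have hmem : radixCyl g (N + 1) x ⊆ radixCyl h (mRadix g h x (N + 1)) x := by
    have hne : {m : ℕ | radixCyl g (N + 1) x ⊆ radixCyl h m x}.Nonempty := by
      by_contra hc
      rw [Set.not_nonempty_iff_eq_empty] at hc
      have : mRadix g h x (N + 1) = 0 := by unfold mRadix; rw [hc]; simp
      omega
    exact Nat.sSup_mem hne (radix_bdd g h hg hh x (N + 1))
  have hnot : ¬ radixCyl g N x ⊆ radixCyl h (mRadix g h x (N + 1)) x := fun hc =>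
    absurd (le_csSup (radix_bdd g h hg hh x N) hc) (not_le.2 hjump)
  have hnot' : ¬ radixCyl g (N + 1) x ⊆ radixCyl h (mRadix g h x (N + 1) + 1) x := fun hc =>
    absurd (le_csSup (radix_bdd g h hg hh x (N + 1)) hc) (not_le.2 (Nat.lt_succ_self _))
  generalize mRadix g h x (N + 1) = m at *
  by_contra hlt
  rw [not_le] at hlt
  apply hnot'
  have hltR : (h : ℝ) ^ (m + 1) < (g : ℝ) ^ N := by exact_mod_cast hlt
  have hGp : (0 : ℝ) < (g : ℝ) ^ N := by positivity
  have hHp : (0 : ℝ) < (h : ℝ) ^ m := by positivity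
  have hKp : (0 : ℝ) < (h : ℝ) ^ (m + 1) := by positivity
  have hh0 : (0 : ℝ) < (h : ℝ) := by positivity
  have hε : 1 / (g : ℝ) ^ N < 1 / (h : ℝ) ^ (m + 1) := one_div_lt_one_div_of_lt hKp hltR
  obtain ⟨n1, n2⟩ := (radixCyl_subset_iff g g hg x (N + 1) N).1 (radix_nested g hg x N)
  obtain ⟨p1, p2⟩ := (radixCyl_subset_iff h h hh x (m + 1) m).1 (radix_nested h hh x m)
  obtain ⟨m1, m2⟩ := (radixCyl_subset_iff g h hg x (N + 1) m).1 hmem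
  obtain ⟨a1, a2⟩ := radix_floor_bounds g hg x N
  obtain ⟨d1, d2⟩ := radix_floor_bounds h hh x (m + 1)
  rw [radixCyl_subset_iff g h hg, not_and_or, not_le, not_le] at hnot
  rw [radixCyl_subset_iff g h hg]
  generalize ⌊(g : ℝ) ^ N * x⌋ = a at *
  generalize ⌊(g : ℝ) ^ (N + 1) * x⌋ = b at *
  generalize ⌊(h : ℝ) ^ m * x⌋ = c at *
  generalize ⌊(h : ℝ) ^ (m + 1) * x⌋ = d at *
  have ec : (c : ℝ) / (h : ℝ) ^ m = ((h * c : ℤ) : ℝ) / (h : ℝ) ^ (m + 1) := by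
    push_cast; rw [pow_succ]; field_simp
  have ec' : ((c : ℝ) + 1) / (h : ℝ) ^ m = ((h * (c + 1) : ℤ) : ℝ) / (h : ℝ) ^ (m + 1) := by
    push_cast; rw [pow_succ]; field_simp
  rw [ec] at m1 p1 hnot
  rw [ec'] at m2 p2 hnot
  rcases hnot with hc | hc
  · have hd : d < h * c + 1 := by
      have : (d : ℝ) / (h : ℝ) ^ (m + 1) < ((h * c : ℤ) + 1 : ℝ) / (h : ℝ) ^ (m + 1) := by
        have e1 := add_div (a : ℝ) 1 ((g : ℝ) ^ N)
        rw [add_div]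
        linarith
      rw [div_lt_div_iff_of_pos_right hKp] at this
      exact_mod_cast this
    have hd' : h * c ≤ d := by
      rw [div_le_div_iff_of_pos_right hKp] at p1
      exact_mod_cast p1
    obtain rfl : d = h * c := by omega
    refine ⟨m1, ?_⟩
    rw [add_div ((_ : ℤ) : ℝ) 1 ((h : ℝ) ^ (m + 1))]
    linarith [add_div (a : ℝ) 1 ((g : ℝ) ^ N)]
  · have hd : h * (c + 1) < d + 2 := by
      have : ((h * (c + 1) : ℤ) : ℝ) / (h : ℝ) ^ (m + 1) < (d + 2 : ℝ) / (h : ℝ) ^ (m + 1) := by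
        have e1 := add_div (a : ℝ) 1 ((g : ℝ) ^ N)
        have e2 := add_div (d : ℝ) 1 ((h : ℝ) ^ (m + 1))
        have e3 : (d + 2 : ℝ) / (h : ℝ) ^ (m + 1)
          = d / (h : ℝ) ^ (m + 1) + 1 / (h : ℝ) ^ (m + 1) + 1 / (h : ℝ) ^ (m + 1) := by ring
        linarith
      rw [div_lt_div_iff_of_pos_right hKp] at this
      exact_mod_cast this
    have hd' : d + 1 ≤ h * (c + 1) := by
      rw [div_le_div_iff_of_pos_right hKp] at p2
      exact_mod_cast p2
    have hdd : ((h * (c + 1) : ℤ) : ℝ) = d + 1 := by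
      have : h * (c + 1) = d + 1 := by omega
      exact_mod_cast this
    rw [hdd] at m2 hc
    refine ⟨?_, m2⟩
    have e1 := add_div (a : ℝ) 1 ((g : ℝ) ^ N)
    have e2 := add_div (d : ℝ) 1 ((h : ℝ) ^ (m + 1))
    linarith
end
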